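/- Let f: ℝ^k → ℝ be continuous with |f(x)| ≤ C(1+|x|^γ), let h: ℝ^k → ℝ be continuous and bounded, let X^x be the solution of a Lipschitz SDE started at x, and suppose E[∫_0^∞ e^{-rs}|f(X^x_s)| ds] < ∞. Define u(x) = sup over stopping times τ of E[∫_0^τ e^{-rl} f(X^x_l) dl + e^{-rτ} h(X^x_τ) 1_{τ<∞}]. Then u is continuous on ℝ^k. -/

import Mathlib

open MeasureTheory Filter Topology Set Matrix

/-- Frobenius norm of a real matrix. -/
noncomputable def matNorm {m n : Type*} [Fintype m] [Fintype n] (A : Matrix m n ℝ) : ℝ :=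
  Real.sqrt (∑ i, ∑ j, (A i j) ^ 2)

/-- A (weak/martingale-problem) solution of the SDE `dX_t = b(X_t)dt + σ(X_t)dB_t`, `X_0 = x`:
the paths are continuous and adapted, `X_t = x + ∫_0^t b(X_s)ds + M_t` where `M` is a
martingale whose predictable quadratic covariation is `∫_0^t (σσᵀ)(X_s)ds`, i.e. for all `i, j`,
`MⁱMʲ − ∫_0^t (σσᵀ)_{ij}(X_s)ds` is a martingale. -/
structure SDESolution {Ω : Type*} {mΩ : MeasurableSpace Ω} (μ : Measure Ω)
    (ℱ : Filtration ℝ mΩ) {k d : ℕ}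
    (b : EuclideanSpace ℝ (Fin k) → EuclideanSpace ℝ (Fin k))
    (σ : EuclideanSpace ℝ (Fin k) → Matrix (Fin k) (Fin d) ℝ)
    (x : EuclideanSpace ℝ (Fin k)) (X : ℝ → Ω → EuclideanSpace ℝ (Fin k)) where
  M : ℝ → Ω → EuclideanSpace ℝ (Fin k)
  adapted : Adapted ℱ X
  contPaths : ∀ ω, Continuous fun t => X t ω
  init : ∀ ω, X 0 ω = x
  mart : Martingale M ℱ μ
  eqn : ∀ ω, ∀ t ≥ (0:ℝ), X t ω = x + (∫ s in Set.Ioc (0:ℝ) t, b (X s ω)) + M t ω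
  qvar : ∀ i j : Fin k, Martingale
    (fun t ω => M t ω i * M t ω j -
      ∫ s in Set.Ioc (0:ℝ) t, ((σ (X s ω)) * (σ (X s ω))ᵀ) i j) ℱ μ


open scoped ENNReal

/-- A `[0,∞]`-valued stopping time. -/
def IsStoppingTimeENN {Ω : Type*} {mΩ : MeasurableSpace Ω} (ℱ : MeasureTheory.Filtration ℝ mΩ)
    (τ : Ω → ℝ≥0∞) : Prop :=
  ∀ t : ℝ, MeasurableSet[ℱ t] {ω | τ ω ≤ ENNReal.ofReal t}




abbrev EE (k : ℕ) := EuclideanSpace ℝ (Fin k)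

/-- Coefficients of the SDE with a finite random walk approximating the noise. -/
structure Coef (k : ℕ) where
  b : EE k → EE k
  m : ℕ
  p : Fin m → ℝ
  s : Fin m → EE k → EE k
  C : ℝ
  C_one : 1 ≤ C
  p_nn : ∀ l, 0 ≤ p l
  p_sum : ∑ l, p l = 1
  s_mean : ∀ x, ∑ l, p l • s l x = 0
  b_lip : ∀ x y, ‖b x - b y‖ ≤ C * ‖x - y‖
  s_lip : ∀ l x y, ‖s l x - s l y‖ ≤ C * ‖x - y‖
  b_gr : ∀ x, ‖b x‖ ≤ C * (1 + ‖x‖)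
  s_gr : ∀ l x, ‖s l x‖ ≤ C * (1 + ‖x‖)

namespace Coef

variable {k : ℕ} (c : Coef k)

/-- the increment of one (shaken) Euler step -/
noncomputable def eta (h : ℝ) (x : EE k) (l : Fin c.m) : EE k :=
  h • c.b x + Real.sqrt h • c.s l x

/-- one step operator with shaking `z` -/
noncomputable def T (h : ℝ) (z : EE k) (g : EE k → ℝ) (x : EE k) : ℝ :=
  ∑ l, c.p l * g (x + c.eta h (x + z) l)

/-- growth constant -/
noncomputable def kap : ℝ := 4 * c.C + 8 * c.C ^ 2

lemma kap_nn : 0 ≤ c.kap := by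
  have := c.C_one
  unfold kap; positivity

lemma sum_sq (u β : EE k) (ς : Fin c.m → EE k) (h : ℝ) (hh : 0 ≤ h)
    (hς : ∑ l, c.p l • ς l = 0) :
    ∑ l, c.p l * ‖u + (h • β + Real.sqrt h • ς l)‖ ^ 2
      = ‖u + h • β‖ ^ 2 + h * ∑ l, c.p l * ‖ς l‖ ^ 2 := by
  have h1 : ∀ l, c.p l * ‖u + (h • β + Real.sqrt h • ς l)‖ ^ 2
      = c.p l * ‖u + h • β‖ ^ 2 + 2 * Real.sqrt h * inner ℝ (u + h • β) (c.p l • ς l)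
        + h * (c.p l * ‖ς l‖ ^ 2) := by
    intro l
    rw [← add_assoc, norm_add_sq_real, inner_smul_right, inner_smul_right, norm_smul, mul_pow,
      Real.norm_eq_abs, sq_abs, Real.sq_sqrt hh]
    ring
  simp_rw [h1]
  rw [Finset.sum_add_distrib, Finset.sum_add_distrib, ← Finset.sum_mul, c.p_sum,
    ← Finset.mul_sum, ← inner_sum, hς, inner_zero_right, ← Finset.mul_sum]
  ring

lemma jensen_sqrt (v : Fin c.m → ℝ) (hv : ∀ l, 0 ≤ v l) :
    ∑ l, c.p l * Real.sqrt (v l) ≤ Real.sqrt (∑ l, c.p l * v l) := by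
  apply Real.le_sqrt_of_sq_le
  have h2 := Finset.sum_mul_sq_le_sq_mul_sq Finset.univ (fun l => Real.sqrt (c.p l))
    (fun l => Real.sqrt (c.p l) * Real.sqrt (v l))
  have e1 : ∀ l, Real.sqrt (c.p l) * (Real.sqrt (c.p l) * Real.sqrt (v l))
      = c.p l * Real.sqrt (v l) := by
    intro l; rw [← mul_assoc, Real.mul_self_sqrt (c.p_nn l)]
  have e2 : ∀ l, (Real.sqrt (c.p l) * Real.sqrt (v l)) ^ 2 = c.p l * v l := by
    intro l; rw [mul_pow, Real.sq_sqrt (c.p_nn l), Real.sq_sqrt (hv l)]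
  have e3 : ∀ l, Real.sqrt (c.p l) ^ 2 = c.p l := fun l => Real.sq_sqrt (c.p_nn l)
  simp only [e1, e2, e3, c.p_sum, one_mul] at h2
  exact h2

/-- one step coupling estimate -/
lemma coupling {h D : ℝ} (hh : 0 ≤ h) (hh1 : h ≤ 1) (hD : 0 ≤ D) (x y z z' : EE k)
    (hz : ‖z - z'‖ ≤ D) :
    ∑ l, c.p l * Real.sqrt (‖(x + c.eta h (x + z) l) - (y + c.eta h (y + z') l)‖ ^ 2 + D ^ 2)
      ≤ (1 + c.kap * h) * Real.sqrt (‖x - y‖ ^ 2 + D ^ 2) := by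
  have hC := c.C_one
  set q := Real.sqrt (‖x - y‖ ^ 2 + D ^ 2) with hq
  have hq0 : 0 ≤ q := Real.sqrt_nonneg _
  have hq2 : q ^ 2 = ‖x - y‖ ^ 2 + D ^ 2 := Real.sq_sqrt (by positivity)
  have hxy : ‖x - y‖ ≤ q := Real.le_sqrt_of_sq_le (by nlinarith)
  have hDq : D ≤ q := Real.le_sqrt_of_sq_le (by nlinarith [norm_nonneg (x - y)])
  have hd : ‖(x + z) - (y + z')‖ ≤ 2 * q := by
    calc ‖(x + z) - (y + z')‖ = ‖(x - y) + (z - z')‖ := by congr 1; abel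
      _ ≤ ‖x - y‖ + ‖z - z'‖ := norm_add_le _ _
      _ ≤ 2 * q := by linarith
  set u := x - y
  set β := c.b (x + z) - c.b (y + z')
  set ς : Fin c.m → EE k := fun l => c.s l (x + z) - c.s l (y + z')
  have hβ : ‖β‖ ≤ 2 * c.C * q := (c.b_lip _ _).trans (by nlinarith)
  have hςb : ∀ l, ‖ς l‖ ≤ 2 * c.C * q := fun l => (c.s_lip l _ _).trans (by nlinarith)
  have hς : ∑ l, c.p l • ς l = 0 := by
    simp only [ς, smul_sub, Finset.sum_sub_distrib, c.s_mean, sub_self]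
  have he : ∀ l, (x + c.eta h (x + z) l) - (y + c.eta h (y + z') l)
      = u + (h • β + Real.sqrt h • ς l) := by
    intro l; simp only [eta, u, β, ς, smul_sub]; abel
  have h1 := c.jensen_sqrt (fun l => ‖u + (h • β + Real.sqrt h • ς l)‖ ^ 2 + D ^ 2)
    (fun l => by positivity)
  have h2 : ∑ l, c.p l * (‖u + (h • β + Real.sqrt h • ς l)‖ ^ 2 + D ^ 2)
      = ‖u + h • β‖ ^ 2 + h * ∑ l, c.p l * ‖ς l‖ ^ 2 + D ^ 2 := by
    simp_rw [mul_add]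
    rw [Finset.sum_add_distrib, c.sum_sq u β ς h hh hς, ← Finset.sum_mul, c.p_sum, one_mul]
  have h3 : ∑ l, c.p l * ‖ς l‖ ^ 2 ≤ (2 * c.C * q) ^ 2 := by
    calc ∑ l, c.p l * ‖ς l‖ ^ 2 ≤ ∑ l, c.p l * (2 * c.C * q) ^ 2 := by
          apply Finset.sum_le_sum; intro l _
          exact mul_le_mul_of_nonneg_left (pow_le_pow_left₀ (norm_nonneg _) (hςb l) 2) (c.p_nn l)
      _ = _ := by rw [← Finset.sum_mul, c.p_sum, one_mul]
  have h4 : ‖u + h • β‖ ≤ ‖u‖ + h * (2 * c.C * q) := by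
    refine (norm_add_le _ _).trans ?_
    rw [norm_smul, Real.norm_of_nonneg hh]
    gcongr
  have h5 : ‖u + h • β‖ ^ 2 + h * ∑ l, c.p l * ‖ς l‖ ^ 2 + D ^ 2 ≤ q ^ 2 * (1 + c.kap * h) := by
    have h6 : ‖u + h • β‖ ^ 2 ≤ (‖u‖ + h * (2 * c.C * q)) ^ 2 :=
      pow_le_pow_left₀ (norm_nonneg _) h4 2
    have h7 : h * ∑ l, c.p l * ‖ς l‖ ^ 2 ≤ h * (2 * c.C * q) ^ 2 := by gcongr
    have h8 : ‖u‖ * (h * (2 * c.C * q)) ≤ q * (h * (2 * c.C * q)) := by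
      apply mul_le_mul_of_nonneg_right hxy; positivity
    have h9 : h * h * (2 * c.C * q) ^ 2 ≤ h * 1 * (2 * c.C * q) ^ 2 := by gcongr
    unfold kap
    nlinarith
  simp_rw [he]
  refine h1.trans ?_
  rw [h2]
  refine Real.sqrt_le_iff.mpr ⟨by have := c.kap_nn; positivity, h5.trans ?_⟩
  have h10 : 0 ≤ c.kap * h := mul_nonneg c.kap_nn hh
  rw [mul_pow, mul_comm]
  apply mul_le_mul_of_nonneg_right _ (by positivity)
  nlinarith

lemma T_step {h D L : ℝ} (hh : 0 ≤ h) (hh1 : h ≤ 1) (hD : 0 ≤ D) (hL : 0 ≤ L)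
    {g g' : EE k → ℝ} (hg : ∀ x y, g x - g' y ≤ L * Real.sqrt (‖x - y‖ ^ 2 + D ^ 2))
    (x y z z' : EE k) (hz : ‖z - z'‖ ≤ D) :
    c.T h z g x - c.T h z' g' y ≤ L * (1 + c.kap * h) * Real.sqrt (‖x - y‖ ^ 2 + D ^ 2) := by
  unfold T
  rw [← Finset.sum_sub_distrib]
  calc _ ≤ ∑ l, L * (c.p l * Real.sqrt
        (‖(x + c.eta h (x + z) l) - (y + c.eta h (y + z') l)‖ ^ 2 + D ^ 2)) := by
        apply Finset.sum_le_sum; intro l _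
        rw [← mul_sub]
        calc _ ≤ c.p l * (L * _) := mul_le_mul_of_nonneg_left (hg _ _) (c.p_nn l)
          _ = _ := by ring
    _ ≤ _ := by
        rw [← Finset.mul_sum, mul_assoc]
        exact mul_le_mul_of_nonneg_left (c.coupling hh hh1 hD x y z z' hz) hL

lemma T_le {h B : ℝ} (z : EE k) {g : EE k → ℝ} (hg : ∀ x, g x ≤ B) (x : EE k) :
    c.T h z g x ≤ B := by
  unfold T
  calc _ ≤ ∑ l, c.p l * B := Finset.sum_le_sum fun l _ =>
        mul_le_mul_of_nonneg_left (hg _) (c.p_nn l)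
    _ = B := by rw [← Finset.sum_mul, c.p_sum, one_mul]

lemma le_T {h B : ℝ} (z : EE k) {g : EE k → ℝ} (hg : ∀ x, B ≤ g x) (x : EE k) :
    B ≤ c.T h z g x := by
  unfold T
  calc B = ∑ l, c.p l * B := by rw [← Finset.sum_mul, c.p_sum, one_mul]
    _ ≤ _ := Finset.sum_le_sum fun l _ => mul_le_mul_of_nonneg_left (hg _) (c.p_nn l)

/-- upper shaken value function (index = number of steps to go) -/
noncomputable def Wp (h δ : ℝ) (F H : ℕ → EE k → ℝ) : ℕ → EE k → ℝ
  | 0 => H 0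
  | n + 1 => fun x => max (H (n + 1) x)
      ((⨆ z : Metric.closedBall (0 : EE k) δ, c.T h z (Wp h δ F H n) x) + h * F (n + 1) x)

/-- lower shaken value function -/
noncomputable def Wm (h δ : ℝ) (F H : ℕ → EE k → ℝ) : ℕ → EE k → ℝ
  | 0 => H 0
  | n + 1 => fun x => max (H (n + 1) x)
      ((⨅ z : Metric.closedBall (0 : EE k) δ, c.T h z (Wm h δ F H n) x) + h * F (n + 1) x)

/-- data assumptions -/
structure Dat (F H : ℕ → EE k → ℝ) (B L : ℝ) : Prop where
  B_nn : 0 ≤ B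
  L_nn : 0 ≤ L
  Fb : ∀ n x, |F n x| ≤ B
  Hb : ∀ n x, |H n x| ≤ B
  Fl : ∀ n x y, F n x - F n y ≤ L * ‖x - y‖
  Hl : ∀ n x y, H n x - H n y ≤ L * ‖x - y‖

/-- Lipschitz constant after `n` steps -/
noncomputable def Lc (h L : ℝ) (n : ℕ) : ℝ := (L + n * h * L) * (1 + c.kap * h) ^ n

lemma Lc_nn {h L : ℝ} (hh : 0 ≤ h) (hL : 0 ≤ L) (n : ℕ) : 0 ≤ c.Lc h L n := by
  have := c.kap_nn
  unfold Lc; positivity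

lemma Lc_ge {h L : ℝ} (hh : 0 ≤ h) (hL : 0 ≤ L) (n : ℕ) : L ≤ c.Lc h L n := by
  have := c.kap_nn
  have h1 : (1:ℝ) ≤ (1 + c.kap * h) ^ n := one_le_pow₀ (by nlinarith [mul_nonneg this hh])
  have h2 : 0 ≤ n * h * L := by positivity
  unfold Lc; nlinarith

lemma Lc_succ {h L : ℝ} (hh : 0 ≤ h) (hL : 0 ≤ L) (n : ℕ) :
    c.Lc h L n * (1 + c.kap * h) + h * L ≤ c.Lc h L (n + 1) := by
  have := c.kap_nn
  have h1 : (1:ℝ) ≤ (1 + c.kap * h) ^ (n + 1) := one_le_pow₀ (by nlinarith [mul_nonneg this hh])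
  have h2 : 0 ≤ h * L := by positivity
  unfold Lc; push_cast
  rw [mul_assoc, ← pow_succ]
  nlinarith

lemma Lc_le {h L T : ℝ} (hh : 0 ≤ h) (hL : 0 ≤ L) (n : ℕ) (hn : n * h ≤ T) :
    c.Lc h L n ≤ (L + T * L) * Real.exp (c.kap * T) := by
  have hk := c.kap_nn
  unfold Lc
  have h0 : 0 ≤ n * h := by positivity
  have h1 : (1 + c.kap * h) ^ n ≤ Real.exp (c.kap * T) := by
    calc (1 + c.kap * h) ^ n ≤ (Real.exp (c.kap * h)) ^ n := by
          apply pow_le_pow_left₀ (by positivity); linarith [Real.add_one_le_exp (c.kap * h)]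
      _ = Real.exp (c.kap * (n * h)) := by rw [← Real.exp_nat_mul]; ring_nf
      _ ≤ _ := Real.exp_le_exp.mpr (by gcongr)
  have h2 : n * h * L ≤ T * L := by gcongr
  have h3 : 0 ≤ T * L := le_trans (by positivity) h2
  apply mul_le_mul (by linarith) h1 (by positivity) (by positivity)

section
variable {c} {h δ B L : ℝ} {F H : ℕ → EE k → ℝ}

lemma Wp_abs (hh : 0 ≤ h) (hδ : 0 ≤ δ) (d : Dat F H B L) (n : ℕ) (x : EE k) :
    |c.Wp h δ F H n x| ≤ B * (1 + n * h) := by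
  have : Nonempty (Metric.closedBall (0 : EE k) δ) := ⟨⟨0, by simpa using hδ⟩⟩
  have hB := d.B_nn
  induction n generalizing x with
  | zero => simpa [Wp] using d.Hb 0 x
  | succ n ih =>
    have h1 : (⨆ z : Metric.closedBall (0 : EE k) δ, c.T h z (c.Wp h δ F H n) x) ≤ B * (1 + n * h) :=
      ciSup_le fun z => c.T_le _ (fun x => (abs_le.mp (ih x)).2) _
    have hHb := abs_le.mp (d.Hb (n + 1) x)
    have hFb := abs_le.mp (d.Fb (n + 1) x)
    have h3 : 0 ≤ B * (n * h) := by positivity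
    have h4 : 0 ≤ B * h := by positivity
    have h5 : h * F (n + 1) x ≤ h * B := by gcongr; exact hFb.2
    rw [abs_le]
    simp only [Wp]
    push_cast
    constructor
    · refine le_trans ?_ (le_max_left _ _)
      nlinarith
    · apply max_le
      · nlinarith
      · nlinarith

lemma Wm_abs (hh : 0 ≤ h) (hδ : 0 ≤ δ) (d : Dat F H B L) (n : ℕ) (x : EE k) :
    |c.Wm h δ F H n x| ≤ B * (1 + n * h) := by
  have : Nonempty (Metric.closedBall (0 : EE k) δ) := ⟨⟨0, by simpa using hδ⟩⟩
  have hB := d.B_nn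
  induction n generalizing x with
  | zero => simpa [Wm] using d.Hb 0 x
  | succ n ih =>
    have h1 : (⨅ z : Metric.closedBall (0 : EE k) δ, c.T h z (c.Wm h δ F H n) x) ≤ B * (1 + n * h) := by
      refine (ciInf_le ⟨-(B * (1 + n * h)), ?_⟩ ⟨0, by simpa using hδ⟩).trans
        (c.T_le _ (fun x => (abs_le.mp (ih x)).2) _)
      rintro _ ⟨z, rfl⟩
      exact c.le_T _ (fun x => (abs_le.mp (ih x)).1) _
    have hHb := abs_le.mp (d.Hb (n + 1) x)
    have hFb := abs_le.mp (d.Fb (n + 1) x)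
    have h3 : 0 ≤ B * (n * h) := by positivity
    have h4 : 0 ≤ B * h := by positivity
    have h5 : h * F (n + 1) x ≤ h * B := by gcongr; exact hFb.2
    rw [abs_le]
    simp only [Wm]
    push_cast
    constructor
    · refine le_trans ?_ (le_max_left _ _)
      nlinarith
    · apply max_le
      · nlinarith
      · nlinarith

lemma bdd_p (hh : 0 ≤ h) (hδ : 0 ≤ δ) (d : Dat F H B L) (n : ℕ) (x : EE k) :
    BddAbove (range fun z : Metric.closedBall (0 : EE k) δ => c.T h z (c.Wp h δ F H n) x) := by
  refine ⟨B * (1 + n * h), ?_⟩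
  rintro _ ⟨z, rfl⟩
  exact c.T_le _ (fun x => (abs_le.mp (Wp_abs hh hδ d n x)).2) _

lemma bdd_m (hh : 0 ≤ h) (hδ : 0 ≤ δ) (d : Dat F H B L) (n : ℕ) (x : EE k) :
    BddBelow (range fun z : Metric.closedBall (0 : EE k) δ => c.T h z (c.Wm h δ F H n) x) := by
  refine ⟨-(B * (1 + n * h)), ?_⟩
  rintro _ ⟨z, rfl⟩
  exact c.le_T _ (fun x => (abs_le.mp (Wm_abs hh hδ d n x)).1) _

lemma max_sub_le {a b a' b' e : ℝ} (h1 : a - a' ≤ e) (h2 : b - b' ≤ e) :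
    max a b - max a' b' ≤ e := by
  have := le_max_left a' b'
  have := le_max_right a' b'
  rcases max_cases a b with h | h <;> linarith

lemma norm_le_q (u : EE k) (D : ℝ) : ‖u‖ ≤ Real.sqrt (‖u‖ ^ 2 + D ^ 2) :=
  Real.le_sqrt_of_sq_le (by nlinarith)

/-- common step of the three stability estimates -/
lemma step_aux (hh : 0 ≤ h) (d : Dat F H B L) {n : ℕ} {D : ℝ} (x y : EE k) {S S' : ℝ}
    (hS : S - S' ≤ c.Lc h L n * (1 + c.kap * h) * Real.sqrt (‖x - y‖ ^ 2 + D ^ 2)) :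
    max (H (n + 1) x) (S + h * F (n + 1) x) - max (H (n + 1) y) (S' + h * F (n + 1) y)
      ≤ c.Lc h L (n + 1) * Real.sqrt (‖x - y‖ ^ 2 + D ^ 2) := by
  have hq := norm_le_q (x - y) D
  set q := Real.sqrt (‖x - y‖ ^ 2 + D ^ 2)
  have hq0 : 0 ≤ q := Real.sqrt_nonneg _
  have hL := d.L_nn
  apply max_sub_le
  · calc _ ≤ L * ‖x - y‖ := d.Hl _ _ _
      _ ≤ L * q := by gcongr
      _ ≤ _ := by gcongr; exact c.Lc_ge hh hL _
  · have h1 : F (n + 1) x - F (n + 1) y ≤ L * q := (d.Fl _ _ _).trans (by gcongr)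
    have h2 := mul_le_mul_of_nonneg_left h1 hh
    have h3 := mul_le_mul_of_nonneg_right (c.Lc_succ hh hL n) hq0
    linarith

lemma Wp_lip' (hh : 0 ≤ h) (hh1 : h ≤ 1) (hδ : 0 ≤ δ) (d : Dat F H B L) (n : ℕ) (x y : EE k) :
    c.Wp h δ F H n x - c.Wp h δ F H n y ≤ c.Lc h L n * Real.sqrt (‖x - y‖ ^ 2 + 0 ^ 2) := by
  have : Nonempty (Metric.closedBall (0 : EE k) δ) := ⟨⟨0, by simpa using hδ⟩⟩
  induction n generalizing x y with
  | zero => simpa [Wp, Lc] using d.Hl 0 x y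
  | succ n ih =>
    apply step_aux hh d
    rw [sub_le_iff_le_add]
    refine ciSup_le fun z => ?_
    have h1 := c.T_step hh hh1 le_rfl (c.Lc_nn hh d.L_nn n) ih x y z z (by simp)
    have h2 := le_ciSup (bdd_p (c := c) hh hδ d n y) z
    linarith

lemma Wm_lip' (hh : 0 ≤ h) (hh1 : h ≤ 1) (hδ : 0 ≤ δ) (d : Dat F H B L) (n : ℕ) (x y : EE k) :
    c.Wm h δ F H n x - c.Wm h δ F H n y ≤ c.Lc h L n * Real.sqrt (‖x - y‖ ^ 2 + 0 ^ 2) := by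
  have : Nonempty (Metric.closedBall (0 : EE k) δ) := ⟨⟨0, by simpa using hδ⟩⟩
  induction n generalizing x y with
  | zero => simpa [Wm, Lc] using d.Hl 0 x y
  | succ n ih =>
    apply step_aux hh d
    rw [sub_le_comm]
    refine le_ciInf fun z => ?_
    have h1 := c.T_step hh hh1 le_rfl (c.Lc_nn hh d.L_nn n) ih x y z z (by simp)
    have h2 := ciInf_le (bdd_m (c := c) hh hδ d n x) z
    linarith

lemma Wp_lip (hh : 0 ≤ h) (hh1 : h ≤ 1) (hδ : 0 ≤ δ) (d : Dat F H B L) (n : ℕ) (x y : EE k) :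
    c.Wp h δ F H n x - c.Wp h δ F H n y ≤ c.Lc h L n * ‖x - y‖ := by
  simpa using Wp_lip' (c := c) hh hh1 hδ d n x y

lemma Wm_lip (hh : 0 ≤ h) (hh1 : h ≤ 1) (hδ : 0 ≤ δ) (d : Dat F H B L) (n : ℕ) (x y : EE k) :
    c.Wm h δ F H n x - c.Wm h δ F H n y ≤ c.Lc h L n * ‖x - y‖ := by
  simpa using Wm_lip' (c := c) hh hh1 hδ d n x y

lemma Wp_Wm (hh : 0 ≤ h) (hh1 : h ≤ 1) (hδ : 0 ≤ δ) (d : Dat F H B L) (n : ℕ) (x y : EE k) :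
    c.Wp h δ F H n x - c.Wm h δ F H n y ≤ c.Lc h L n * Real.sqrt (‖x - y‖ ^ 2 + (2 * δ) ^ 2) := by
  have : Nonempty (Metric.closedBall (0 : EE k) δ) := ⟨⟨0, by simpa using hδ⟩⟩
  induction n generalizing x y with
  | zero =>
    have h1 : L * ‖x - y‖ ≤ L * Real.sqrt (‖x - y‖ ^ 2 + (2 * δ) ^ 2) :=
      mul_le_mul_of_nonneg_left (norm_le_q _ _) d.L_nn
    simpa [Wm, Wp, Lc] using (d.Hl 0 x y).trans h1
  | succ n ih =>
    apply step_aux hh d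
    rw [sub_le_iff_le_add]
    refine ciSup_le fun z => ?_
    rw [← sub_le_iff_le_add']
    refine le_ciInf fun z' => ?_
    have hz : ‖(z : EE k) - z'‖ ≤ 2 * δ := by
      have h1 : ‖(z : EE k)‖ ≤ δ := mem_closedBall_zero_iff.mp z.2
      have h2 : ‖(z' : EE k)‖ ≤ δ := mem_closedBall_zero_iff.mp z'.2
      linarith [norm_sub_le (z : EE k) z']
    have h1 := c.T_step hh hh1 (by positivity) (c.Lc_nn hh d.L_nn n) ih x y z z' hz
    linarith

/-- super-solution property before mollification -/
lemma Wp_super (hh : 0 ≤ h) (hδ : 0 ≤ δ) (d : Dat F H B L) (n : ℕ) (x z : EE k) (hz : ‖z‖ ≤ δ) :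
    c.T h z (c.Wp h δ F H n) x + h * F (n + 1) x ≤ c.Wp h δ F H (n + 1) x := by
  refine le_trans ?_ (le_max_right _ _)
  have := le_ciSup (bdd_p (c := c) hh hδ d n x) ⟨z, by simpa using hz⟩
  simpa using this

lemma Wp_ge (n : ℕ) (x : EE k) : H n x ≤ c.Wp h δ F H n x := by
  cases n with
  | zero => exact le_rfl
  | succ n => exact le_max_left _ _

lemma Wm_sub (hh : 0 ≤ h) (hδ : 0 ≤ δ) (d : Dat F H B L) (n : ℕ) (x z : EE k) (hz : ‖z‖ ≤ δ)
    (hx : H (n + 1) x < c.Wm h δ F H (n + 1) x) :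
    c.Wm h δ F H (n + 1) x ≤ c.T h z (c.Wm h δ F H n) x + h * F (n + 1) x := by
  have := ciInf_le (bdd_m (c := c) hh hδ d n x) ⟨z, by simpa using hz⟩
  simp only [Wm] at hx ⊢
  rcases lt_max_iff.mp hx with h1 | h1
  · exact absurd h1 (lt_irrefl _)
  · rw [max_eq_right h1.le]
    simpa using this

end

end Coef



lemma one_add_pow_bound (m : ℕ) (K : ℝ) (hK : 0 ≤ K) : ∃ Q : ℝ, 0 ≤ Q ∧ ∀ e : ℝ, -1 ≤ e → e ≤ K →
    (1 + e) ^ m ≤ 1 + m * e + Q * e ^ 2 := by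
  induction m with
  | zero => exact ⟨0, le_rfl, fun e _ _ => by simp⟩
  | succ m ih =>
    obtain ⟨Q, hQ, h⟩ := ih
    refine ⟨m + Q * (1 + K), by positivity, fun e h1 h2 => ?_⟩
    have h3 := mul_le_mul_of_nonneg_right (h e h1 h2) (by linarith : 0 ≤ 1 + e)
    rw [pow_succ]
    refine h3.trans ?_
    push_cast
    have h4 : 0 ≤ Q * e ^ 2 := by positivity
    nlinarith [mul_le_mul_of_nonneg_left h2 h4]

namespace Coef

variable {k : ℕ} (c : Coef k)

lemma eta_norm {h : ℝ} (hh : 0 ≤ h) (hh1 : h ≤ 1) (x : EE k) (l : Fin c.m) :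
    ‖c.eta h x l‖ ≤ 2 * c.C * Real.sqrt h * (1 + ‖x‖) := by
  have hC := c.C_one
  have h1 : h ≤ Real.sqrt h := Real.le_sqrt_of_sq_le (by nlinarith)
  have hs := Real.sqrt_nonneg h
  unfold eta
  calc _ ≤ ‖h • c.b x‖ + ‖Real.sqrt h • c.s l x‖ := norm_add_le _ _
    _ = h * ‖c.b x‖ + Real.sqrt h * ‖c.s l x‖ := by
        rw [norm_smul, norm_smul, Real.norm_of_nonneg hh, Real.norm_of_nonneg hs]
    _ ≤ Real.sqrt h * (c.C * (1 + ‖x‖)) + Real.sqrt h * (c.C * (1 + ‖x‖)) := by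
        gcongr
        · exact c.b_gr x
        · exact c.s_gr l x
    _ = _ := by ring

lemma T_moment (m : ℕ) : ∃ κ : ℝ, 0 ≤ κ ∧ ∀ (h : ℝ), 0 ≤ h → h ≤ 1 → ∀ z : EE k, ‖z‖ ≤ 1 → ∀ x,
    c.T h z (fun y => (1 + ‖y‖ ^ 2) ^ m) x ≤ (1 + κ * h) * (1 + ‖x‖ ^ 2) ^ m := by
  have hC := c.C_one
  set c1 := 8 * c.C + 24 * c.C ^ 2 with hc1
  have hc1n : 0 ≤ c1 := by positivity
  obtain ⟨Q, hQ, hpow⟩ := one_add_pow_bound m c1 hc1n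
  refine ⟨m * c1 + Q * c1 ^ 2, by positivity, fun h hh hh1 z hz x => ?_⟩
  set A := 1 + ‖x‖ ^ 2 with hA
  have hA0 : 0 < A := by positivity
  set η := fun l => c.eta h (x + z) l with hη
  have hsq : Real.sqrt h ^ 2 = h := Real.sq_sqrt hh
  have hs0 := Real.sqrt_nonneg h
  have hs1 : Real.sqrt h ≤ 1 := by rw [Real.sqrt_le_left (by norm_num)]; simpa using hh1
  have hx0 := norm_nonneg x
  have hηn : ∀ l, ‖η l‖ ≤ 2 * c.C * Real.sqrt h * (2 + ‖x‖) := by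
    intro l
    refine (c.eta_norm hh hh1 (x + z) l).trans ?_
    gcongr 2 * c.C * Real.sqrt h * ?_
    linarith [norm_add_le x z]
  have hη2 : ∀ l, ‖η l‖ ^ 2 ≤ 24 * c.C ^ 2 * h * A := by
    intro l
    calc ‖η l‖ ^ 2 ≤ (2 * c.C * Real.sqrt h * (2 + ‖x‖)) ^ 2 :=
          pow_le_pow_left₀ (norm_nonneg _) (hηn l) 2
      _ = 4 * c.C ^ 2 * h * (2 + ‖x‖) ^ 2 := by rw [mul_pow, mul_pow, mul_pow, hsq]; ring
      _ ≤ 4 * c.C ^ 2 * h * (6 * A) := by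
          gcongr
          nlinarith [sq_nonneg (‖x‖ - 1)]
      _ = _ := by ring
  set e := fun l => (2 * inner ℝ x (η l) + ‖η l‖ ^ 2) / A with he
  have heA : ∀ l, 1 + ‖x + η l‖ ^ 2 = A * (1 + e l) := by
    intro l
    rw [norm_add_sq_real, he]; field_simp; ring
  have he1 : ∀ l, -1 ≤ e l := by
    intro l
    have h1 : 0 ≤ A * (1 + e l) := by rw [← heA]; positivity
    nlinarith [(mul_nonneg_iff_of_pos_left hA0).mp h1]
  have hea : ∀ l, |e l| ≤ Real.sqrt h * c1 := by
    intro l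
    rw [he]
    simp only
    rw [abs_div, abs_of_pos hA0, div_le_iff₀ hA0]
    have h1 : |inner ℝ x (η l)| ≤ ‖x‖ * (2 * c.C * Real.sqrt h * (2 + ‖x‖)) :=
      (abs_real_inner_le_norm _ _).trans (by gcongr; exact hηn l)
    have h2 : |2 * inner ℝ x (η l) + ‖η l‖ ^ 2| ≤ 2 * |inner ℝ x (η l)| + ‖η l‖ ^ 2 := by
      refine (abs_add_le _ _).trans ?_
      rw [abs_mul, abs_of_pos (by norm_num : (0:ℝ) < 2), abs_of_nonneg (sq_nonneg ‖η l‖)]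
    have h3 : ‖x‖ * (2 + ‖x‖) ≤ 2 * A := by nlinarith [sq_nonneg (‖x‖ - 1)]
    have h4 : h ≤ Real.sqrt h := by nlinarith
    have h5 := hη2 l
    have h6 : 24 * c.C ^ 2 * h * A ≤ 24 * c.C ^ 2 * Real.sqrt h * A := by gcongr
    have h7 : 4 * c.C * Real.sqrt h * (‖x‖ * (2 + ‖x‖)) ≤ 4 * c.C * Real.sqrt h * (2 * A) := by
      gcongr
    rw [hc1]
    nlinarith
  have hee : ∀ l, e l ^ 2 ≤ h * c1 ^ 2 := by
    intro l
    rw [← sq_abs, ← hsq, ← mul_pow]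
    exact pow_le_pow_left₀ (abs_nonneg _) (hea l) 2
  have hmean : ∑ l, c.p l * e l ≤ h * c1 := by
    have h1 : ∑ l, c.p l * inner ℝ x (η l) = h * inner ℝ x (c.b (x + z)) := by
      have : ∀ l, c.p l * inner ℝ x (η l)
          = c.p l * (h * inner ℝ x (c.b (x + z))) + Real.sqrt h * inner ℝ x (c.p l • c.s l (x + z)) := by
        intro l
        simp only [hη, eta, inner_add_right, inner_smul_right]; ring
      simp_rw [this]
      rw [Finset.sum_add_distrib, ← Finset.sum_mul, c.p_sum, ← Finset.mul_sum, ← inner_sum,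
        c.s_mean, inner_zero_right]; ring
    have h2 : inner ℝ x (c.b (x + z)) ≤ 2 * c.C * A := by
      refine (real_inner_le_norm _ _).trans ?_
      have h3 : ‖c.b (x + z)‖ ≤ c.C * (2 + ‖x‖) := by
        refine (c.b_gr _).trans ?_
        gcongr c.C * ?_
        linarith [norm_add_le x z]
      calc ‖x‖ * ‖c.b (x + z)‖ ≤ ‖x‖ * (c.C * (2 + ‖x‖)) := by gcongr
        _ = c.C * (‖x‖ * (2 + ‖x‖)) := by ring
        _ ≤ c.C * (2 * A) := by
            gcongr c.C * ?_
            nlinarith [sq_nonneg (‖x‖ - 1)]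
        _ = _ := by ring
    have h4 : ∑ l, c.p l * ‖η l‖ ^ 2 ≤ 24 * c.C ^ 2 * h * A := by
      calc _ ≤ ∑ l, c.p l * (24 * c.C ^ 2 * h * A) := Finset.sum_le_sum fun l _ =>
            mul_le_mul_of_nonneg_left (hη2 l) (c.p_nn l)
        _ = _ := by rw [← Finset.sum_mul, c.p_sum, one_mul]
    have h5 : ∑ l, c.p l * e l
        = (2 * ∑ l, c.p l * inner ℝ x (η l) + ∑ l, c.p l * ‖η l‖ ^ 2) / A := by
      rw [Finset.mul_sum, ← Finset.sum_add_distrib, Finset.sum_div]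
      refine Finset.sum_congr rfl fun l _ => ?_
      simp only [he]; ring
    rw [h5, h1, div_le_iff₀ hA0, hc1]
    have h6 := mul_le_mul_of_nonneg_left h2 hh
    have h7 : 0 ≤ c.C * h * A := by positivity
    nlinarith
  have hterm : ∀ l, (1 + ‖x + η l‖ ^ 2) ^ m ≤ A ^ m * (1 + m * e l + Q * (h * c1 ^ 2)) := by
    intro l
    rw [heA, mul_pow]
    gcongr
    have h1 : e l ≤ c1 := (le_abs_self _).trans ((hea l).trans (by nlinarith))
    refine (hpow (e l) (he1 l) h1).trans ?_
    gcongr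
    exact hee l
  unfold T
  calc _ ≤ ∑ l, c.p l * (A ^ m * (1 + m * e l + Q * (h * c1 ^ 2))) := Finset.sum_le_sum fun l _ =>
        mul_le_mul_of_nonneg_left (hterm l) (c.p_nn l)
    _ = A ^ m * (1 + m * ∑ l, c.p l * e l + Q * (h * c1 ^ 2)) := by
        have : ∀ l, c.p l * (A ^ m * (1 + m * e l + Q * (h * c1 ^ 2)))
          = c.p l * (A ^ m * (1 + Q * (h * c1 ^ 2))) + A ^ m * m * (c.p l * e l) := by
          intro l; ring
        simp_rw [this]
        rw [Finset.sum_add_distrib, ← Finset.sum_mul, c.p_sum, ← Finset.mul_sum]; ring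
    _ ≤ A ^ m * (1 + m * (h * c1) + Q * (h * c1 ^ 2)) := by gcongr
    _ = _ := by ring

lemma T_mono {h : ℝ} (z : EE k) {g g' : EE k → ℝ} (hg : ∀ x, g x ≤ g' x) (x : EE k) :
    c.T h z g x ≤ c.T h z g' x :=
  Finset.sum_le_sum fun l _ => mul_le_mul_of_nonneg_left (hg _) (c.p_nn l)

lemma Wp_moment (m : ℕ) : ∃ κ : ℝ, 0 ≤ κ ∧ ∀ (h δ : ℝ), 0 ≤ h → h ≤ 1 → 0 ≤ δ → δ ≤ 1 →
    ∀ H : ℕ → EE k → ℝ, (∀ n x, H n x ≤ (1 + ‖x‖ ^ 2) ^ m) → ∀ n x,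
    c.Wp h δ (fun _ _ => 0) H n x ≤ (1 + κ * h) ^ n * (1 + ‖x‖ ^ 2) ^ m := by
  obtain ⟨κ, hκ, hT⟩ := c.T_moment m
  refine ⟨κ, hκ, fun h δ hh hh1 hδ hδ1 H hH n => ?_⟩
  have : Nonempty (Metric.closedBall (0 : EE k) δ) := ⟨⟨0, by simpa using hδ⟩⟩
  have hκh : 0 ≤ κ * h := by positivity
  induction n with
  | zero => intro x; simpa [Wp] using hH 0 x
  | succ n ih =>
    intro x
    simp only [Wp, mul_zero, add_zero]
    have h1 : 1 ≤ (1 + κ * h) ^ (n + 1) := one_le_pow₀ (by linarith)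
    have hV : 0 ≤ (1 + ‖x‖ ^ 2) ^ m := by positivity
    apply max_le
    · exact (hH _ _).trans (le_mul_of_one_le_left hV h1)
    · refine ciSup_le fun z => ?_
      have hz : ‖(z : EE k)‖ ≤ 1 := (mem_closedBall_zero_iff.mp z.2).trans hδ1
      refine (c.T_mono z ih x).trans ?_
      have h2 : c.T h z (fun x => (1 + κ * h) ^ n * (1 + ‖x‖ ^ 2) ^ m) x
          = (1 + κ * h) ^ n * c.T h z (fun x => (1 + ‖x‖ ^ 2) ^ m) x := by
        unfold T; rw [Finset.mul_sum]; refine Finset.sum_congr rfl fun l _ => by ring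
      rw [h2, pow_succ, mul_assoc]
      gcongr
      exact hT h hh hh1 z hz x

end Coef



section taylor
variable {E : Type*} [NormedAddCommGroup E] [NormedSpace ℝ E]

lemma taylor_step1 {G : Type*} [NormedAddCommGroup G] [NormedSpace ℝ G] {f : E → G} {f' : E → E →L[ℝ] G} {K : ℝ}
    (hd : ∀ u, HasFDerivAt f (f' u) u) (hK0 : 0 ≤ K) (hK : ∀ u v, ‖f' u - f' v‖ ≤ K * ‖u - v‖) (u y : E) :
    ‖f (u + y) - f u - f' u y‖ ≤ K * ‖y‖ ^ 2 := by
  have := Convex.norm_image_sub_le_of_norm_hasFDerivWithin_le' (𝕜 := ℝ) (f := f)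
      (f' := f') (φ := f' u) (C := K * ‖y‖)
      (s := Metric.closedBall u ‖y‖) (x := u) (y := u + y)
      (fun v _ => (hd v).hasFDerivWithinAt)
      (fun v hv => by
        refine (hK v u).trans ?_
        gcongr
        rw [← dist_eq_norm]; exact hv)
      (convex_closedBall _ _) (by simp) (by simp)
  rw [add_sub_cancel_left] at this
  rw [pow_two, ← mul_assoc]
  exact this

lemma taylor_step2 {ρ : E → ℝ} {D : E → E →L[ℝ] ℝ} {A : E →L[ℝ] E →L[ℝ] ℝ} {K : ℝ}
    (d0 : ∀ u, HasFDerivAt ρ (D u) u) (hK0 : 0 ≤ K) (u : E) (hsym : ∀ v w, A v w = A w v)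
    (s1 : ∀ y, ‖D (u + y) - D u - A y‖ ≤ K * ‖y‖ ^ 2) (y : E) :
    |ρ (u + y) - ρ u - D u y - (1 / 2) * A y y| ≤ K * ‖y‖ ^ 3 := by
  have dF : ∀ v, HasFDerivAt (fun v => ρ (u + v) - D u v - (1 / 2) * A v v)
      (D (u + v) - D u - A v) v := by
    intro v
    have e1 : HasFDerivAt (fun v => ρ (u + v)) (D (u + v)) v := by
      have := (d0 (u + v)).comp v ((hasFDerivAt_id v).const_add u)
      exact this
    have e2 : HasFDerivAt (fun v => D u v) (D u) v := (D u).hasFDerivAt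
    have e3 : HasFDerivAt (fun v => A v v) ((A v).comp (ContinuousLinearMap.id ℝ E) + A.flip v) v := by
      have := (A.hasFDerivAt (x := v)).clm_apply (hasFDerivAt_id v)
      exact this
    refine ((e1.sub e2).sub (e3.const_mul (1 / 2))).congr_fderiv ?_
    ext w
    simp only [_root_.sub_apply, _root_.smul_apply, _root_.add_apply,
      ContinuousLinearMap.comp_apply, ContinuousLinearMap.id_apply, ContinuousLinearMap.flip_apply, smul_eq_mul]
    rw [hsym w v]
    ring
  have := Convex.norm_image_sub_le_of_norm_hasFDerivWithin_le (𝕜 := ℝ)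
      (f := fun v => ρ (u + v) - D u v - (1 / 2) * A v v)
      (f' := fun v => D (u + v) - D u - A v) (C := K * ‖y‖ ^ 2)
      (s := Metric.closedBall 0 ‖y‖) (x := 0) (y := y)
      (fun v _ => (dF v).hasFDerivWithinAt)
      (fun v hv => by
        refine (s1 v).trans ?_
        have : ‖v‖ ≤ ‖y‖ := by simpa using hv
        gcongr)
      (convex_closedBall _ _) (by simp) (by simp)
  simp only [Real.norm_eq_abs, sub_zero, add_zero, map_zero, mul_zero] at this
  calc _ = |ρ (u + y) - D u y - (1 / 2) * A y y - ρ u| := by congr 1; ring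
    _ ≤ K * ‖y‖ ^ 2 * ‖y‖ := this
    _ = _ := by ring

lemma taylor2_lip {G : Type*} [NormedAddCommGroup G] [NormedSpace ℝ G] {f : E → G}
    (h2 : ContDiff ℝ 1 f) (hc2 : HasCompactSupport f) :
    ∃ K : ℝ, 0 ≤ K ∧ ∀ u v, ‖f u - f v‖ ≤ K * ‖u - v‖ := by
  obtain ⟨K, hK⟩ := ContDiff.lipschitzWith_of_hasCompactSupport hc2 h2 one_ne_zero
  exact ⟨K, K.coe_nonneg, fun u v => hK.norm_sub_le u v⟩

lemma taylor2_aux {ρ : E → ℝ} (h1 : ContDiff ℝ 2 (fderiv ℝ ρ)) (hc1 : HasCompactSupport (fderiv ℝ ρ)) :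
    ∃ K : ℝ, 0 ≤ K ∧ ∀ u v, ‖fderiv ℝ (fderiv ℝ ρ) u - fderiv ℝ (fderiv ℝ ρ) v‖ ≤ K * ‖u - v‖ := by
  have h2 : ContDiff ℝ 1 (fderiv ℝ (fderiv ℝ ρ)) := h1.fderiv_right (by norm_num)
  have hc2 : HasCompactSupport (fderiv ℝ (fderiv ℝ ρ)) := hc1.fderiv (𝕜 := ℝ)
  exact taylor2_lip h2 hc2

lemma taylor2 {ρ : E → ℝ} (hρ : ContDiff ℝ 3 ρ) (hc : HasCompactSupport ρ) :
    ∃ K : ℝ, 0 ≤ K ∧ ∀ u y, |ρ (u + y) - ρ u - fderiv ℝ ρ u y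
      - (1 / 2) * fderiv ℝ (fderiv ℝ ρ) u y y| ≤ K * ‖y‖ ^ 3 := by
  have h1 : ContDiff ℝ 2 (fderiv ℝ ρ) := hρ.fderiv_right (by norm_num)
  have hc1 : HasCompactSupport (fderiv ℝ ρ) := hc.fderiv (𝕜 := ℝ)
  obtain ⟨K, hK0, hK⟩ := taylor2_aux h1 hc1
  have d0 : ∀ u, HasFDerivAt ρ (fderiv ℝ ρ u) u :=
    fun u => (hρ.differentiable three_ne_zero u).hasFDerivAt
  have d1 : ∀ u, HasFDerivAt (fderiv ℝ ρ) (fderiv ℝ (fderiv ℝ ρ) u) u :=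
    fun u => (h1.differentiable two_ne_zero u).hasFDerivAt
  have hs : ∀ u v w, fderiv ℝ (fderiv ℝ ρ) u v w = fderiv ℝ (fderiv ℝ ρ) u w v :=
    fun u v w => second_derivative_symmetric d0 (d1 u) v w
  exact ⟨K, hK0, fun u y => taylor_step2 d0 hK0 u (hs u) (fun y => taylor_step1 d1 hK0 hK u y) y⟩
end taylor



/-- smooth function with second-order Taylor data -/
structure SM {k : ℕ} (g : EE k → ℝ) (p : EE k → Fin k → ℝ) (q : EE k → Fin k → Fin k → ℝ)
    (K : ℝ) : Prop where
  K_nn : 0 ≤ K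
  g_meas : Measurable g
  p_meas : ∀ i, Measurable fun x => p x i
  q_meas : ∀ i j, Measurable fun x => q x i j
  g_bd : ∀ x, |g x| ≤ K
  p_bd : ∀ x i, |p x i| ≤ K
  q_bd : ∀ x i j, |q x i j| ≤ K
  taylor : ∀ x y, |g (x + y) - g x - ∑ i, p x i * y i - (1 / 2) * ∑ i, ∑ j, q x i j * (y i * y j)|
    ≤ K * (‖y‖ ^ 2 * min 1 ‖y‖)


section
variable {k : ℕ}

/-- mollifier -/
noncomputable def bump (k : ℕ) (δ : ℝ) (hδ : 0 < δ) : ContDiffBump (0 : EE k) where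
  rIn := δ / 2
  rOut := δ
  rIn_pos := by positivity
  rIn_lt_rOut := by linarith

noncomputable def rho (k : ℕ) (δ : ℝ) (hδ : 0 < δ) : EE k → ℝ := (bump k δ hδ).normed volume

noncomputable def moll (δ : ℝ) (hδ : 0 < δ) (w : EE k → ℝ) (x : EE k) : ℝ :=
  ∫ z, rho k δ hδ z * w (x - z)

variable {δ : ℝ} (hδ : 0 < δ)

lemma rho_contDiff : ContDiff ℝ 3 (rho k δ hδ) := (bump k δ hδ).contDiff_normed
lemma rho_cont : Continuous (rho k δ hδ) := (rho_contDiff hδ).continuous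
lemma rho_nn (z : EE k) : 0 ≤ rho k δ hδ z := (bump k δ hδ).nonneg_normed z
lemma rho_cpt : HasCompactSupport (rho k δ hδ) := (bump k δ hδ).hasCompactSupport_normed
lemma rho_int : ∫ z, rho k δ hδ z = 1 := (bump k δ hδ).integral_normed
lemma rho_integrable : Integrable (rho k δ hδ) := (bump k δ hδ).integrable_normed
lemma rho_supp (z : EE k) (hz : δ < ‖z‖) : rho k δ hδ z = 0 := by
  by_contra h
  have : z ∈ Function.support (rho k δ hδ) := h
  rw [rho, (bump k δ hδ).support_normed_eq] at this
  have h2 : ‖z‖ < δ := by simpa [bump] using this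
  linarith

lemma moll_integrable {w : EE k → ℝ} (hw : Continuous w) (x : EE k) :
    Integrable fun z => rho k δ hδ z * w (x - z) := by
  apply Continuous.integrable_of_hasCompactSupport
  · exact (rho_cont hδ).mul (hw.comp (by fun_prop))
  · exact (rho_cpt hδ).mul_right

lemma moll_mono {w w' : EE k → ℝ} (hw : Continuous w) (hw' : Continuous w') (x : EE k)
    (h : ∀ z, ‖z‖ ≤ δ → w (x - z) ≤ w' (x - z)) : moll δ hδ w x ≤ moll δ hδ w' x := by
  apply integral_mono (moll_integrable hδ hw x) (moll_integrable hδ hw' x)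
  intro z
  simp only
  by_cases hz : ‖z‖ ≤ δ
  · exact mul_le_mul_of_nonneg_left (h z hz) (rho_nn hδ z)
  · rw [rho_supp hδ z (not_le.mp hz)]; simp

lemma moll_const (a : ℝ) (x : EE k) : moll δ hδ (fun _ => a) x = a := by
  unfold moll; rw [integral_mul_const, rho_int, one_mul]

lemma moll_bd {w : EE k → ℝ} (hw : Continuous w) {B : ℝ} (hB : ∀ x, |w x| ≤ B) (x : EE k) :
    |moll δ hδ w x| ≤ B := by
  rw [abs_le]
  constructor
  · rw [← moll_const hδ (-B) x]
    exact moll_mono hδ continuous_const hw x fun z _ => (abs_le.mp (hB _)).1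
  · rw [← moll_const hδ B x]
    exact moll_mono hδ hw continuous_const x fun z _ => (abs_le.mp (hB _)).2

lemma cont_of_lip {w : EE k → ℝ} {L : ℝ} (hL : ∀ x y, w x - w y ≤ L * ‖x - y‖) : Continuous w := by
  have : LipschitzWith (Real.toNNReal L) w := by
    apply LipschitzWith.of_dist_le_mul
    intro x y
    rw [Real.dist_eq, dist_eq_norm]
    have h0 : L * ‖x - y‖ ≤ (Real.toNNReal L : ℝ) * ‖x - y‖ := by
      gcongr; exact Real.le_coe_toNNReal L
    rw [abs_le]
    have h1 := hL x y
    have h2 := hL y x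
    rw [norm_sub_rev] at h2
    constructor <;> linarith
  exact this.continuous

lemma moll_close {w : EE k → ℝ} {L : ℝ} (hL0 : 0 ≤ L) (hL : ∀ x y, w x - w y ≤ L * ‖x - y‖) (x : EE k) :
    |moll δ hδ w x - w x| ≤ L * δ := by
  have hw := cont_of_lip hL
  rw [abs_le]
  have h1 : moll δ hδ w x ≤ w x + L * δ := by
    rw [← moll_const hδ (w x + L * δ) x]
    refine moll_mono hδ hw continuous_const x fun z hz => ?_
    have := hL (x - z) x
    have h3 : ‖x - z - x‖ ≤ δ := by simpa using hz
    have h4 : L * ‖x - z - x‖ ≤ L * δ := by gcongr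
    linarith
  have h2 : w x - L * δ ≤ moll δ hδ w x := by
    rw [← moll_const hδ (w x - L * δ) x]
    refine moll_mono hδ continuous_const hw x fun z hz => ?_
    have := hL x (x - z)
    have h3 : ‖x - (x - z)‖ ≤ δ := by simpa using hz
    have h4 : L * ‖x - (x - z)‖ ≤ L * δ := by gcongr
    linarith
  constructor <;> linarith

/-- mollification of the affine combination appearing in the scheme -/
lemma moll_comb (c : Coef k) {w F : EE k → ℝ} (hw : Continuous w) (hF : Continuous F) (h : ℝ)
    (x : EE k) :
    moll δ hδ (fun y => ∑ l, c.p l * w (y + c.eta h x l) + h * F y) x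
      = c.T h 0 (moll δ hδ w) x + h * moll δ hδ F x := by
  unfold moll Coef.T
  have e : ∀ z, rho k δ hδ z * (∑ l, c.p l * w (x - z + c.eta h x l) + h * F (x - z))
      = ∑ l, c.p l * (rho k δ hδ z * w (x + c.eta h x l - z)) + h * (rho k δ hδ z * F (x - z)) := by
    intro z
    rw [mul_add, Finset.mul_sum]
    congr 1
    · refine Finset.sum_congr rfl fun l _ => ?_
      rw [show x - z + c.eta h x l = x + c.eta h x l - z by abel]; ring
    · ring
  simp_rw [e, add_zero]
  rw [integral_add, integral_finsetSum]
  · congr 1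
    · refine Finset.sum_congr rfl fun l _ => ?_
      rw [integral_const_mul]
    · rw [integral_const_mul]
  · intro l _
    exact (moll_integrable hδ hw _).const_mul _
  · apply integrable_finsetSum
    intro l _
    exact (moll_integrable hδ hw _).const_mul _
  · exact (moll_integrable hδ hF _).const_mul _

lemma int_sub_comm (φ w : EE k → ℝ) (x : EE k) :
    ∫ z, φ z * w (x - z) = ∫ z, φ (x - z) * w z := by
  rw [← integral_sub_left_eq_self (fun z => φ z * w (x - z)) volume x]
  simp

lemma conv_meas {φ w : EE k → ℝ} (hφ : Continuous φ) (hw : Continuous w) :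
    Measurable fun x => ∫ z, φ (x - z) * w z := by
  have : StronglyMeasurable (Function.uncurry fun (x z : EE k) => φ (x - z) * w z) := by
    apply Continuous.stronglyMeasurable
    exact (hφ.comp (by fun_prop)).mul (hw.comp (by fun_prop))
  exact this.integral_prod_right.measurable

lemma conv_integrable {φ w : EE k → ℝ} (hφ : Continuous φ) (hφc : HasCompactSupport φ)
    (hw : Continuous w) (x : EE k) : Integrable fun z => φ (x - z) * w z := by
  have h1 : Integrable fun z => φ z * w (x - z) := by
    apply Continuous.integrable_of_hasCompactSupport
    · exact hφ.mul (hw.comp (by fun_prop))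
    · exact hφc.mul_right
  have := h1.comp_sub_left x
  simpa using this

lemma conv_bd {φ w : EE k → ℝ} (hφ : Continuous φ) (hφc : HasCompactSupport φ)
    {B : ℝ} (hB : ∀ x, |w x| ≤ B) (x : EE k) :
    |∫ z, φ (x - z) * w z| ≤ (∫ z, |φ z|) * B := by
  have h0 : Integrable φ := hφ.integrable_of_hasCompactSupport hφc
  have h1 : Integrable fun z => |φ (x - z)| * B := (h0.abs.comp_sub_left x).mul_const B
  have h2 := norm_integral_le_of_norm_le (f := fun z => φ (x - z) * w z) h1 (Eventually.of_forall fun z => by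
    rw [norm_mul, Real.norm_eq_abs, Real.norm_eq_abs]
    exact mul_le_mul_of_nonneg_left (hB z) (abs_nonneg _))
  rw [integral_mul_const, integral_sub_left_eq_self (fun z => |φ z|) volume x] at h2
  exact h2

end


section
variable {k : ℕ} {δ : ℝ} (hδ : 0 < δ)

noncomputable def rho1 (i : Fin k) (u : EE k) : ℝ := fderiv ℝ (rho k δ hδ) u (EuclideanSpace.single i 1)
noncomputable def rho2 (i j : Fin k) (u : EE k) : ℝ :=
  fderiv ℝ (fderiv ℝ (rho k δ hδ)) u (EuclideanSpace.single i 1) (EuclideanSpace.single j 1)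

lemma rho1_cont (i : Fin k) : Continuous (rho1 hδ i) :=
  (((rho_contDiff hδ).fderiv_right (m := 2) (by norm_num)).continuous).clm_apply continuous_const

lemma rho_d2 : ContDiff ℝ 1 (fderiv ℝ (fderiv ℝ (rho k δ hδ))) := by
  have h1 : ContDiff ℝ 2 (fderiv ℝ (rho k δ hδ)) := (rho_contDiff hδ).fderiv_right (by norm_num)
  exact h1.fderiv_right (by norm_num)

lemma rho2_cont (i j : Fin k) : Continuous (rho2 hδ i j) :=
  ((rho_d2 hδ).continuous.clm_apply continuous_const).clm_apply continuous_const

lemma rho_far (u : EE k) (hu : δ < ‖u‖) : rho k δ hδ =ᶠ[𝓝 u] fun _ => 0 := by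
  have : IsOpen {u : EE k | δ < ‖u‖} := isOpen_lt continuous_const continuous_norm
  filter_upwards [this.mem_nhds hu] with v hv
  exact rho_supp hδ v hv

lemma rho1_far (i : Fin k) (u : EE k) (hu : δ < ‖u‖) : rho1 hδ i u = 0 := by
  unfold rho1
  rw [(rho_far hδ u hu).fderiv_eq]; simp

lemma rho2_far (i j : Fin k) (u : EE k) (hu : δ < ‖u‖) : rho2 hδ i j u = 0 := by
  unfold rho2
  have h := (rho_far hδ u hu).fderiv (𝕜 := ℝ)
  rw [h.fderiv_eq]
  simp

lemma cpt_of_far {φ : EE k → ℝ} {r : ℝ} (h : ∀ u, r < ‖u‖ → φ u = 0) : HasCompactSupport φ := by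
  apply HasCompactSupport.of_support_subset_isCompact (isCompact_closedBall (0 : EE k) r)
  intro u hu
  by_contra hc
  apply hu (h u _)
  simpa using hc

lemma eucl_sum (y : EE k) : y = ∑ i, y i • EuclideanSpace.single i (1 : ℝ) := by
  ext j
  simp [Finset.sum_apply, Pi.single_apply]

/-- Taylor remainder of the mollifier -/
noncomputable def Rem (y u : EE k) : ℝ := rho k δ hδ (u + y) - rho k δ hδ u - ∑ i, rho1 hδ i u * y i
  - (1 / 2) * ∑ i, ∑ j, rho2 hδ i j u * (y i * y j)

lemma Rem_eq (y u : EE k) : Rem hδ y u = rho k δ hδ (u + y) - rho k δ hδ u - fderiv ℝ (rho k δ hδ) u y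
      - (1 / 2) * fderiv ℝ (fderiv ℝ (rho k δ hδ)) u y y := by
  have e1 : fderiv ℝ (rho k δ hδ) u y = ∑ i, rho1 hδ i u * y i := by
    conv_lhs => rw [eucl_sum y]
    rw [map_sum]
    refine Finset.sum_congr rfl fun i _ => ?_
    rw [map_smul, smul_eq_mul, mul_comm]; rfl
  have e2 : fderiv ℝ (fderiv ℝ (rho k δ hδ)) u y y = ∑ i, ∑ j, rho2 hδ i j u * (y i * y j) := by
    have e3 : ∀ v, fderiv ℝ (fderiv ℝ (rho k δ hδ)) u y v
        = ∑ i, y i * fderiv ℝ (fderiv ℝ (rho k δ hδ)) u (EuclideanSpace.single i 1) v := by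
      intro v
      conv_lhs => rw [eucl_sum y]
      rw [map_sum, _root_.sum_apply]
      refine Finset.sum_congr rfl fun i _ => ?_
      rw [map_smul, _root_.smul_apply, smul_eq_mul]
    rw [e3]
    refine Finset.sum_congr rfl fun i _ => ?_
    generalize hL : fderiv ℝ (fderiv ℝ (rho k δ hδ)) u (EuclideanSpace.single i 1) = L
    conv_lhs => rw [eucl_sum y]
    rw [map_sum, Finset.mul_sum]
    refine Finset.sum_congr rfl fun j _ => ?_
    rw [map_smul, smul_eq_mul]; unfold rho2; rw [hL]
    simp only [← eucl_sum]
    ring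
  rw [Rem, e1, e2]

lemma Rem_cont (y : EE k) : Continuous (Rem hδ y) := by
  have h0 := rho_cont (k := k) hδ
  have h1 := rho1_cont (k := k) hδ
  have h2 := rho2_cont (k := k) hδ
  unfold Rem
  have := h0.comp (continuous_add_const y)
  fun_prop

lemma Rem_far (y u : EE k) (hu : δ + ‖y‖ < ‖u‖) : Rem hδ y u = 0 := by
  have h0 : δ < ‖u‖ := by have := norm_nonneg y; linarith
  have h1 : δ < ‖u + y‖ := by
    have := norm_sub_le (u + y) y
    rw [add_sub_cancel_right] at this; linarith
  unfold Rem
  simp [rho_supp hδ _ h0, rho_supp hδ _ h1, rho1_far hδ _ u h0, rho2_far hδ _ _ u h0]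

lemma coord_le (y : EE k) (i : Fin k) : |y i| ≤ ‖y‖ := by
  have := PiLp.norm_apply_le y i
  simpa using this

lemma rho1_cpt (i : Fin k) : HasCompactSupport (rho1 hδ i) := cpt_of_far (rho1_far hδ i)
lemma rho2_cpt (i j : Fin k) : HasCompactSupport (rho2 hδ i j) := cpt_of_far (rho2_far hδ i j)

lemma Rem_int : ∃ K : ℝ, 0 ≤ K ∧ ∀ y : EE k, ∫ u, |Rem hδ y u| ≤ K * (‖y‖ ^ 2 * min 1 ‖y‖) := by
  obtain ⟨K3, hK30, hK3⟩ := taylor2 (rho_contDiff (k := k) hδ) (rho_cpt hδ)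
  set V := volume.real (Metric.closedBall (0 : EE k) (δ + 1)) with hV
  have hV0 : 0 ≤ V := measureReal_nonneg
  set c1 : ℝ := ∑ i : Fin k, ∫ u, |rho1 hδ i u| with hc1
  set c2 : ℝ := ∑ i : Fin k, ∑ j : Fin k, ∫ u, |rho2 hδ i j u| with hc2
  have hc10 : 0 ≤ c1 := Finset.sum_nonneg fun i _ => integral_nonneg fun u => abs_nonneg _
  have hc20 : 0 ≤ c2 := Finset.sum_nonneg fun i _ => Finset.sum_nonneg fun j _ =>
    integral_nonneg fun u => abs_nonneg _
  have i1 : ∀ i : Fin k, Integrable (fun u => |rho1 hδ i u|) volume := fun i =>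
    Integrable.abs ((rho1_cont hδ i).integrable_of_hasCompactSupport (μ := volume) (rho1_cpt hδ i))
  have i2 : ∀ i j : Fin k, Integrable (fun u => |rho2 hδ i j u|) volume := fun i j =>
    Integrable.abs ((rho2_cont hδ i j).integrable_of_hasCompactSupport (μ := volume) (rho2_cpt hδ i j))
  refine ⟨K3 * V + (2 + c1 + c2), by positivity, fun y => ?_⟩
  have hint : Integrable fun u => |Rem hδ y u| :=
    ((Rem_cont hδ y).integrable_of_hasCompactSupport (μ := volume) (cpt_of_far (Rem_far hδ y))).abs
  by_cases hy : ‖y‖ ≤ 1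
  · have hle : ∀ u, |Rem hδ y u| ≤ (Metric.closedBall (0 : EE k) (δ + 1)).indicator (fun _ => K3 * ‖y‖ ^ 3) u := by
      intro u
      by_cases hu : u ∈ Metric.closedBall (0 : EE k) (δ + 1)
      · rw [indicator_of_mem hu, Rem_eq]; exact hK3 u y
      · rw [indicator_of_notMem hu, Rem_far, abs_zero]
        have : δ + 1 < ‖u‖ := by simpa using hu
        linarith
    have h1 : ∫ u, |Rem hδ y u| ≤ K3 * ‖y‖ ^ 3 * V := by
      refine (integral_mono hint ?_ hle).trans ?_
      · rw [integrable_indicator_iff measurableSet_closedBall]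
        exact integrableOn_const ((measure_closedBall_lt_top (μ := volume)).ne)
      · rw [integral_indicator measurableSet_closedBall, setIntegral_const, smul_eq_mul, mul_comm]
    rw [min_eq_right hy]
    have : 0 ≤ (2 + c1 + c2) * ‖y‖ ^ 3 := by positivity
    calc _ ≤ _ := h1
      _ ≤ K3 * ‖y‖ ^ 3 * V + (2 + c1 + c2) * ‖y‖ ^ 3 := by linarith
      _ = _ := by ring
  · push Not at hy
    rw [min_eq_left hy.le]
    have hle : ∀ u, |Rem hδ y u| ≤ rho k δ hδ (u + y) + rho k δ hδ u + ∑ i, |rho1 hδ i u| * ‖y‖ ^ 2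
        + ∑ i, ∑ j, |rho2 hδ i j u| * ‖y‖ ^ 2 := by
      intro u
      have b1 : |∑ i, rho1 hδ i u * y i| ≤ ∑ i, |rho1 hδ i u| * ‖y‖ ^ 2 := by
        refine (Finset.abs_sum_le_sum_abs _ _).trans (Finset.sum_le_sum fun i _ => ?_)
        rw [abs_mul]
        gcongr
        have := coord_le y i
        nlinarith
      have b2 : |∑ i, ∑ j, rho2 hδ i j u * (y i * y j)| ≤ ∑ i, ∑ j, |rho2 hδ i j u| * ‖y‖ ^ 2 := by
        refine (Finset.abs_sum_le_sum_abs _ _).trans (Finset.sum_le_sum fun i _ => ?_)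
        refine (Finset.abs_sum_le_sum_abs _ _).trans (Finset.sum_le_sum fun j _ => ?_)
        rw [abs_mul, abs_mul, pow_two]
        gcongr <;> exact coord_le y _
      have b3 := rho_nn hδ (u + y)
      have b4 := rho_nn hδ u
      unfold Rem
      rw [abs_le] at b1 b2 ⊢
      constructor <;> linarith [b1.1, b1.2, b2.1, b2.2]
    have j0 : Integrable fun u => rho k δ hδ (u + y) := (rho_integrable hδ).comp_add_right y
    have j1 : Integrable fun u => ∑ i, |rho1 hδ i u| * ‖y‖ ^ 2 :=
      integrable_finsetSum _ fun i _ => (i1 i).mul_const _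
    have j2 : Integrable fun u => ∑ i, ∑ j, |rho2 hδ i j u| * ‖y‖ ^ 2 :=
      integrable_finsetSum _ fun i _ => integrable_finsetSum _ fun j _ => (i2 i j).mul_const _
    have j01 : Integrable fun u => rho k δ hδ (u + y) + rho k δ hδ u := j0.add (rho_integrable hδ)
    have j012 : Integrable fun u => rho k δ hδ (u + y) + rho k δ hδ u + ∑ i, |rho1 hδ i u| * ‖y‖ ^ 2 := j01.add j1
    have h1 := integral_mono hint (j012.add j2) hle
    have h2 : ∫ u, (rho k δ hδ (u + y) + rho k δ hδ u + ∑ i, |rho1 hδ i u| * ‖y‖ ^ 2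
        + ∑ i, ∑ j, |rho2 hδ i j u| * ‖y‖ ^ 2) = 2 + c1 * ‖y‖ ^ 2 + c2 * ‖y‖ ^ 2 := by
      rw [integral_add j012 j2, integral_add j01 j1,
        integral_add j0 (rho_integrable hδ), integral_add_right_eq_self (rho k δ hδ) y, rho_int,
        integral_finsetSum _ (fun i _ => (i1 i).mul_const _),
        integral_finsetSum _ (fun i _ => integrable_finsetSum _ fun j _ => (i2 i j).mul_const _)]
      have e : ∀ i : Fin k, ∫ u : EE k, ∑ j, |rho2 hδ i j u| * ‖y‖ ^ 2 = (∑ j, ∫ u, |rho2 hδ i j u|) * ‖y‖ ^ 2 := by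
        intro i
        rw [integral_finsetSum _ (fun j _ => (i2 i j).mul_const _), Finset.sum_mul]
        simp_rw [integral_mul_const]
      simp_rw [e, integral_mul_const]
      rw [← Finset.sum_mul, ← Finset.sum_mul]
      ring
    have h1 := h1.trans_eq h2
    have h3 : 1 ≤ ‖y‖ ^ 2 := by nlinarith
    have : 0 ≤ K3 * V * ‖y‖ ^ 2 := by positivity
    nlinarith

lemma moll_SM : ∃ K : ℝ, 0 ≤ K ∧ ∀ (B : ℝ) (w : EE k → ℝ), Continuous w → (∀ x, |w x| ≤ B) →
    ∃ p q, SM (moll δ hδ w) p q (K * B) := by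
  obtain ⟨K3, hK30, hK3⟩ := Rem_int (k := k) hδ
  set c1 : ℝ := ∑ i : Fin k, ∫ u, |rho1 hδ i u| with hc1
  set c2 : ℝ := ∑ i : Fin k, ∑ j : Fin k, ∫ u, |rho2 hδ i j u| with hc2
  have n1 : ∀ i : Fin k, 0 ≤ ∫ u, |rho1 hδ i u| := fun i => integral_nonneg fun u => abs_nonneg _
  have n2 : ∀ i j : Fin k, 0 ≤ ∫ u, |rho2 hδ i j u| := fun i j => integral_nonneg fun u => abs_nonneg _
  have hc10 : 0 ≤ c1 := Finset.sum_nonneg fun i _ => n1 i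
  have hc20 : 0 ≤ c2 := Finset.sum_nonneg fun i _ => Finset.sum_nonneg fun j _ => n2 i j
  refine ⟨1 + K3 + c1 + c2, by positivity, fun B w hw hB => ?_⟩
  have hB0 : 0 ≤ B := (abs_nonneg _).trans (hB 0)
  have hm : moll δ hδ w = fun x => ∫ z, rho k δ hδ (x - z) * w z := by
    funext x; exact int_sub_comm _ _ _
  refine ⟨fun x i => ∫ z, rho1 hδ i (x - z) * w z, fun x i j => ∫ z, rho2 hδ i j (x - z) * w z, ?_⟩
  constructor
  · positivity
  · rw [hm]; exact conv_meas (rho_cont hδ) hw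
  · exact fun i => conv_meas (rho1_cont hδ i) hw
  · exact fun i j => conv_meas (rho2_cont hδ i j) hw
  · intro x
    refine (moll_bd hδ hw hB x).trans ?_
    nlinarith [mul_nonneg hK30 hB0, mul_nonneg hc10 hB0, mul_nonneg hc20 hB0]
  · intro x i
    refine (conv_bd (rho1_cont hδ i) (rho1_cpt hδ i) hB x).trans ?_
    gcongr
    have := Finset.single_le_sum (fun i _ => n1 i) (Finset.mem_univ i)
    linarith
  · intro x i j
    refine (conv_bd (rho2_cont hδ i j) (rho2_cpt hδ i j) hB x).trans ?_
    gcongr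
    have h1 := Finset.single_le_sum (fun j _ => n2 i j) (Finset.mem_univ j)
    have h2 := Finset.single_le_sum (f := fun i => ∑ j, ∫ u, |rho2 hδ i j u|)
      (fun i _ => Finset.sum_nonneg fun j _ => n2 i j) (Finset.mem_univ i)
    linarith
  · intro x y
    have key : moll δ hδ w (x + y) - moll δ hδ w x - ∑ i, (∫ z, rho1 hδ i (x - z) * w z) * y i
        - (1 / 2) * ∑ i, ∑ j, (∫ z, rho2 hδ i j (x - z) * w z) * (y i * y j)
        = ∫ z, Rem hδ y (x - z) * w z := by
      have a0 := conv_integrable (rho_cont hδ) (rho_cpt hδ) hw (x + y)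
      have a1 := conv_integrable (rho_cont hδ) (rho_cpt hδ) hw x
      have a2 := fun i => (conv_integrable (rho1_cont hδ i) (rho1_cpt hδ i) hw x).mul_const (y i)
      have a3 := fun i j => (conv_integrable (rho2_cont hδ i j) (rho2_cpt hδ i j) hw x).mul_const (y i * y j)
      have a01 : Integrable fun z => rho k δ hδ (x + y - z) * w z - rho k δ hδ (x - z) * w z := a0.sub a1
      have a2' : Integrable fun z => ∑ i, rho1 hδ i (x - z) * w z * y i := integrable_finsetSum _ fun i _ => a2 i
      have a012 : Integrable fun z => rho k δ hδ (x + y - z) * w z - rho k δ hδ (x - z) * w z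
        - ∑ i, rho1 hδ i (x - z) * w z * y i := a01.sub a2'
      rw [hm]
      simp only
      simp_rw [← integral_mul_const]
      simp_rw [← integral_finsetSum Finset.univ (fun j _ => a3 _ j)]
      rw [← integral_finsetSum Finset.univ (fun i _ => integrable_finsetSum Finset.univ fun j _ => a3 i j),
        ← integral_finsetSum Finset.univ (fun i _ => a2 i), ← integral_const_mul, ← integral_sub a0 a1,
        ← integral_sub a01 a2', ← integral_sub a012
          ((integrable_finsetSum _ fun i _ => integrable_finsetSum Finset.univ fun j _ => a3 i j).const_mul _)]
      congr 1
      funext z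
      unfold Rem
      rw [show x - z + y = x + y - z by abel]
      simp only [sub_mul, Finset.sum_mul, mul_assoc]
      simp only [mul_comm, mul_left_comm, mul_assoc]
    rw [key]
    refine (conv_bd (Rem_cont hδ y) (cpt_of_far (Rem_far hδ y)) hB x).trans ?_
    have h1 := hK3 y
    have h4 : 0 ≤ ‖y‖ ^ 2 * min 1 ‖y‖ := by positivity
    calc _ ≤ K3 * (‖y‖ ^ 2 * min 1 ‖y‖) * B := by gcongr
      _ = K3 * B * (‖y‖ ^ 2 * min 1 ‖y‖) := by ring
      _ ≤ _ := by gcongr; linarith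
end


section
variable {Ω : Type*} {mΩ : MeasurableSpace Ω} {μ : Measure Ω} [IsProbabilityMeasure μ] {ℱ : Filtration ℝ mΩ}

lemma opt_disc {Z : ℝ → Ω → ℝ} (hZ : Martingale Z ℱ μ) {t : ℝ} (u : ℕ → ℝ) (n : ℕ)
    (hu : ∀ i ≤ n, u i ≤ t) (θ : Ω → ℕ) (D : Set Ω) (hθ : ∀ ω ∈ D, θ ω ≤ n)
    (hD : ∀ i ≤ n, MeasurableSet[ℱ (u i)] (D ∩ {ω | θ ω = i})) :
    Integrable (D.indicator fun ω => Z (u (θ ω)) ω) μ ∧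
    ∫ ω, D.indicator (fun ω => Z (u (θ ω)) ω) ω ∂μ = ∫ ω, D.indicator (Z t) ω ∂μ := by
  have e : ∀ (V : Ω → ℕ → ℝ) ω, D.indicator (fun ω => V ω (θ ω)) ω
      = ∑ i ∈ Finset.range (n + 1), (D ∩ {ω | θ ω = i}).indicator (fun ω => V ω i) ω := by
    intro V ω
    by_cases h : ω ∈ D
    · rw [indicator_of_mem h, Finset.sum_eq_single (θ ω)]
      · rw [indicator_of_mem]; exact ⟨h, rfl⟩
      · intro i _ hi
        rw [indicator_of_notMem]; rintro ⟨_, h2⟩; exact hi h2.symm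
      · intro h2
        exact absurd (Finset.mem_range.mpr (Nat.lt_succ_of_le (hθ ω h))) h2
    · rw [indicator_of_notMem h, Finset.sum_eq_zero]
      intro i _
      rw [indicator_of_notMem]; exact fun h2 => h h2.1
  have m : ∀ i ∈ Finset.range (n + 1), MeasurableSet (D ∩ {ω | θ ω = i}) := fun i hi =>
    ℱ.le _ _ (hD i (Nat.lt_succ_iff.mp (Finset.mem_range.mp hi)))
  have e1 := e (fun ω i => Z (u i) ω)
  have e2 := e (fun ω _ => Z t ω)
  have i1 : ∀ i ∈ Finset.range (n + 1), Integrable ((D ∩ {ω | θ ω = i}).indicator (fun ω => Z (u i) ω)) μ :=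
    fun i hi => (hZ.integrable (u i)).indicator (m i hi)
  have i2 : ∀ i ∈ Finset.range (n + 1), Integrable ((D ∩ {ω | θ ω = i}).indicator (fun ω => Z t ω)) μ :=
    fun i hi => (hZ.integrable t).indicator (m i hi)
  refine ⟨?_, ?_⟩
  · rw [funext e1]
    exact integrable_finsetSum _ i1
  · have e2' : ∀ ω, D.indicator (Z t) ω = _ := e2
    simp_rw [e1, e2']
    rw [integral_finsetSum _ i1, integral_finsetSum _ i2]
    refine Finset.sum_congr rfl fun i hi => ?_
    rw [integral_indicator (m i hi), integral_indicator (m i hi)]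
    have hi' := Nat.lt_succ_iff.mp (Finset.mem_range.mp hi)
    exact hZ.setIntegral_eq (hu i hi') (hD i hi')

lemma ceil_grid (a h : ℝ) (hh : 0 < h) (ha : 0 ≤ a) : a ≤ ⌈a / h⌉₊ * h ∧ ⌈a / h⌉₊ * h ≤ a + h := by
  constructor
  · have := Nat.le_ceil (a / h)
    rwa [div_le_iff₀ hh] at this
  · have := (Nat.ceil_lt_add_one (a := a / h) (by positivity)).le
    calc _ ≤ (a / h + 1) * h := by gcongr
      _ = _ := by field_simp

lemma stopped_mart {Z : ℝ → Ω → ℝ} (hZ : Martingale Z ℱ μ)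
    (hc : ∀ ω, ContinuousOn (fun t => Z t ω) (Ici 0)) {τ : Ω → ℝ}
    (hτm : ∀ s ≥ 0, MeasurableSet[ℱ s] {ω | τ ω ≤ s}) {c t s : ℝ} (hs : 0 ≤ s) (hst : s ≤ t)
    (hb : ∀ ω, |Z (min t (τ ω)) ω| ≤ c) {A : Set Ω} (hA : MeasurableSet[ℱ s] A) :
    ∫ ω in A, Z (min t (τ ω)) ω - Z (min s (τ ω)) ω ∂μ = 0 ∧
    AEStronglyMeasurable (A.indicator fun ω => Z (min t (τ ω)) ω - Z (min s (τ ω)) ω) μ := by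
  rcases eq_or_lt_of_le hst with rfl | hst'
  · simp [aestronglyMeasurable_const]
  set A' := A ∩ {ω | s < τ ω} with hA'
  have hA's : MeasurableSet[ℱ s] A' := by
    refine hA.inter ?_
    have := (hτm s hs).compl
    convert this using 1
    ext ω; simp
  have hAm : MeasurableSet A := ℱ.le s _ hA
  have hA'm : MeasurableSet A' := ℱ.le s _ hA's
  -- grid
  set h : ℕ → ℝ := fun n => (t - s) / (n + 1) with hh
  have hh0 : ∀ n, 0 < h n := fun n => by simp only [hh]; have : 0 < t - s := by linarith
                                         positivity
  set u : ℕ → ℕ → ℝ := fun n i => s + i * h n with hu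
  set θ : ℕ → Ω → ℕ := fun n ω => ⌈(min t (τ ω) - s) / h n⌉₊ with hθ
  have hmin : ∀ ω ∈ A', 0 ≤ min t (τ ω) - s := fun ω hω => by
    have : s < τ ω := hω.2
    simp [hst, this.le]
  have hle : ∀ n, ∀ ω ∈ A', min t (τ ω) ≤ u n (θ n ω) := fun n ω hω => by
    have := (ceil_grid _ _ (hh0 n) (hmin ω hω)).1
    simp only [hu, hθ]; linarith
  have hge : ∀ n, ∀ ω ∈ A', u n (θ n ω) ≤ min t (τ ω) + h n := fun n ω hω => by
    have := (ceil_grid _ _ (hh0 n) (hmin ω hω)).2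
    simp only [hu, hθ]; linarith
  have hnh : ∀ n : ℕ, ((n + 1 : ℕ) : ℝ) * h n = t - s := fun n => by
    simp only [hh]; push_cast; field_simp
  have hθn : ∀ n, ∀ ω ∈ A', θ n ω ≤ n + 1 := fun n ω hω => by
    apply Nat.ceil_le.mpr
    rw [div_le_iff₀ (hh0 n), hnh]
    have := min_le_left t (τ ω); linarith
  have hut : ∀ n, ∀ i ≤ n + 1, u n i ≤ t := fun n i hi => by
    have : (i : ℝ) ≤ ((n + 1 : ℕ) : ℝ) := by exact_mod_cast hi
    have := mul_le_mul_of_nonneg_right this (hh0 n).le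
    rw [hnh] at this
    simp only [hu]; linarith
  have hus : ∀ n i, s ≤ u n i := fun n i => by
    have := hh0 n
    simp only [hu]; have : 0 ≤ (i : ℝ) * h n := by positivity
    linarith
  have hm1 : ∀ n i, MeasurableSet[ℱ (u n i)] {ω | θ n ω ≤ i} := fun n i => by
    have e : {ω | θ n ω ≤ i} = if t ≤ u n i then univ else {ω | τ ω ≤ u n i} := by
      split_ifs with h1 <;> ext ω <;> simp only [mem_ofPred_eq, mem_univ, iff_true, hθ, Nat.ceil_le, div_le_iff₀ (hh0 n)]
      · have := min_le_left t (τ ω); simp only [hu] at h1; linarith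
      · simp only [hu] at h1 ⊢
        rw [sub_le_iff_le_add, add_comm, min_le_iff]
        simp [h1]
    rw [e]; split_ifs
    · exact MeasurableSet.univ
    · exact hτm _ (hs.trans (hus n i))
  have hm2 : ∀ n i, MeasurableSet[ℱ (u n i)] {ω | θ n ω = i} := fun n i => by
    rcases i with _ | i
    · have := hm1 n 0
      simpa using this
    · have e : {ω | θ n ω = i + 1} = {ω | θ n ω ≤ i + 1} \ {ω | θ n ω ≤ i} := by
        ext ω; simp only [mem_ofPred_eq, Set.mem_sdiff]; omega
      rw [e]
      refine (hm1 n (i + 1)).diff (ℱ.mono ?_ _ (hm1 n i))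
      simp only [hu]; push_cast; nlinarith [hh0 n]
  have hD1 : ∀ n, ∀ i ≤ n + 1, MeasurableSet[ℱ (u n i)] (A' ∩ {ω | θ n ω = i}) := fun n i _ =>
    (ℱ.mono (hus n i) _ hA's).inter (hm2 n i)
  set Y : ℕ → Ω → ℝ := fun n ω => Z (u n (θ n ω)) ω with hY
  set D : ℕ → Set Ω := fun n => A' ∩ {ω | c + 1 < |Y n ω|} with hD
  have hD2 : ∀ n, ∀ i ≤ n + 1, MeasurableSet[ℱ (u n i)] (D n ∩ {ω | θ n ω = i}) := fun n i hi => by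
    have e : D n ∩ {ω | θ n ω = i} = (A' ∩ {ω | θ n ω = i}) ∩ {ω | c + 1 < |Z (u n i) ω|} := by
      ext ω; simp only [hD, hY, mem_inter_iff, mem_ofPred_eq]
      constructor
      · rintro ⟨⟨a, b⟩, d⟩; rw [d] at b; exact ⟨⟨a, d⟩, b⟩
      · rintro ⟨⟨a, d⟩, b⟩; rw [← d] at b; exact ⟨⟨a, b⟩, d⟩
    rw [e]
    refine (hD1 n i hi).inter ?_
    have := (hZ.1 (u n i)).measurable
    exact measurableSet_lt (@measurable_const _ _ _ (ℱ (u n i)) _) (measurable_norm.comp this)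
  have o1 := fun n => opt_disc hZ (u n) (n + 1) (hut n) (θ n) A' (hθn n) (hD1 n)
  have o2 := fun n => opt_disc hZ (u n) (n + 1) (hut n) (θ n) (D n) (fun ω hω => hθn n ω hω.1) (hD2 n)
  have hDm : ∀ n, MeasurableSet (D n) := fun n => by
    have e : D n = ⋃ i ∈ Finset.range (n + 2), (D n ∩ {ω | θ n ω = i}) := by
      ext ω; simp only [mem_iUnion, mem_inter_iff, mem_ofPred_eq, Finset.mem_range]
      constructor
      · intro h; exact ⟨θ n ω, by have := hθn n ω h.1; omega, h, rfl⟩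
      · rintro ⟨i, _, h, _⟩; exact h
    rw [e]
    refine Finset.measurableSet_biUnion _ fun i hi => ℱ.le _ _ (hD2 n i ?_)
    have := Finset.mem_range.mp hi; omega
  -- pathwise convergence
  have hconv : ∀ ω ∈ A', Tendsto (fun n => Y n ω) atTop (𝓝 (Z (min t (τ ω)) ω)) := by
    intro ω hω
    have hp : 0 ≤ min t (τ ω) := by have := hmin ω hω; linarith
    have h1 := (hc ω) (min t (τ ω)) hp
    have h0 : Tendsto h atTop (𝓝 0) := by
      have := tendsto_one_div_add_atTop_nhds_zero_nat (𝕜 := ℝ)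
      have := this.const_mul (t - s)
      simpa [hh, div_eq_mul_inv] using this
    have h2 : Tendsto (fun n => u n (θ n ω)) atTop (𝓝[Ici 0] (min t (τ ω))) := by
      rw [tendsto_nhdsWithin_iff]
      refine ⟨?_, Eventually.of_forall fun n => hs.trans (hus n _)⟩
      refine tendsto_of_tendsto_of_tendsto_of_le_of_le tendsto_const_nhds ?_
        (fun n => hle n ω hω) (fun n => hge n ω hω)
      simpa using h0.const_add (min t (τ ω))
    exact h1.tendsto.comp h2
  have hev : ∀ ω ∈ A', ∀ᶠ n in atTop, ω ∉ D n := by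
    intro ω hω
    have h1 := (hconv ω hω).abs
    have h2 : |Z (min t (τ ω)) ω| < c + 1 := by have := hb ω; linarith
    filter_upwards [h1.eventually_lt_const h2] with n hn
    intro h3
    exact absurd h3.2 (not_lt.mpr hn.le)
  set V : Ω → ℝ := A'.indicator fun ω => Z (min t (τ ω)) ω with hV
  have hmeas : AEStronglyMeasurable V μ := by
    refine aestronglyMeasurable_of_tendsto_ae atTop (fun n => (o1 n).1.1) (Eventually.of_forall fun ω => ?_)
    by_cases hω : ω ∈ A'
    · simp only [hV, indicator_of_mem hω]; exact hconv ω hω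
    · simp only [hV, indicator_of_notMem hω]; exact tendsto_const_nhds
  have lim1 : Tendsto (fun n => ∫ ω, (A'.indicator (Y n) ω - (D n).indicator (Y n) ω) ∂μ) atTop (𝓝 (∫ ω, V ω ∂μ)) := by
    refine tendsto_integral_of_dominated_convergence (fun _ => |c| + 1)
      (fun n => ((o1 n).1.sub (o2 n).1).1) (integrable_const _) (fun n => Eventually.of_forall fun ω => ?_)
      (Eventually.of_forall fun ω => ?_)
    · have hc1 := le_abs_self c
      by_cases h1 : ω ∈ A'
      · by_cases h2 : ω ∈ D n
        · rw [indicator_of_mem h1, indicator_of_mem h2, sub_self, norm_zero]; positivity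
        · rw [indicator_of_mem h1, indicator_of_notMem h2, sub_zero, Real.norm_eq_abs]
          have : ¬ (c + 1 < |Y n ω|) := fun h3 => h2 ⟨h1, h3⟩
          linarith
      · have h2 : ω ∉ D n := fun h => h1 h.1
        rw [indicator_of_notMem h1, indicator_of_notMem h2, sub_self, norm_zero]; positivity
    · by_cases h1 : ω ∈ A'
      · simp only [hV, indicator_of_mem h1]
        refine (hconv ω h1).congr' ?_
        filter_upwards [hev ω h1] with n hn
        rw [indicator_of_notMem hn, sub_zero]
      · have h2 : ∀ n, ω ∉ D n := fun n h => h1 h.1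
        simp only [hV, indicator_of_notMem h1, indicator_of_notMem (h2 _), sub_self]
        exact tendsto_const_nhds
  have lim2 : Tendsto (fun n => ∫ ω, (D n).indicator (Z t) ω ∂μ) atTop (𝓝 (∫ ω, (0 : ℝ) ∂μ)) := by
    refine tendsto_integral_of_dominated_convergence (fun ω => |Z t ω|)
      (fun n => ((hZ.integrable t).indicator (hDm n)).1) (hZ.integrable t).abs
      (fun n => Eventually.of_forall fun ω => ?_) (Eventually.of_forall fun ω => ?_)
    · exact norm_indicator_le_norm_self _ _
    · by_cases h1 : ω ∈ A'
      · refine tendsto_const_nhds.congr' ?_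
        filter_upwards [hev ω h1] with n hn
        rw [indicator_of_notMem hn]
      · have h2 : ∀ n, ω ∉ D n := fun n h => h1 h.1
        simp only [indicator_of_notMem (h2 _)]
        exact tendsto_const_nhds
  have eqn : ∀ n, ∫ ω, (A'.indicator (Y n) ω - (D n).indicator (Y n) ω) ∂μ
      = (∫ ω, A'.indicator (Z s) ω ∂μ) - ∫ ω, (D n).indicator (Z t) ω ∂μ := by
    intro n
    rw [integral_sub (o1 n).1 (o2 n).1, (o1 n).2, (o2 n).2, integral_indicator hA'm, integral_indicator hA'm,
      hZ.setIntegral_eq hst hA's]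
  simp_rw [eqn] at lim1
  have fin := tendsto_nhds_unique lim1 (lim2.const_sub (∫ ω, A'.indicator (Z s) ω ∂μ))
  simp only [integral_zero, sub_zero] at fin
  have hVi : Integrable V μ := by
    refine Integrable.of_bound hmeas |c| (Eventually.of_forall fun ω => ?_)
    by_cases h1 : ω ∈ A'
    · simp only [hV, indicator_of_mem h1]; exact (hb ω).trans (le_abs_self c)
    · simp only [hV, indicator_of_notMem h1, norm_zero]; positivity
  have hsI : Integrable (A'.indicator (Z s)) μ := (hZ.integrable s).indicator hA'm
  have efin : (A.indicator fun ω => Z (min t (τ ω)) ω - Z (min s (τ ω)) ω) = V - A'.indicator (Z s) := by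
    funext ω
    by_cases h1 : ω ∈ A
    · by_cases h2 : s < τ ω
      · have h3 : ω ∈ A' := ⟨h1, h2⟩
        simp only [hV, Pi.sub_apply, indicator_of_mem h1, indicator_of_mem h3, min_eq_left h2.le]
      · have h3 : ω ∉ A' := fun h => h2 h.2
        push Not at h2
        simp only [hV, Pi.sub_apply, indicator_of_mem h1, indicator_of_notMem h3, min_eq_right h2,
          min_eq_right (h2.trans hst), sub_self]
    · have h3 : ω ∉ A' := fun h => h1 h.1
      simp only [hV, Pi.sub_apply, indicator_of_notMem h1, indicator_of_notMem h3, sub_self]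
  refine ⟨?_, ?_⟩
  · rw [← integral_indicator hAm, efin, integral_sub' hVi hsI, fin, sub_self]
  · rw [efin]; exact (hVi.sub hsI).1
end



/-- diffusion matrix -/
noncomputable def Coef.a {k : ℕ} (c : Coef k) (y : EE k) (i j : Fin k) : ℝ :=
  ∑ l, c.p l * (c.s l y i * c.s l y j)

/-- solution of the martingale problem -/
structure Sol {Ω : Type*} {mΩ : MeasurableSpace Ω} {k : ℕ} (c : Coef k) (μ : Measure Ω)
    (ℱ : Filtration ℝ mΩ) (x : EE k) (X M : ℝ → Ω → EE k) : Prop where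
  adapted : ∀ t, Measurable[ℱ t] (X t)
  cont : ∀ ω, Continuous fun t => X t ω
  init : ∀ ω, X 0 ω = x
  mart : ∀ i, Martingale (fun t ω => M t ω i) ℱ μ
  eqn : ∀ ω, ∀ t ≥ (0:ℝ), X t ω = x + (∫ s in Set.Ioc (0:ℝ) t, c.b (X s ω)) + M t ω
  qvar : ∀ i j : Fin k, Martingale
    (fun t ω => M t ω i * M t ω j - ∫ s in Set.Ioc (0:ℝ) t, c.a (X s ω) i j) ℱ μ

section
variable {Ω : Type*} {mΩ : MeasurableSpace Ω} {μ : Measure Ω} [IsProbabilityMeasure μ] {ℱ : Filtration ℝ mΩ}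
  {k : ℕ} {c : Coef k} {x : EE k} {X M : ℝ → Ω → EE k}

lemma hit_meas (hX : ∀ t, Measurable[ℱ t] (X t)) (hc : ∀ ω, Continuous fun t => X t ω) {s : ℝ} (hs : 0 ≤ s) (R : ℝ) :
    MeasurableSet[ℱ s] {ω | ∃ u ∈ Icc 0 s, R ≤ ‖X u ω‖} := by
  set d := TopologicalSpace.denseSeq unitInterval with hd
  have e : {ω | ∃ u ∈ Icc 0 s, R ≤ ‖X u ω‖}
      = ⋂ m : ℕ, ⋃ n : ℕ, {ω | R - 1 / ((m : ℝ) + 1) < ‖X (s * d n) ω‖} := by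
    ext ω
    have hg : Continuous fun v : unitInterval => ‖X (s * v) ω‖ := by
      have := hc ω
      exact (this.comp (by fun_prop : Continuous fun v : unitInterval => s * (v : ℝ))).norm
    simp only [mem_ofPred_eq, mem_iInter, mem_iUnion]
    constructor
    · rintro ⟨u, hu, hR⟩ m
      have hv : ∃ v : unitInterval, s * (v : ℝ) = u := by
        rcases eq_or_lt_of_le hs with rfl | hs'
        · exact ⟨0, by have := hu.1; have := hu.2; simp; linarith⟩
        · refine ⟨⟨u / s, by have := hu.1; positivity, ?_⟩, ?_⟩
          · rw [div_le_one hs']; exact hu.2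
          · simp only; field_simp
      obtain ⟨v, hv⟩ := hv
      have hopen : IsOpen {v : unitInterval | R - 1 / ((m : ℝ) + 1) < ‖X (s * v) ω‖} :=
        isOpen_lt continuous_const hg
      have hne : {v : unitInterval | R - 1 / ((m : ℝ) + 1) < ‖X (s * v) ω‖}.Nonempty := by
        refine ⟨v, ?_⟩
        have : (0:ℝ) < 1 / ((m : ℝ) + 1) := by positivity
        simp only [mem_ofPred_eq]; rw [hv]; linarith
      obtain ⟨_, hy, n, rfl⟩ := (TopologicalSpace.denseRange_denseSeq unitInterval).inter_open_nonempty _ hopen hne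
      exact ⟨n, hy⟩
    · intro h
      obtain ⟨v, -, hv⟩ := isCompact_univ.exists_isMaxOn (univ_nonempty (α := unitInterval)) hg.continuousOn
      refine ⟨s * v, ⟨mul_nonneg hs v.2.1, mul_le_of_le_one_right hs v.2.2⟩, ?_⟩
      apply le_of_forall_pos_lt_add
      intro ε hε
      obtain ⟨m, hm⟩ := exists_nat_one_div_lt hε
      obtain ⟨n, hn⟩ := h m
      have := hv (mem_univ (d n))
      simp only [mem_ofPred_eq] at this
      linarith
  rw [e]
  refine MeasurableSet.iInter fun m => MeasurableSet.iUnion fun n => ?_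
  have h1 : Measurable[ℱ s] (X (s * d n)) := (hX _).mono (ℱ.mono (mul_le_of_le_one_right hs (d n).2.2)) le_rfl
  exact measurableSet_lt (@measurable_const _ _ _ (ℱ s) _) (measurable_norm.comp h1)

lemma hit_small (hX : ∀ t, Measurable[ℱ t] (X t)) (hc : ∀ ω, Continuous fun t => X t ω) {s : ℝ} (hs : 0 ≤ s) {ε : ℝ} (hε : 0 < ε) :
    ∃ R0 : ℝ, ∀ R ≥ R0, μ.real {ω | ∃ u ∈ Icc 0 s, R ≤ ‖X u ω‖} ≤ ε := by
  set E : ℕ → Set Ω := fun n => {ω | ∃ u ∈ Icc 0 s, (n : ℝ) ≤ ‖X u ω‖} with hE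
  have hEm : ∀ n, MeasurableSet (E n) := fun n => ℱ.le s _ (hit_meas hX hc hs n)
  have hanti : Antitone E := by
    intro n m hnm ω
    rintro ⟨u, hu, h⟩
    exact ⟨u, hu, le_trans (by exact_mod_cast hnm) h⟩
  have hemp : ⋂ n, E n = ∅ := by
    ext ω
    simp only [mem_iInter, mem_empty_iff_false, iff_false, not_forall]
    obtain ⟨B, hB⟩ := isCompact_Icc.exists_bound_of_continuousOn (f := fun u => X u ω) (s := Icc 0 s) (hc ω).continuousOn
    obtain ⟨n, hn⟩ := exists_nat_gt B
    refine ⟨n, ?_⟩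
    rintro ⟨u, hu, h⟩
    have := hB u hu
    linarith
  have := tendsto_measure_iInter_atTop (μ := μ) (fun n => (hEm n).nullMeasurableSet) hanti ⟨0, measure_ne_top _ _⟩
  rw [hemp, measure_empty] at this
  have h2 := (ENNReal.tendsto_toReal ENNReal.zero_ne_top).comp this
  have h3 := h2.eventually_lt_const (show (0:ENNReal).toReal < ε by simpa using hε)
  obtain ⟨n, hn⟩ := h3.exists
  refine ⟨n, fun R hR => ?_⟩
  refine le_trans (measureReal_mono ?_) hn.le
  rintro ω ⟨u, hu, h⟩
  exact ⟨u, hu, hR.le.trans h⟩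

lemma exit_time (S : Sol c μ ℱ x X M) {T : ℝ} (hT : 0 ≤ T) {ε : ℝ} (hε : 0 < ε) :
    ∃ (R : ℝ) (τ : Ω → ℝ), 0 ≤ R ∧ (∀ ω, 0 ≤ τ ω) ∧ (∀ ω, τ ω ≤ T) ∧
      (∀ s ≥ 0, MeasurableSet[ℱ s] {ω | τ ω ≤ s}) ∧ (∀ ω, ∀ u, 0 ≤ u → u ≤ τ ω → ‖X u ω‖ ≤ R) ∧
      μ.real {ω | τ ω < T} ≤ ε := by
  obtain ⟨R0, hR0⟩ := hit_small (μ := μ) S.adapted S.cont hT hε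
  set R := max R0 ‖x‖ with hR
  set Q : Ω → Set ℝ := fun ω => {t | 0 ≤ t ∧ R ≤ ‖X t ω‖} ∪ {T} with hQ
  have hne : ∀ ω, (Q ω).Nonempty := fun ω => ⟨T, Or.inr rfl⟩
  have hlb : ∀ ω, ∀ t ∈ Q ω, 0 ≤ t := by
    rintro ω t (h | h)
    · exact h.1
    · rw [mem_singleton_iff.mp h]; exact hT
  have hbdd : ∀ ω, BddBelow (Q ω) := fun ω => ⟨0, hlb ω⟩
  have hcl : ∀ ω, IsClosed (Q ω) := fun ω =>
    ((isClosed_le continuous_const continuous_id).inter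
      (isClosed_le continuous_const (S.cont ω).norm)).union isClosed_singleton
  have hmem : ∀ ω, sInf (Q ω) ∈ Q ω := fun ω => (hcl ω).csInf_mem (hne ω) (hbdd ω)
  have hle : ∀ ω, sInf (Q ω) ≤ T := fun ω => csInf_le (hbdd ω) (Or.inr rfl)
  have key : ∀ ω s, s < T → (sInf (Q ω) ≤ s ↔ ∃ u ∈ Icc 0 s, R ≤ ‖X u ω‖) := by
    intro ω s hs
    constructor
    · intro h
      rcases hmem ω with h1 | h1
      · exact ⟨_, ⟨h1.1, h⟩, h1.2⟩
      · rw [mem_singleton_iff] at h1; linarith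
    · rintro ⟨u, hu, h⟩
      exact (csInf_le (hbdd ω) (Or.inl ⟨hu.1, h⟩)).trans hu.2
  refine ⟨R, fun ω => sInf (Q ω), (norm_nonneg x).trans (le_max_right _ _), fun ω => hlb ω _ (hmem ω), hle, ?_, ?_, ?_⟩
  · intro s hs
    by_cases h : s < T
    · have : {ω | sInf (Q ω) ≤ s} = {ω | ∃ u ∈ Icc 0 s, R ≤ ‖X u ω‖} := by
        ext ω; exact key ω s h
      rw [this]; exact hit_meas S.adapted S.cont hs R
    · have : {ω | sInf (Q ω) ≤ s} = univ := by
        ext ω; simp only [mem_ofPred_eq, mem_univ, iff_true]; linarith [hle ω, not_lt.mp h]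
      rw [this]; exact MeasurableSet.univ
  · intro ω u hu0 hu
    rcases eq_or_lt_of_le hu with h | h
    · rcases eq_or_lt_of_le hu0 with h0 | h0
      · rw [← h0, S.init]; exact le_max_right _ _
      · have hcl : IsClosed {v : ℝ | ‖X v ω‖ ≤ R} := isClosed_le (S.cont ω).norm continuous_const
        have hsub : Ico 0 u ⊆ {v : ℝ | ‖X v ω‖ ≤ R} := by
          intro v hv
          by_contra hc
          simp only [mem_ofPred_eq, not_le] at hc
          have := csInf_le (hbdd ω) (Or.inl ⟨hv.1, hc.le⟩ : v ∈ Q ω)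
          have := hv.2
          linarith
        have := hcl.closure_subset_iff.mpr hsub
        rw [closure_Ico h0.ne] at this
        exact this (right_mem_Icc.mpr hu0)
    · by_contra hc
      simp only [not_le] at hc
      have := csInf_le (hbdd ω) (Or.inl ⟨hu0, hc.le⟩ : u ∈ Q ω)
      linarith
  · refine le_trans (measureReal_mono ?_) (hR0 R (le_max_left _ _))
    intro ω hω
    obtain ⟨u, hu, h⟩ := (key ω _ hω).mp le_rfl
    exact ⟨u, ⟨hu.1, hu.2.trans (hle ω)⟩, h⟩
end



section
variable {k : ℕ} (c : Coef k)

lemma abs_dot_le {P : ℝ} {p v : Fin k → ℝ} {V : ℝ} (hP : 0 ≤ P) (hp : ∀ i, |p i| ≤ P) (hv : ∀ i, |v i| ≤ V) :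
    |∑ i, p i * v i| ≤ k * (P * V) := by
  calc |∑ i, p i * v i| ≤ ∑ i, |p i * v i| := Finset.abs_sum_le_sum_abs _ _
    _ ≤ ∑ i : Fin k, P * V := Finset.sum_le_sum fun i _ => by
        rw [abs_mul]; exact mul_le_mul (hp i) (hv i) (abs_nonneg _) hP
    _ = k * (P * V) := by simp

lemma abs_dot2_le {P : ℝ} {p v : Fin k → Fin k → ℝ} {V : ℝ} (hP : 0 ≤ P) (hp : ∀ i j, |p i j| ≤ P) (hv : ∀ i j, |v i j| ≤ V) :
    |∑ i, ∑ j, p i j * v i j| ≤ k * (k * (P * V)) := by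
  calc |∑ i, ∑ j, p i j * v i j| ≤ ∑ i, |∑ j, p i j * v i j| := Finset.abs_sum_le_sum_abs _ _
    _ ≤ ∑ i : Fin k, k * (P * V) := Finset.sum_le_sum fun i _ => abs_dot_le hP (hp i) (hv i)
    _ = k * (k * (P * V)) := by simp

lemma T_exp {R : ℝ} (hR : 0 ≤ R) : ∃ C1 : ℝ, 0 ≤ C1 ∧ ∀ (h : ℝ), 0 ≤ h → h ≤ 1 → ∀ (g : EE k → ℝ) (p : EE k → Fin k → ℝ)
    (q : EE k → Fin k → Fin k → ℝ) (K : ℝ), SM g p q K → ∀ x : EE k, ‖x‖ ≤ R →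
    |c.T h 0 g x - g x - h * (∑ i, p x i * c.b x i + (1/2) * ∑ i, ∑ j, q x i j * c.a x i j)|
      ≤ K * C1 * (h * Real.sqrt h) := by
  set Cb := c.C * (1 + R) with hCb
  have hC1 := c.C_one
  have hCb0 : 0 ≤ Cb := by positivity
  refine ⟨(2 * Cb) ^ 3 + k * (k * Cb ^ 2), by positivity, ?_⟩
  intro h hh hh1 g p q K S x hx
  have hK := S.K_nn
  set e := Real.sqrt h with he
  have he0 : 0 ≤ e := Real.sqrt_nonneg h
  have he2 : e ^ 2 = h := Real.sq_sqrt hh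
  have he1 : e ≤ 1 := by rw [he]; exact Real.sqrt_le_one.mpr hh1
  have hη : ∀ l, ‖c.eta h x l‖ ≤ 2 * Cb * e := by
    intro l
    refine (c.eta_norm hh hh1 x l).trans ?_
    rw [hCb]
    have : c.C * (1 + ‖x‖) ≤ c.C * (1 + R) := by gcongr
    nlinarith
  have hb : ‖c.b x‖ ≤ Cb := by
    refine (c.b_gr x).trans ?_
    rw [hCb]; gcongr
  set r : Fin c.m → ℝ := fun l => g (x + c.eta h x l) - g x - ∑ i, p x i * c.eta h x l i
    - (1/2) * ∑ i, ∑ j, q x i j * (c.eta h x l i * c.eta h x l j) with hr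
  have hrb : ∀ l, |r l| ≤ K * ((2 * Cb) ^ 3 * (h * e)) := by
    intro l
    refine (S.taylor x _).trans (mul_le_mul_of_nonneg_left ?_ hK)
    calc ‖c.eta h x l‖ ^ 2 * min 1 ‖c.eta h x l‖ ≤ (2 * Cb * e) ^ 2 * (2 * Cb * e) := by
          gcongr
          · exact hη l
          · exact (min_le_right _ _).trans (hη l)
      _ = (2 * Cb) ^ 3 * (h * e) := by rw [← he2]; ring
  have hm : ∀ i, ∑ l, c.p l * c.s l x i = 0 := by
    intro i
    have := congrArg (fun v : EE k => v i) (c.s_mean x)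
    simpa using this
  have hm1 : ∀ i, ∑ l, c.p l * c.eta h x l i = h * c.b x i := by
    intro i
    have : ∀ l, c.p l * c.eta h x l i = c.p l * (h * c.b x i) + e * (c.p l * c.s l x i) := by
      intro l; simp only [Coef.eta, PiLp.add_apply, PiLp.smul_apply, smul_eq_mul]; rw [he]; ring
    simp_rw [this]
    rw [Finset.sum_add_distrib, ← Finset.sum_mul, c.p_sum, ← Finset.mul_sum, hm]; ring
  have hm2 : ∀ i j, ∑ l, c.p l * (c.eta h x l i * c.eta h x l j) = h * c.a x i j + h^2 * (c.b x i * c.b x j) := by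
    intro i j
    have : ∀ l, c.p l * (c.eta h x l i * c.eta h x l j) = c.p l * (h^2 * (c.b x i * c.b x j))
        + e * h * c.b x j * (c.p l * c.s l x i) + e * h * c.b x i * (c.p l * c.s l x j)
        + h * (c.p l * (c.s l x i * c.s l x j)) := by
      intro l; simp only [Coef.eta, PiLp.add_apply, PiLp.smul_apply, smul_eq_mul]; rw [← he]
      have : e * e = h := by rw [← he2]; ring
      linear_combination (c.p l * c.s l x i * c.s l x j) * this
    simp_rw [this]
    rw [Finset.sum_add_distrib, Finset.sum_add_distrib, Finset.sum_add_distrib, ← Finset.sum_mul, c.p_sum, ← Finset.mul_sum, ← Finset.mul_sum, ← Finset.mul_sum, hm, hm]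
    simp only [Coef.a]; ring
  have key : c.T h 0 g x - g x - h * (∑ i, p x i * c.b x i + (1/2) * ∑ i, ∑ j, q x i j * c.a x i j)
      = ∑ l, c.p l * r l + (1/2) * h^2 * ∑ i, ∑ j, q x i j * (c.b x i * c.b x j) := by
    have e1 : ∑ l, c.p l * r l = c.T h 0 g x - g x - ∑ l, c.p l * ∑ i, p x i * c.eta h x l i
       - (1/2) * ∑ l, c.p l * ∑ i, ∑ j, q x i j * (c.eta h x l i * c.eta h x l j) := by
      simp only [Coef.T, add_zero]
      have : ∀ l, c.p l * r l = c.p l * g (x + c.eta h x l) - c.p l * g x - c.p l * ∑ i, p x i * c.eta h x l i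
         - (1/2) * (c.p l * ∑ i, ∑ j, q x i j * (c.eta h x l i * c.eta h x l j)) := by
        intro l; rw [hr]; ring
      simp_rw [this]
      rw [Finset.sum_sub_distrib, Finset.sum_sub_distrib, Finset.sum_sub_distrib, ← Finset.sum_mul, c.p_sum, ← Finset.mul_sum, one_mul]
    have e2 : ∑ l, c.p l * ∑ i, p x i * c.eta h x l i = h * ∑ i, p x i * c.b x i := by
      simp_rw [Finset.mul_sum]
      rw [Finset.sum_comm]
      refine Finset.sum_congr rfl fun i _ => ?_
      rw [show h * (p x i * c.b x i) = p x i * (h * c.b x i) by ring, ← hm1 i, Finset.mul_sum]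
      exact Finset.sum_congr rfl fun l _ => by ring
    have e3 : ∑ l, c.p l * ∑ i, ∑ j, q x i j * (c.eta h x l i * c.eta h x l j)
       = h * ∑ i, ∑ j, q x i j * c.a x i j + h^2 * ∑ i, ∑ j, q x i j * (c.b x i * c.b x j) := by
      simp_rw [Finset.mul_sum]
      rw [Finset.sum_comm, ← Finset.sum_add_distrib]
      refine Finset.sum_congr rfl fun i _ => ?_
      rw [Finset.sum_comm, ← Finset.sum_add_distrib]
      refine Finset.sum_congr rfl fun j _ => ?_
      rw [show h * (q x i j * c.a x i j) + h^2 * (q x i j * (c.b x i * c.b x j)) = q x i j * (h * c.a x i j + h^2 * (c.b x i * c.b x j)) by ring, ← hm2 i j, Finset.mul_sum]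
      exact Finset.sum_congr rfl fun l _ => by ring
    rw [e1, e2, e3]; ring
  rw [key]
  have b1 : |∑ l, c.p l * r l| ≤ K * ((2 * Cb) ^ 3 * (h * e)) := by
    calc |∑ l, c.p l * r l| ≤ ∑ l, |c.p l * r l| := Finset.abs_sum_le_sum_abs _ _
      _ ≤ ∑ l, c.p l * (K * ((2 * Cb) ^ 3 * (h * e))) := Finset.sum_le_sum fun l _ => by
          rw [abs_mul, abs_of_nonneg (c.p_nn l)]; exact mul_le_mul_of_nonneg_left (hrb l) (c.p_nn l)
      _ = _ := by rw [← Finset.sum_mul, c.p_sum, one_mul]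
  have b2 : |∑ i, ∑ j, q x i j * (c.b x i * c.b x j)| ≤ k * (k * (K * Cb ^ 2)) := by
    refine abs_dot2_le hK (S.q_bd x) fun i j => ?_
    rw [abs_mul, sq]
    exact mul_le_mul ((coord_le _ _).trans hb) ((coord_le _ _).trans hb) (abs_nonneg _) hCb0
  have b3 : h ^ 2 ≤ h * e := by
    rw [sq]; refine mul_le_mul_of_nonneg_left ?_ hh
    rw [← he2]; nlinarith
  calc _ ≤ |∑ l, c.p l * r l| + |(1/2) * h^2 * ∑ i, ∑ j, q x i j * (c.b x i * c.b x j)| := abs_add_le _ _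
    _ ≤ K * ((2 * Cb) ^ 3 * (h * e)) + (1/2) * (h * e) * (k * (k * (K * Cb ^ 2))) := by
        rw [abs_mul, abs_of_nonneg (by positivity : 0 ≤ (1/2) * h^2)]
        gcongr
    _ ≤ _ := by
        have : 0 ≤ (h * e) * (k * (k * (K * Cb ^ 2))) := by positivity
        nlinarith
end


set_option linter.unusedSectionVars false

section
variable {k : ℕ} (c : Coef k)

lemma Coef.b_cont : Continuous c.b := by
  have : LipschitzWith (Real.toNNReal c.C) c.b := LipschitzWith.of_dist_le_mul fun x y => by
    rw [dist_eq_norm, dist_eq_norm, Real.coe_toNNReal _ (by linarith [c.C_one])]; exact c.b_lip x y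
  exact this.continuous

lemma Coef.s_cont (l : Fin c.m) : Continuous (c.s l) := by
  have : LipschitzWith (Real.toNNReal c.C) (c.s l) := LipschitzWith.of_dist_le_mul fun x y => by
    rw [dist_eq_norm, dist_eq_norm, Real.coe_toNNReal _ (by linarith [c.C_one])]; exact c.s_lip l x y
  exact this.continuous

lemma Coef.a_cont (i j : Fin k) : Continuous fun y => c.a y i j := by
  unfold Coef.a
  refine continuous_finsetSum _ fun l _ => ?_
  have := c.s_cont l
  fun_prop

lemma Coef.avg_le (v : Fin c.m → ℝ) (B : ℝ) (hv : ∀ l, |v l| ≤ B) : |∑ l, c.p l * v l| ≤ B := by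
  calc |∑ l, c.p l * v l| ≤ ∑ l, |c.p l * v l| := Finset.abs_sum_le_sum_abs _ _
      _ ≤ ∑ l, c.p l * B := Finset.sum_le_sum fun l _ => by
          rw [abs_mul, abs_of_nonneg (c.p_nn l)]; exact mul_le_mul_of_nonneg_left (hv l) (c.p_nn l)
      _ = _ := by rw [← Finset.sum_mul, c.p_sum, one_mul]

lemma Coef.s_bd {R : ℝ} {y : EE k} (hy : ‖y‖ ≤ R) (l : Fin c.m) (i : Fin k) : |c.s l y i| ≤ c.C * (1 + R) := by
  refine (coord_le _ _).trans ((c.s_gr l y).trans ?_)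
  have := c.C_one
  gcongr

lemma Coef.b_bd {R : ℝ} {y : EE k} (hy : ‖y‖ ≤ R) : ‖c.b y‖ ≤ c.C * (1 + R) := by
  refine (c.b_gr y).trans ?_
  have := c.C_one
  gcongr

lemma Coef.a_bd {R : ℝ} {y : EE k} (hy : ‖y‖ ≤ R) (i j : Fin k) : |c.a y i j| ≤ (c.C * (1 + R)) ^ 2 := by
  refine c.avg_le _ _ fun l => ?_
  rw [abs_mul, sq]
  have := c.s_bd hy l i
  exact mul_le_mul this (c.s_bd hy l j) (abs_nonneg _) ((abs_nonneg _).trans this)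

lemma Coef.a_lip {R : ℝ} {y y' : EE k} (hy : ‖y‖ ≤ R) (hy' : ‖y'‖ ≤ R) (i j : Fin k) :
    |c.a y i j - c.a y' i j| ≤ 2 * (c.C * (1 + R)) * c.C * ‖y - y'‖ := by
  have : c.a y i j - c.a y' i j = ∑ l, c.p l * (c.s l y i * c.s l y j - c.s l y' i * c.s l y' j) := by
    unfold Coef.a; rw [← Finset.sum_sub_distrib]; exact Finset.sum_congr rfl fun l _ => by ring
  rw [this]
  refine c.avg_le _ _ fun l => ?_
  have e : c.s l y i * c.s l y j - c.s l y' i * c.s l y' j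
    = c.s l y i * (c.s l y - c.s l y') j + c.s l y' j * (c.s l y - c.s l y') i := by
    simp only [PiLp.sub_apply]; ring
  have h1 : ∀ j, |(c.s l y - c.s l y') j| ≤ c.C * ‖y - y'‖ := fun j => (coord_le _ _).trans (c.s_lip l y y')
  rw [e]
  refine (abs_add_le _ _).trans ?_
  rw [abs_mul, abs_mul]
  have a1 := mul_le_mul (c.s_bd hy l i) (h1 j) (abs_nonneg _) ((abs_nonneg _).trans (c.s_bd hy l i))
  have a2 := mul_le_mul (c.s_bd hy' l j) (h1 i) (abs_nonneg _) ((abs_nonneg _).trans (c.s_bd hy l i))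
  linarith
end

/-- localisation by an exit time -/
structure Loc {Ω : Type*} {mΩ : MeasurableSpace Ω} {k : ℕ} (ℱ : Filtration ℝ mΩ) (X : ℝ → Ω → EE k)
    (T R : ℝ) (τ : Ω → ℝ) : Prop where
  T_nn : 0 ≤ T
  R_nn : 0 ≤ R
  nn : ∀ ω, 0 ≤ τ ω
  le : ∀ ω, τ ω ≤ T
  meas : ∀ s ≥ 0, MeasurableSet[ℱ s] {ω | τ ω ≤ s}
  bd : ∀ ω u, 0 ≤ u → u ≤ τ ω → ‖X u ω‖ ≤ R

section
variable {Ω : Type*} {mΩ : MeasurableSpace Ω} {μ : Measure Ω} [IsProbabilityMeasure μ] {ℱ : Filtration ℝ mΩ}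
  {k : ℕ} {c : Coef k} {x : EE k} {X M : ℝ → Ω → EE k} {T R : ℝ} {τ : Ω → ℝ}

lemma pull_out {s : ℝ} {Z D : Ω → ℝ} {c c' : ℝ} (hZ : Measurable[ℱ s] Z) (hZb : ∀ ω, |Z ω| ≤ c)
    (hD : AEStronglyMeasurable D μ) (hDb : ∀ ω, |D ω| ≤ c')
    (h : ∀ A, MeasurableSet[ℱ s] A → ∫ ω in A, D ω ∂μ = 0) : ∫ ω, Z ω * D ω ∂μ = 0 := by
  have hDi : Integrable D μ := Integrable.of_bound hD c' (ae_of_all _ fun ω => by simpa using hDb ω)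
  have hZs : StronglyMeasurable[ℱ s] Z := hZ.stronglyMeasurable
  have h0 : (0 : Ω → ℝ) =ᵐ[μ] μ[D | ℱ s] := by
    refine ae_eq_condExp_of_forall_setIntegral_eq (ℱ.le s) hDi (fun _ _ _ => integrableOn_zero) ?_ ?_
    · intro A hA _
      simp [h A hA]
    · exact (stronglyMeasurable_zero).aestronglyMeasurable
  have hZD : Integrable (fun ω => Z ω * D ω) μ :=
    hDi.bdd_mul (c := c) (hZs.mono (ℱ.le s)).aestronglyMeasurable (ae_of_all _ fun ω => by simpa using hZb ω)
  have h1 := condExp_mul_of_stronglyMeasurable_left (μ := μ) hZs hZD hDi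
  have h2 : ∫ ω, Z ω * D ω ∂μ = ∫ ω, (μ[Z * D | ℱ s]) ω ∂μ := (integral_condExp (ℱ.le s)).symm
  rw [h2, integral_congr_ae h1, integral_congr_ae (g := 0)]
  · simp
  · filter_upwards [h0] with ω hω
    simp [← hω]

namespace Sol
variable (S : Sol c μ ℱ x X M) (L : Loc ℱ X T R τ)
include S

lemma M0 (ω) : M 0 ω = 0 := by
  have := S.eqn ω 0 le_rfl
  rw [S.init ω] at this
  simpa using this

lemma int_cont {E : Type*} [NormedAddCommGroup E] [NormedSpace ℝ E] {φ : EE k → E} (hφ : Continuous φ) (ω : Ω) :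
    ContinuousOn (fun t => ∫ s in Ioc (0:ℝ) t, φ (X s ω)) (Ici 0) := by
  have hc : Continuous fun s => φ (X s ω) := hφ.comp (S.cont ω)
  have h1 : Continuous fun t => ∫ s in (0:ℝ)..t, φ (X s ω) :=
    intervalIntegral.continuous_primitive (fun a b => hc.intervalIntegrable a b) 0
  refine h1.continuousOn.congr fun t ht => ?_
  exact (intervalIntegral.integral_of_le ht).symm

lemma M_cont (ω : Ω) : ContinuousOn (fun t => M t ω) (Ici 0) := by
  have h1 : ContinuousOn (fun t => X t ω - x - ∫ s in Ioc (0:ℝ) t, c.b (X s ω)) (Ici 0) :=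
    ((S.cont ω).continuousOn.sub continuousOn_const).sub (S.int_cont c.b_cont ω)
  refine h1.congr fun t ht => ?_
  simp only [S.eqn ω t ht]; abel

lemma int_sub {E : Type*} [NormedAddCommGroup E] [NormedSpace ℝ E] {φ : EE k → E} (hφ : Continuous φ) (ω : Ω)
    {u v : ℝ} (hu : 0 ≤ u) (huv : u ≤ v) :
    (∫ s in Ioc (0:ℝ) v, φ (X s ω)) - (∫ s in Ioc (0:ℝ) u, φ (X s ω)) = ∫ s in u..v, φ (X s ω) := by
  have hc : Continuous fun s => φ (X s ω) := hφ.comp (S.cont ω)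
  rw [← intervalIntegral.integral_of_le hu, ← intervalIntegral.integral_of_le (hu.trans huv)]
  exact intervalIntegral.integral_interval_sub_left (hc.intervalIntegrable _ _) (hc.intervalIntegrable _ _)

omit S in
include L in
lemma int_le {E : Type*} [NormedAddCommGroup E] [NormedSpace ℝ E] {φ : EE k → E} {B : ℝ} (hB : ∀ y, ‖y‖ ≤ R → ‖φ y‖ ≤ B) (ω : Ω)
    {u v : ℝ} (hu : 0 ≤ u) (huv : u ≤ v) (hv : v ≤ τ ω) : ‖∫ s in u..v, φ (X s ω)‖ ≤ B * (v - u) := by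
  have := intervalIntegral.norm_integral_le_of_norm_le_const (a := u) (b := v) (f := fun s => φ (X s ω)) (C := B) (by
    intro s hs
    rw [uIoc_of_le huv] at hs
    exact hB _ (L.bd ω s (hu.trans hs.1.le) (hs.2.trans hv)))
  rwa [abs_of_nonneg (by linarith)] at this

include L in
lemma M_bd (ω : Ω) {u : ℝ} (hu : 0 ≤ u) (hv : u ≤ τ ω) : ‖M u ω‖ ≤ R + ‖x‖ + c.C * (1 + R) * T := by
  have h1 := S.eqn ω u hu
  have h2 : M u ω = X u ω - x - ∫ s in (0:ℝ)..u, c.b (X s ω) := by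
    rw [intervalIntegral.integral_of_le hu]; rw [h1]; abel
  have h3 := int_le L (φ := c.b) (fun y hy => c.b_bd hy) ω le_rfl hu hv
  rw [h2]
  have h4 := L.bd ω u hu hv
  have hC := c.C_one
  have hR := L.R_nn
  have : c.C * (1 + R) * (u - 0) ≤ c.C * (1 + R) * T := by
    have := L.le ω
    gcongr; linarith
  calc _ ≤ ‖X u ω‖ + ‖x‖ + ‖∫ s in (0:ℝ)..u, c.b (X s ω)‖ :=
        (norm_sub_le _ _).trans (by gcongr; exact norm_sub_le _ _)
    _ ≤ _ := by linarith

end Sol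

/-- martingale increment -/
noncomputable def dM (M : ℝ → Ω → EE k) (τ : Ω → ℝ) (s t : ℝ) (ω : Ω) : EE k := M (min t (τ ω)) ω - M (min s (τ ω)) ω
/-- covariation increment -/
noncomputable def dA (c : Coef k) (X : ℝ → Ω → EE k) (τ : Ω → ℝ) (s t : ℝ) (i j : Fin k) (ω : Ω) : ℝ :=
  ∫ u in (min s (τ ω))..(min t (τ ω)), c.a (X u ω) i j

namespace Sol
variable (S : Sol c μ ℱ x X M) (L : Loc ℱ X T R τ)
include S L

lemma lin (i : Fin k) {s t : ℝ} (hs : 0 ≤ s) (hst : s ≤ t) :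
    AEStronglyMeasurable (fun ω => dM M τ s t ω i) μ ∧
    ∀ (Z : Ω → ℝ) (cz : ℝ), Measurable[ℱ s] Z → (∀ ω, |Z ω| ≤ cz) → ∫ ω, Z ω * dM M τ s t ω i ∂μ = 0 := by
  have hb : ∀ u ≥ 0, ∀ ω, |M (min u (τ ω)) ω i| ≤ R + ‖x‖ + c.C * (1 + R) * T := fun u hu ω =>
    (coord_le _ _).trans (S.M_bd L ω (le_min hu (L.nn ω)) (min_le_right _ _))
  have hc : ∀ ω, ContinuousOn (fun t => M t ω i) (Ici 0) := fun ω =>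
    (by fun_prop : Continuous fun y : EE k => y i).comp_continuousOn (S.M_cont ω)
  have h1 := fun A hA => stopped_mart (S.mart i) hc L.meas hs hst (hb t (hs.trans hst)) (A := A) hA
  have hm : AEStronglyMeasurable (fun ω => dM M τ s t ω i) μ := by
    have := (h1 univ MeasurableSet.univ).2
    simpa [dM] using this
  refine ⟨hm, fun Z cz hZ hZb => ?_⟩
  refine pull_out hZ hZb hm (c' := (R + ‖x‖ + c.C * (1 + R) * T) + (R + ‖x‖ + c.C * (1 + R) * T)) ?_ ?_
  · intro ω
    simp only [dM, PiLp.sub_apply]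
    exact (abs_sub _ _).trans (add_le_add (hb t (hs.trans hst) ω) (hb s hs ω))
  · intro A hA
    have := (h1 A hA).1
    simpa [dM] using this

lemma dM_bd {s t : ℝ} (hs : 0 ≤ s) (hst : s ≤ t) (ω : Ω) : ‖dM M τ s t ω‖ ≤ 2 * (R + ‖x‖ + c.C * (1 + R) * T) := by
  have h1 := S.M_bd L ω (le_min hs (L.nn ω)) (min_le_right _ _)
  have h2 := S.M_bd L ω (le_min (hs.trans hst) (L.nn ω)) (min_le_right _ _)
  have := norm_sub_le (M (min t (τ ω)) ω) (M (min s (τ ω)) ω)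
  unfold dM; linarith

omit S in
lemma dA_bd {s t : ℝ} (hs : 0 ≤ s) (hst : s ≤ t) (i j : Fin k) (ω : Ω) :
    |dA c X τ s t i j ω| ≤ (c.C * (1 + R)) ^ 2 * (t - s) := by
  have h := int_le L (φ := fun y => c.a y i j) (fun y hy => c.a_bd hy i j) ω (le_min hs (L.nn ω))
    (min_le_min_right (τ ω) hst) (min_le_right _ _)
  refine h.trans (mul_le_mul_of_nonneg_left ?_ (sq_nonneg _))
  rcases le_total s (τ ω) with h1 | h1
  · rw [min_eq_left h1]; linarith [min_le_left t (τ ω)]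
  · rw [min_eq_right h1, min_eq_right (h1.trans hst)]; linarith

lemma quad (i j : Fin k) {s t : ℝ} (hs : 0 ≤ s) (hst : s ≤ t) :
    AEStronglyMeasurable (fun ω => dM M τ s t ω i * dM M τ s t ω j - dA c X τ s t i j ω) μ ∧
    ∀ (Z : Ω → ℝ) (cz : ℝ), Measurable[ℱ s] Z → (∀ ω, |Z ω| ≤ cz) → (∀ ω, τ ω ≤ s → Z ω = 0) →
      ∫ ω, Z ω * (dM M τ s t ω i * dM M τ s t ω j - dA c X τ s t i j ω) ∂μ = 0 := by
  set Q := R + ‖x‖ + c.C * (1 + R) * T with hQ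
  have hQ0 : 0 ≤ Q := (norm_nonneg _).trans (S.M_bd L (u := 0) (Classical.choice (nonempty_of_isProbabilityMeasure μ)) le_rfl (L.nn _))
  have hb : ∀ u ≥ 0, ∀ ω i, |M (min u (τ ω)) ω i| ≤ Q := fun u hu ω i =>
    (coord_le _ _).trans (S.M_bd L ω (le_min hu (L.nn ω)) (min_le_right _ _))
  have hc : ∀ ω i, ContinuousOn (fun t => M t ω i) (Ici 0) := fun ω i =>
    (by fun_prop : Continuous fun y : EE k => y i).comp_continuousOn (S.M_cont ω)
  have hc2 : ∀ ω, ContinuousOn (fun t => M t ω i * M t ω j - ∫ s in Set.Ioc (0:ℝ) t, c.a (X s ω) i j) (Ici 0) := fun ω =>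
    ((hc ω i).mul (hc ω j)).sub (S.int_cont (c.a_cont i j) ω)
  have hb2 : ∀ u ≥ 0, ∀ ω, |M (min u (τ ω)) ω i * M (min u (τ ω)) ω j - ∫ s in Set.Ioc (0:ℝ) (min u (τ ω)), c.a (X s ω) i j|
      ≤ Q * Q + (c.C * (1 + R)) ^ 2 * T := by
    intro u hu ω
    have h0 : 0 ≤ min u (τ ω) := le_min hu (L.nn ω)
    refine (abs_sub _ _).trans (add_le_add ?_ ?_)
    · rw [abs_mul]; exact mul_le_mul (hb u hu ω i) (hb u hu ω j) (abs_nonneg _) hQ0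
    · have h := int_le L (φ := fun y => c.a y i j) (fun y hy => c.a_bd hy i j) ω le_rfl h0 (min_le_right _ _)
      rw [intervalIntegral.integral_of_le h0] at h
      refine h.trans ?_
      gcongr
      have := L.le ω
      linarith [min_le_right u (τ ω)]
  have h1 := fun A hA => stopped_mart (S.qvar i j) hc2 L.meas hs hst (hb2 t (hs.trans hst)) (A := A) hA
  set Z2 : Ω → ℝ := fun ω => (M (min t (τ ω)) ω i * M (min t (τ ω)) ω j - ∫ s in Set.Ioc (0:ℝ) (min t (τ ω)), c.a (X s ω) i j)
    - (M (min s (τ ω)) ω i * M (min s (τ ω)) ω j - ∫ u in Set.Ioc (0:ℝ) (min s (τ ω)), c.a (X u ω) i j) with hZ2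
  have hm2 : AEStronglyMeasurable Z2 μ := by
    have := (h1 univ MeasurableSet.univ).2
    simpa using this
  have hMs : ∀ i, AEStronglyMeasurable (fun ω => M (min s (τ ω)) ω i) μ := by
    intro i
    have := (S.lin L i le_rfl hs).1
    refine this.congr (ae_of_all _ fun ω => ?_)
    simp [dM, min_eq_left (L.nn ω), S.M0 ω]
  have id1 : ∀ ω, dM M τ s t ω i * dM M τ s t ω j - dA c X τ s t i j ω
      = Z2 ω - M (min s (τ ω)) ω i * dM M τ s t ω j - M (min s (τ ω)) ω j * dM M τ s t ω i := by
    intro ω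
    have := S.int_sub (c.a_cont i j) ω (le_min hs (L.nn ω)) (min_le_min_right (τ ω) hst)
    simp only [dM, dA, hZ2, PiLp.sub_apply]
    rw [← this]; ring
  have hm : AEStronglyMeasurable (fun ω => dM M τ s t ω i * dM M τ s t ω j - dA c X τ s t i j ω) μ := by
    simp_rw [id1]
    exact (hm2.sub ((hMs i).mul (S.lin L j hs hst).1)).sub ((hMs j).mul (S.lin L i hs hst).1)
  refine ⟨hm, fun Z cz hZ hZb hZ0 => ?_⟩
  have hcz : 0 ≤ cz := (abs_nonneg _).trans (hZb (Classical.choice (nonempty_of_isProbabilityMeasure μ)))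
  -- Z * M_s is measurable
  have hZM : ∀ i, Measurable[ℱ s] (fun ω => Z ω * M s ω i) := fun i =>
    hZ.mul ((S.mart i).1 s).measurable
  have hZMe : ∀ i ω, Z ω * M (min s (τ ω)) ω i = Z ω * M s ω i := by
    intro i ω
    rcases le_or_gt (τ ω) s with h | h
    · rw [hZ0 ω h]; simp
    · rw [min_eq_left h.le]
  have hZMb : ∀ i ω, |Z ω * M s ω i| ≤ cz * Q := by
    intro i ω
    rw [← hZMe, abs_mul]
    exact mul_le_mul (hZb ω) (hb s hs ω i) (abs_nonneg _) hcz
  have I1 : ∫ ω, Z ω * Z2 ω ∂μ = 0 := by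
    refine pull_out hZ hZb hm2 (c' := (Q * Q + (c.C * (1 + R)) ^ 2 * T) + (Q * Q + (c.C * (1 + R)) ^ 2 * T)) ?_ ?_
    · intro ω
      exact (abs_sub _ _).trans (add_le_add (hb2 t (hs.trans hst) ω) (hb2 s hs ω))
    · intro A hA
      exact (h1 A hA).1
  have I2 := fun i j => (S.lin L j hs hst).2 _ _ (hZM i) (hZMb i)
  have hZm : AEStronglyMeasurable Z μ := (hZ.mono (ℱ.le s) le_rfl).aestronglyMeasurable
  have hdb : ∀ i ω, |dM M τ s t ω i| ≤ 2 * Q := fun i ω => (coord_le _ _).trans (S.dM_bd L hs hst ω)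
  have int1 : Integrable (fun ω => Z ω * Z2 ω) μ := by
    refine Integrable.of_bound (hZm.mul hm2) (cz * ((Q * Q + (c.C * (1 + R)) ^ 2 * T) + (Q * Q + (c.C * (1 + R)) ^ 2 * T))) (ae_of_all _ fun ω => ?_)
    rw [Real.norm_eq_abs, abs_mul]
    exact mul_le_mul (hZb ω) ((abs_sub _ _).trans (add_le_add (hb2 t (hs.trans hst) ω) (hb2 s hs ω))) (abs_nonneg _) hcz
  have int2 : ∀ i j, Integrable (fun ω => Z ω * M s ω i * dM M τ s t ω j) μ := by
    intro i j
    refine Integrable.of_bound ((((hZM i).mono (ℱ.le s) le_rfl).aestronglyMeasurable).mul (S.lin L j hs hst).1) (cz * Q * (2 * Q)) (ae_of_all _ fun ω => ?_)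
    rw [Real.norm_eq_abs, abs_mul]
    exact mul_le_mul (hZMb i ω) (hdb j ω) (abs_nonneg _) (by positivity)
  have : ∀ ω, Z ω * (dM M τ s t ω i * dM M τ s t ω j - dA c X τ s t i j ω)
     = Z ω * Z2 ω - Z ω * M s ω i * dM M τ s t ω j - Z ω * M s ω j * dM M τ s t ω i := by
    intro ω; rw [id1, ← hZMe, ← hZMe]; ring
  simp_rw [this]
  have i12 : Integrable (fun ω => Z ω * Z2 ω - Z ω * M s ω i * dM M τ s t ω j) μ := int1.sub (int2 i j)
  rw [integral_sub i12 (int2 j i), integral_sub int1 (int2 i j), I1, I2 i j, I2 j i]; simp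

end Sol
end


set_option linter.unusedSectionVars false

section
variable {Ω : Type*} {mΩ : MeasurableSpace Ω} {μ : Measure Ω} [IsProbabilityMeasure μ] {ℱ : Filtration ℝ mΩ}
  {k : ℕ} {c : Coef k} {x : EE k} {X M : ℝ → Ω → EE k} {T R : ℝ} {τ : Ω → ℝ}

/-- stopped process -/
noncomputable def Yc (X : ℝ → Ω → EE k) (τ : Ω → ℝ) (u : ℝ) (ω : Ω) : EE k := X (min (max u 0) (τ ω)) ω

/-- oscillation of the stopped path -/
noncomputable def osc (X : ℝ → Ω → EE k) (τ : Ω → ℝ) (h : ℝ) (ω : Ω) : ℝ :=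
  ⨆ q : ℚ × ℚ, if |(q.1 : ℝ) - q.2| < 2 * h then ‖Yc X τ q.1 ω - Yc X τ q.2 ω‖ else 0

namespace Sol
variable (S : Sol c μ ℱ x X M) (L : Loc ℱ X T R τ)

include S in
lemma unc : Measurable (Function.uncurry X) :=
  measurable_uncurry_of_continuous_of_measurable (fun ω => S.cont ω) (fun t => (S.adapted t).mono (ℱ.le t) le_rfl)

include L in
lemma τ_meas : Measurable τ := by
  refine measurable_of_Iic fun s => ?_
  rcases le_or_gt 0 s with h | h
  · exact ℱ.le s _ (L.meas s h)
  · convert MeasurableSet.empty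
    ext ω
    simp only [mem_preimage, mem_Iic, mem_empty_iff_false, iff_false, not_le]
    exact h.trans_le (L.nn ω)

include S L in
lemma Yc_meas (u : ℝ) : Measurable (Yc X τ u) := by
  have h1 : Measurable fun ω => (min (max u 0) (τ ω), ω) := (measurable_const.min (τ_meas L)).prodMk measurable_id
  exact S.unc.comp h1

include S L in
lemma Ys_meas {u : ℝ} (hu : 0 ≤ u) : Measurable fun ω => X (min u (τ ω)) ω := by
  have := S.Yc_meas L u
  unfold Yc at this; rwa [max_eq_left hu] at this

include L in
lemma Yc_bd (u : ℝ) (ω : Ω) : ‖Yc X τ u ω‖ ≤ R :=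
  L.bd ω _ (le_min (le_max_right _ _) (L.nn ω)) (min_le_right _ _)

include L in
lemma osc_elem (h : ℝ) (ω : Ω) (q : ℚ × ℚ) :
    (if |(q.1 : ℝ) - q.2| < 2 * h then ‖Yc X τ q.1 ω - Yc X τ q.2 ω‖ else 0) ≤ 2 * R := by
  have := L.R_nn
  split_ifs
  · have := norm_sub_le (Yc X τ q.1 ω) (Yc X τ q.2 ω)
    linarith [Yc_bd L q.1 ω, Yc_bd L q.2 ω]
  · linarith

include L in
lemma osc_bdd (h : ℝ) (ω : Ω) : BddAbove (range fun q : ℚ × ℚ => if |(q.1 : ℝ) - q.2| < 2 * h then ‖Yc X τ q.1 ω - Yc X τ q.2 ω‖ else 0) :=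
  ⟨2 * R, by rintro _ ⟨q, rfl⟩; exact osc_elem L h ω q⟩

include L in
lemma osc_le (h : ℝ) (ω : Ω) : osc X τ h ω ≤ 2 * R := ciSup_le fun q => osc_elem L h ω q

lemma osc_nn (h : ℝ) (ω : Ω) : 0 ≤ osc X τ h ω := Real.iSup_nonneg fun q => by split_ifs <;> positivity

include S L in
lemma osc_meas (h : ℝ) : Measurable (osc X τ h) := by
  refine Measurable.iSup fun q => ?_
  split_ifs
  · exact ((S.Yc_meas L _).sub (S.Yc_meas L _)).norm
  · exact measurable_const

include S in
lemma Yc_cont (ω : Ω) : Continuous fun u => Yc X τ u ω :=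
  (S.cont ω).comp (by fun_prop : Continuous fun u : ℝ => min (max u 0) (τ ω))

include S L in
lemma osc_ge {h : ℝ} (hh : 0 < h) (ω : Ω) {u v : ℝ} (huv : |u - v| ≤ h) : ‖Yc X τ u ω - Yc X τ v ω‖ ≤ osc X τ h ω := by
  by_contra hcon
  push Not at hcon
  have hY := S.Yc_cont (τ := τ) ω
  have ho : IsOpen {p : ℝ × ℝ | |p.1 - p.2| < 2 * h ∧ osc X τ h ω < ‖Yc X τ p.1 ω - Yc X τ p.2 ω‖} := by
    refine IsOpen.inter ?_ ?_
    · exact isOpen_lt ((continuous_fst.sub continuous_snd).abs : Continuous fun p : ℝ × ℝ => |p.1 - p.2|) continuous_const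
    · exact isOpen_lt continuous_const ((hY.comp continuous_fst).sub (hY.comp continuous_snd)).norm
  have hd : DenseRange (fun q : ℚ × ℚ => ((q.1 : ℝ), (q.2 : ℝ))) := Rat.denseRange_cast.prodMap Rat.denseRange_cast
  obtain ⟨_, hy, q, rfl⟩ := hd.inter_open_nonempty _ ho ⟨(u, v), by simp only [mem_ofPred_eq]; exact ⟨by linarith, hcon⟩⟩
  obtain ⟨h1, h2⟩ := hy
  have h3 := le_ciSup (osc_bdd L h ω) q
  simp only at h1 h2 h3
  rw [if_pos h1] at h3
  exact absurd h3 (not_le.mpr h2)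

include S L in
lemma osc_ge' {h : ℝ} (hh : 0 < h) (ω : Ω) {u v : ℝ} (hu : 0 ≤ u) (hv : 0 ≤ v) (huv : |u - v| ≤ h) :
    ‖X (min u (τ ω)) ω - X (min v (τ ω)) ω‖ ≤ osc X τ h ω := by
  have := S.osc_ge L hh ω huv
  unfold Yc at this; rwa [max_eq_left hu, max_eq_left hv] at this

include S L in
lemma osc_small {ε : ℝ} (hε : 0 < ε) : ∃ h0 > 0, ∀ h, 0 < h → h < h0 → ∫ ω, osc X τ h ω ∂μ ≤ ε := by
  have ht : Tendsto (fun h => ∫ ω, osc X τ h ω ∂μ) (𝓝[>] 0) (𝓝 (∫ ω : Ω, (0:ℝ) ∂μ)) := by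
    refine tendsto_integral_filter_of_dominated_convergence (fun _ => 2 * R) ?_ ?_ (integrable_const _) ?_
    · exact Eventually.of_forall fun h => (S.osc_meas L h).aestronglyMeasurable
    · exact Eventually.of_forall fun h => ae_of_all _ fun ω => by
        rw [Real.norm_of_nonneg (osc_nn h ω)]; exact osc_le L h ω
    · refine ae_of_all _ fun ω => ?_
      have huc : UniformContinuousOn (fun u => X u ω) (Icc 0 T) := isCompact_Icc.uniformContinuousOn_of_continuous (S.cont ω).continuousOn
      rw [Metric.tendsto_nhds]
      intro e he
      rw [Metric.uniformContinuousOn_iff] at huc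
      obtain ⟨d, hd, hd'⟩ := huc (e/2) (by linarith)
      filter_upwards [Ioo_mem_nhdsGT (show (0:ℝ) < d / 2 by linarith)] with h hh
      rw [Real.dist_eq, sub_zero, abs_of_nonneg (osc_nn h ω)]
      refine lt_of_le_of_lt (ciSup_le fun q => ?_) (show e/2 < e by linarith)
      split_ifs with hq
      · rw [← dist_eq_norm]
        refine (hd' _ ⟨le_min (le_max_right _ _) (L.nn ω), (min_le_right _ _).trans (L.le ω)⟩ _ ⟨le_min (le_max_right _ _) (L.nn ω), (min_le_right _ _).trans (L.le ω)⟩ ?_).le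
        rw [Real.dist_eq]
        have h1 : |min (max (q.1:ℝ) 0) (τ ω) - min (max (q.2:ℝ) 0) (τ ω)| ≤ |(q.1 : ℝ) - q.2| :=
          (abs_min_sub_min_le_max _ _ _ _).trans (by
            rw [sub_self, abs_zero, max_eq_left (abs_nonneg _)]
            refine (abs_max_sub_max_le_max _ _ _ _).trans (by simp))
        linarith [hh.2]
      · linarith
  simp only [integral_zero] at ht
  have := (ht.eventually (ge_mem_nhds hε) : ∀ᶠ h in 𝓝[>] (0:ℝ), _)
  rw [eventually_nhdsWithin_iff, Metric.eventually_nhds_iff] at this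
  obtain ⟨h0, hh0, H⟩ := this
  refine ⟨h0, hh0, fun h hh hlt => H ?_ hh⟩
  rw [Real.dist_eq, sub_zero, abs_of_pos hh]; exact hlt

/-- indicator of overshooting -/
noncomputable def ind (τ : Ω → ℝ) (t : ℝ) (ω : Ω) : ℝ := if τ ω < t then 1 else 0

lemma ind_nn (t : ℝ) (ω : Ω) : 0 ≤ ind τ t ω := by unfold ind; split_ifs <;> norm_num
lemma ind_le (t : ℝ) (ω : Ω) : ind τ t ω ≤ 1 := by unfold ind; split_ifs <;> norm_num

include S L in
lemma riem {E : Type*} [NormedAddCommGroup E] [NormedSpace ℝ E] [CompleteSpace E] {φ : EE k → E} (hφ : Continuous φ) {B Λ : ℝ}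
    (hB : ∀ y, ‖y‖ ≤ R → ‖φ y‖ ≤ B) (hΛ0 : 0 ≤ Λ) (hΛ : ∀ y y', ‖y‖ ≤ R → ‖y'‖ ≤ R → ‖φ y - φ y'‖ ≤ Λ * ‖y - y'‖)
    {s h : ℝ} (hs : 0 ≤ s) (hh : 0 < h) (ω : Ω) (hsτ : s < τ ω) :
    ‖(∫ u in s..(min (s + h) (τ ω)), φ (X u ω)) - h • φ (X s ω)‖ ≤ h * (Λ * osc X τ h ω) + 2 * B * h * ind τ (s + h) ω := by
  have hB0 : 0 ≤ B := (norm_nonneg _).trans (hB 0 (by simpa using L.R_nn))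
  have ho := osc_nn (X := X) (τ := τ) h ω
  by_cases hlt : τ ω < s + h
  · rw [min_eq_right hlt.le]
    have h1 := int_le L hB ω hs hsτ.le le_rfl
    have h2 : ‖h • φ (X s ω)‖ ≤ h * B := by
      rw [norm_smul, Real.norm_of_nonneg hh.le]; exact mul_le_mul_of_nonneg_left (hB _ (L.bd ω s hs hsτ.le)) hh.le
    have h3 : B * (τ ω - s) ≤ B * h := mul_le_mul_of_nonneg_left (by linarith) hB0
    have h4 : 0 ≤ h * (Λ * osc X τ h ω) := by positivity
    simp only [ind, if_pos hlt]
    refine (norm_sub_le _ _).trans ?_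
    linarith
  · push Not at hlt
    rw [min_eq_left hlt]
    have hc : Continuous fun s => φ (X s ω) := hφ.comp (S.cont ω)
    have e : h • φ (X s ω) = ∫ u in s..(s+h), φ (X s ω) := by rw [intervalIntegral.integral_const]; congr 1; ring
    rw [e, ← intervalIntegral.integral_sub (hc.intervalIntegrable _ _) (by simp)]
    have h5 := intervalIntegral.norm_integral_le_of_norm_le_const (a := s) (b := s + h) (f := fun u => φ (X u ω) - φ (X s ω)) (C := Λ * osc X τ h ω) (by
      intro u hu
      rw [uIoc_of_le (by linarith)] at hu
      have hu2 : u ≤ τ ω := hu.2.trans hlt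
      refine (hΛ _ _ (L.bd ω u (by linarith [hu.1]) hu2) (L.bd ω s hs hsτ.le)).trans (mul_le_mul_of_nonneg_left ?_ hΛ0)
      have := S.osc_ge' L hh ω (u := u) (v := s) (by linarith [hu.1]) hs (by rw [abs_of_nonneg (by linarith [hu.1])]; linarith [hu.2])
      rwa [min_eq_left hu2, min_eq_left hsτ.le] at this)
    rw [add_sub_cancel_left, abs_of_pos hh] at h5
    have := mul_nonneg (mul_nonneg (mul_nonneg zero_le_two hB0) hh.le) (ind_nn (τ := τ) (s+h) ω)
    linarith
end Sol
end


set_option linter.unusedSectionVars false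

section
variable {Ω : Type*} {mΩ : MeasurableSpace Ω} {μ : Measure Ω} [IsProbabilityMeasure μ] {ℱ : Filtration ℝ mΩ}
  {k : ℕ} {c : Coef k} {x : EE k} {X M : ℝ → Ω → EE k} {T R : ℝ} {τ : Ω → ℝ}

namespace Sol
variable (S : Sol c μ ℱ x X M) (L : Loc ℱ X T R τ)
include S L

lemma incr (ω : Ω) {s t : ℝ} (hs : 0 ≤ s) (hst : s ≤ t) :
    X (min t (τ ω)) ω - X (min s (τ ω)) ω = dM M τ s t ω + ∫ u in (min s (τ ω))..(min t (τ ω)), c.b (X u ω) := by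
  have h0 := le_min hs (L.nn ω)
  have h1 := min_le_min_right (τ ω) hst
  rw [← S.int_sub c.b_cont ω h0 h1, S.eqn ω _ h0, S.eqn ω _ (h0.trans h1)]
  unfold dM; abel

lemma path_step : ∃ C2 : ℝ, 0 ≤ C2 ∧ ∀ (h : ℝ), 0 < h → h ≤ 1 → ∀ (g : EE k → ℝ) (p : EE k → Fin k → ℝ)
    (q : EE k → Fin k → Fin k → ℝ) (K : ℝ), SM g p q K → ∀ s, 0 ≤ s → ∀ ω, s < τ ω →
    |g (X (min (s + h) (τ ω)) ω) - c.T h 0 g (X s ω) - ∑ i, p (X s ω) i * dM M τ s (s + h) ω i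
      - (1/2) * ∑ i, ∑ j, q (X s ω) i j * (dM M τ s (s+h) ω i * dM M τ s (s+h) ω j - dA c X τ s (s+h) i j ω)|
    ≤ K * C2 * (h * osc X τ h ω + h * Real.sqrt h + h * ind τ (s + h) ω
      + ‖X (min (s + h) (τ ω)) ω - X (min s (τ ω)) ω‖ ^ 2 * min 1 ‖X (min (s + h) (τ ω)) ω - X (min s (τ ω)) ω‖) := by
  obtain ⟨C1, hC1, hT⟩ := T_exp c L.R_nn
  have hR := L.R_nn
  have hC := c.C_one
  set Cb := c.C * (1 + R) with hCb
  have hCb0 : 0 ≤ Cb := by positivity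
  refine ⟨1 + C1 + k * (c.C + 2 * Cb) + k * (k * (2 * Cb + Cb ^ 2 + 2 * Cb * c.C + 2 * Cb ^ 2)), by positivity, ?_⟩
  intro h hh hh1 g p q K G s hs ω hsτ
  have hK := G.K_nn
  have hx : ‖X s ω‖ ≤ R := L.bd ω s hs hsτ.le
  have hms : min s (τ ω) = s := min_eq_left hsτ.le
  set t := s + h with ht
  have hst : s ≤ t := by linarith
  set O := osc X τ h ω with hO
  have hO0 : 0 ≤ O := osc_nn h ω
  set I := ind τ t ω with hI
  have hI0 : 0 ≤ I := ind_nn t ω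
  set e := Real.sqrt h with he
  have he0 : 0 ≤ e := Real.sqrt_nonneg h
  have he2 : e ^ 2 = h := Real.sq_sqrt hh.le
  have he1 : e ≤ 1 := by rw [he]; exact Real.sqrt_le_one.mpr hh1
  have hhe : h * h ≤ h * e := by
    refine mul_le_mul_of_nonneg_left ?_ hh.le
    nlinarith
  have hin := S.incr L ω hs hst
  rw [hms] at hin ⊢
  set Δ := X (min t (τ ω)) ω - X s ω with hΔ
  set m := dM M τ s t ω with hm
  set β := ∫ u in s..(min t (τ ω)), c.b (X u ω) with hβ
  have hΔO : ‖Δ‖ ≤ O := by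
    have := S.osc_ge' L hh ω (u := t) (v := s) (by linarith) hs (by rw [abs_of_nonneg (by linarith)]; linarith)
    rwa [hms] at this
  have hβb : ‖β‖ ≤ Cb * h := by
    have h1 : s ≤ min t (τ ω) := le_min hst hsτ.le
    refine (int_le L (φ := c.b) (fun y hy => c.b_bd hy) ω hs h1 (min_le_right _ _)).trans (mul_le_mul_of_nonneg_left ?_ hCb0)
    linarith [min_le_left t (τ ω)]
  have r1 : ‖β - h • c.b (X s ω)‖ ≤ h * (c.C * O) + 2 * Cb * h * I :=
    S.riem L (φ := c.b) c.b_cont (fun y hy => c.b_bd hy) (by linarith) (fun y y' _ _ => c.b_lip y y') hs hh ω hsτ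
  have r2 : ∀ i j, |dA c X τ s t i j ω - h * c.a (X s ω) i j| ≤ h * (2 * Cb * c.C * O) + 2 * Cb ^ 2 * h * I := by
    intro i j
    have := S.riem L (φ := fun y => c.a y i j) (c.a_cont i j) (fun y hy => c.a_bd hy i j) (by positivity : 0 ≤ 2 * (c.C * (1 + R)) * c.C)
      (fun y y' hy hy' => c.a_lip hy hy' i j) hs hh ω hsτ
    unfold dA; rw [hms]; exact this
  have tay := G.taylor (X s ω) Δ
  have eΔ : X s ω + Δ = X (min t (τ ω)) ω := by rw [hΔ]; abel
  rw [eΔ] at tay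
  have tT := hT h hh.le hh1 g p q K G (X s ω) hx
  set y := X s ω with hy
  set A1 := g (X (min t (τ ω)) ω) - g y - ∑ i, p y i * Δ i - (1 / 2) * ∑ i, ∑ j, q y i j * (Δ i * Δ j) with hA1
  set A2 := c.T h 0 g y - g y - h * (∑ i, p y i * c.b y i + (1/2) * ∑ i, ∑ j, q y i j * c.a y i j) with hA2
  set A3 := ∑ i, p y i * (β - h • c.b y) i with hA3
  set A4 := ∑ i, ∑ j, q y i j * (Δ i * Δ j - m i * m j + (dA c X τ s t i j ω - h * c.a y i j)) with hA4
  have id : g (X (min t (τ ω)) ω) - c.T h 0 g y - ∑ i, p y i * m i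
      - (1/2) * ∑ i, ∑ j, q y i j * (m i * m j - dA c X τ s t i j ω) = A1 - A2 + A3 + (1/2) * A4 := by
    have e3 : A3 = ∑ i, p y i * Δ i - ∑ i, p y i * m i - h * ∑ i, p y i * c.b y i := by
      rw [hA3, Finset.mul_sum, ← Finset.sum_sub_distrib, ← Finset.sum_sub_distrib]
      refine Finset.sum_congr rfl fun i _ => ?_
      rw [hin]; simp only [PiLp.add_apply, PiLp.sub_apply, PiLp.smul_apply, smul_eq_mul]; ring
    have e4 : A4 = ∑ i, ∑ j, q y i j * (Δ i * Δ j) - ∑ i, ∑ j, q y i j * (m i * m j - dA c X τ s t i j ω)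
       - h * ∑ i, ∑ j, q y i j * c.a y i j := by
      rw [hA4, Finset.mul_sum, ← Finset.sum_sub_distrib, ← Finset.sum_sub_distrib]
      refine Finset.sum_congr rfl fun i _ => ?_
      rw [Finset.mul_sum, ← Finset.sum_sub_distrib, ← Finset.sum_sub_distrib]
      refine Finset.sum_congr rfl fun j _ => ?_
      ring
    rw [hA1, hA2, e3, e4]; ring
  rw [id]
  have b3 : |A3| ≤ k * (K * (h * (c.C * O) + 2 * Cb * h * I)) :=
    abs_dot_le hK (G.p_bd y) fun i => (coord_le _ _).trans r1
  have b4 : |A4| ≤ k * (k * (K * ((2 * Cb * h * O + Cb ^ 2 * (h * e)) + (h * (2 * Cb * c.C * O) + 2 * Cb ^ 2 * h * I)))) := by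
    refine abs_dot2_le hK (G.q_bd y) fun i j => ?_
    refine (abs_add_le _ _).trans (add_le_add ?_ (r2 i j))
    have e1 : Δ i * Δ j - m i * m j = Δ i * β j + β i * Δ j - β i * β j := by
      rw [hin]; simp only [PiLp.add_apply]; ring
    have d : ∀ i, |Δ i| ≤ O := fun i => (coord_le _ _).trans hΔO
    have b : ∀ i, |β i| ≤ Cb * h := fun i => (coord_le _ _).trans hβb
    have a1 : |Δ i * β j| ≤ O * (Cb * h) := by rw [abs_mul]; exact mul_le_mul (d i) (b j) (abs_nonneg _) hO0
    have a2 : |β i * Δ j| ≤ (Cb * h) * O := by rw [abs_mul]; exact mul_le_mul (b i) (d j) (abs_nonneg _) (by positivity)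
    have a3 : |β i * β j| ≤ (Cb * h) * (Cb * h) := by rw [abs_mul]; exact mul_le_mul (b i) (b j) (abs_nonneg _) (by positivity)
    have a4 : (Cb * h) * (Cb * h) ≤ Cb ^ 2 * (h * e) := by
      calc (Cb * h) * (Cb * h) = Cb ^ 2 * (h * h) := by ring
        _ ≤ _ := by gcongr
    rw [e1]
    calc _ ≤ |Δ i * β j + β i * Δ j| + |β i * β j| := abs_sub _ _
      _ ≤ |Δ i * β j| + |β i * Δ j| + |β i * β j| := by gcongr; exact abs_add_le _ _
      _ ≤ _ := by linarith
  set V := ‖Δ‖ ^ 2 * min 1 ‖Δ‖ with hV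
  have hV0 : 0 ≤ V := by positivity
  have hk : (0:ℝ) ≤ k := Nat.cast_nonneg k
  have t0 : |A1 - A2 + A3 + (1/2) * A4| ≤ |A1| + |A2| + |A3| + |A4| := by
    have := abs_add_le (A1 - A2 + A3) ((1/2) * A4)
    have := abs_add_le (A1 - A2) A3
    have := abs_sub A1 A2
    rw [abs_mul, abs_of_pos (by norm_num : (0:ℝ) < 1/2)] at *
    linarith [abs_nonneg A4]
  refine t0.trans ?_
  set E := h * O + h * e + h * I + V with hE
  have n1 : 0 ≤ h * O := by positivity
  have n2 : 0 ≤ h * e := by positivity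
  have n3 : 0 ≤ h * I := by positivity
  have s1 : K * V ≤ K * 1 * E := by
    rw [mul_one]; exact mul_le_mul_of_nonneg_left (by linarith) hK
  have s2 : K * C1 * (h * e) ≤ K * C1 * E := mul_le_mul_of_nonneg_left (by linarith) (by positivity)
  have s3 : k * (K * (h * (c.C * O) + 2 * Cb * h * I)) ≤ K * (k * (c.C + 2 * Cb)) * E := by
    have : h * (c.C * O) + 2 * Cb * h * I ≤ (c.C + 2 * Cb) * E := by
      have h1 : c.C * (h * O) ≤ c.C * E := mul_le_mul_of_nonneg_left (by linarith) (by linarith)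
      have h2 : 2 * Cb * (h * I) ≤ 2 * Cb * E := mul_le_mul_of_nonneg_left (by linarith) (by linarith)
      linarith
    calc _ ≤ k * (K * ((c.C + 2 * Cb) * E)) := by gcongr
      _ = _ := by ring
  have s4 : k * (k * (K * ((2 * Cb * h * O + Cb ^ 2 * (h * e)) + (h * (2 * Cb * c.C * O) + 2 * Cb ^ 2 * h * I))))
      ≤ K * (k * (k * (2 * Cb + Cb ^ 2 + 2 * Cb * c.C + 2 * Cb ^ 2))) * E := by
    have : (2 * Cb * h * O + Cb ^ 2 * (h * e)) + (h * (2 * Cb * c.C * O) + 2 * Cb ^ 2 * h * I)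
       ≤ (2 * Cb + Cb ^ 2 + 2 * Cb * c.C + 2 * Cb ^ 2) * E := by
      have h1 : 2 * Cb * (h * O) ≤ 2 * Cb * E := mul_le_mul_of_nonneg_left (by linarith) (by linarith)
      have h2 : Cb ^ 2 * (h * e) ≤ Cb ^ 2 * E := mul_le_mul_of_nonneg_left (by linarith) (by positivity)
      have h3 : 2 * Cb * c.C * (h * O) ≤ 2 * Cb * c.C * E := mul_le_mul_of_nonneg_left (by linarith) (by positivity)
      have h4 : 2 * Cb ^ 2 * (h * I) ≤ 2 * Cb ^ 2 * E := mul_le_mul_of_nonneg_left (by linarith) (by positivity)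
      linarith
    calc _ ≤ k * (k * (K * ((2 * Cb + Cb ^ 2 + 2 * Cb * c.C + 2 * Cb ^ 2) * E))) := by gcongr
      _ = _ := by ring
  calc _ ≤ K * 1 * E + K * C1 * E + K * (k * (c.C + 2 * Cb)) * E + K * (k * (k * (2 * Cb + Cb ^ 2 + 2 * Cb * c.C + 2 * Cb ^ 2))) * E := by
        linarith
    _ = _ := by ring
end Sol
end


set_option linter.unusedSectionVars false

section
variable {Ω : Type*} {mΩ : MeasurableSpace Ω} {μ : Measure Ω} [IsProbabilityMeasure μ] {ℱ : Filtration ℝ mΩ}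
  {k : ℕ} {c : Coef k} {x : EE k} {X M : ℝ → Ω → EE k} {T R : ℝ} {τ : Ω → ℝ}

lemma Coef.T_meas (c : Coef k) (h : ℝ) {g : EE k → ℝ} (hg : Measurable g) : Measurable (c.T h 0 g) := by
  unfold Coef.T
  refine Finset.measurable_sum _ fun l _ => ?_
  refine measurable_const.mul (hg.comp ?_)
  have h1 := c.b_cont
  have h2 := c.s_cont l
  have : Continuous fun x : EE k => x + c.eta h (x + 0) l := by unfold Coef.eta; fun_prop
  exact this.measurable

lemma Coef.T_abs (c : Coef k) (h : ℝ) {g : EE k → ℝ} {K : ℝ} (hg : ∀ x, |g x| ≤ K) (z x : EE k) : |c.T h z g x| ≤ K :=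
  c.avg_le _ _ fun _ => hg _

/-- stopped value -/
noncomputable abbrev Ys (X : ℝ → Ω → EE k) (τ : Ω → ℝ) (u : ℝ) (ω : Ω) : EE k := X (min u (τ ω)) ω

/-- error functional of a single step -/
noncomputable def Er (X : ℝ → Ω → EE k) (τ : Ω → ℝ) (s h : ℝ) (ω : Ω) : ℝ :=
  ‖Ys X τ (s + h) ω - Ys X τ s ω‖ ^ 2 * min 1 ‖Ys X τ (s + h) ω - Ys X τ s ω‖

lemma bint {f : Ω → ℝ} (hf : AEStronglyMeasurable f μ) (B : ℝ) (h : ∀ ω, |f ω| ≤ B) : Integrable f μ :=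
  Integrable.of_bound hf B (ae_of_all _ fun ω => by simpa using h ω)

namespace Sol
variable (S : Sol c μ ℱ x X M) (L : Loc ℱ X T R τ)

include L in
lemma Ys_bd {u : ℝ} (hu : 0 ≤ u) (ω : Ω) : ‖Ys X τ u ω‖ ≤ R := L.bd ω _ (le_min hu (L.nn ω)) (min_le_right _ _)

include L in
lemma dY_bd {u v : ℝ} (hu : 0 ≤ u) (hv : 0 ≤ v) (ω : Ω) : ‖Ys X τ u ω - Ys X τ v ω‖ ≤ 2 * R := by
  have := norm_sub_le (Ys X τ u ω) (Ys X τ v ω)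
  linarith [Ys_bd L hu ω, Ys_bd L hv ω]

include S L

lemma Er_meas {s h : ℝ} (hs : 0 ≤ s) (hh : 0 ≤ h) : Measurable (Er X τ s h) := by
  have h1 := S.Ys_meas L (u := s + h) (by linarith)
  have h2 := S.Ys_meas L hs
  have := (h1.sub h2).norm
  exact (this.pow_const 2).mul (measurable_const.min this)

omit S in
lemma Er_bd {s h : ℝ} (hs : 0 ≤ s) (hh : 0 ≤ h) (ω : Ω) : |Er X τ s h ω| ≤ (2 * R) ^ 2 := by
  have h1 := dY_bd L (u := s + h) (v := s) (by linarith) hs ω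
  unfold Er
  rw [abs_of_nonneg (by positivity)]
  calc _ ≤ (2 * R) ^ 2 * 1 := by
        gcongr
        exact min_le_left _ _
    _ = _ := by ring

lemma int_step : ∃ C2 : ℝ, 0 ≤ C2 ∧ ∀ (h : ℝ), 0 < h → h ≤ 1 → ∀ (g : EE k → ℝ) (p : EE k → Fin k → ℝ)
    (q : EE k → Fin k → Fin k → ℝ) (K : ℝ), SM g p q K → ∀ s, 0 ≤ s → ∀ A, MeasurableSet[ℱ s] A → (∀ ω ∈ A, s < τ ω) →
    |∫ ω in A, g (Ys X τ (s + h) ω) - c.T h 0 g (Ys X τ s ω) ∂μ|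
    ≤ K * C2 * ∫ ω in A, h * osc X τ h ω + h * Real.sqrt h + h * ind τ (s + h) ω + Er X τ s h ω ∂μ := by
  obtain ⟨C2, hC2, H⟩ := S.path_step L
  refine ⟨C2, hC2, ?_⟩
  intro h hh hh1 g p q K G s hs A hA hAτ
  have hK := G.K_nn
  have hst : s ≤ s + h := by linarith
  have hAm : MeasurableSet A := ℱ.le s _ hA
  have hXs : Measurable[ℱ s] (X s) := S.adapted s
  -- weights
  have zp : ∀ i, Measurable[ℱ s] (A.indicator fun ω => p (X s ω) i) := fun i =>
    ((G.p_meas i).comp hXs).indicator hA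
  have zq : ∀ i j, Measurable[ℱ s] (A.indicator fun ω => q (X s ω) i j) := fun i j =>
    ((G.q_meas i j).comp hXs).indicator hA
  have zpb : ∀ i ω, |A.indicator (fun ω => p (X s ω) i) ω| ≤ K := fun i ω => by
    by_cases hω : ω ∈ A
    · rw [indicator_of_mem hω]; exact G.p_bd _ _
    · rw [indicator_of_notMem hω]; simpa using hK
  have zqb : ∀ i j ω, |A.indicator (fun ω => q (X s ω) i j) ω| ≤ K := fun i j ω => by
    by_cases hω : ω ∈ A
    · rw [indicator_of_mem hω]; exact G.q_bd _ _ _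
    · rw [indicator_of_notMem hω]; simpa using hK
  have lin0 := fun i => (S.lin L i hs hst).2 _ _ (zp i) (zpb i)
  have quad0 := fun i j => (S.quad L i j hs hst).2 _ _ (zq i j) (zqb i j) (fun ω hω => by
    rw [indicator_of_notMem]; intro hA'; exact absurd (hAτ ω hA') (not_lt.mpr hω))
  -- integrability
  set Q := R + ‖x‖ + c.C * (1 + R) * T with hQ
  have hmb : ∀ i ω, |dM M τ s (s+h) ω i| ≤ 2 * Q := fun i ω => (coord_le _ _).trans (S.dM_bd L hs hst ω)
  have li : ∀ i, Integrable (fun ω => A.indicator (fun ω => p (X s ω) i) ω * dM M τ s (s+h) ω i) μ := fun i =>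
    bint (((zp i).mono (ℱ.le s) le_rfl).aestronglyMeasurable.mul (S.lin L i hs hst).1) (K * (2 * Q)) fun ω => by
      rw [abs_mul]; exact mul_le_mul (zpb i ω) (hmb i ω) (abs_nonneg _) hK
  have qi : ∀ i j, Integrable (fun ω => A.indicator (fun ω => q (X s ω) i j) ω *
      (dM M τ s (s+h) ω i * dM M τ s (s+h) ω j - dA c X τ s (s+h) i j ω)) μ := fun i j =>
    bint (((zq i j).mono (ℱ.le s) le_rfl).aestronglyMeasurable.mul (S.quad L i j hs hst).1) (K * ((2 * Q) * (2 * Q) + (c.C * (1 + R)) ^ 2 * (s + h - s))) fun ω => by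
      rw [abs_mul]; refine mul_le_mul (zqb i j ω) ?_ (abs_nonneg _) hK
      refine (abs_sub _ _).trans (add_le_add ?_ (dA_bd L hs hst i j ω))
      rw [abs_mul]; exact mul_le_mul (hmb i ω) (hmb j ω) (abs_nonneg _) ((abs_nonneg _).trans (hmb i ω))
  set D : Ω → ℝ := fun ω => g (Ys X τ (s + h) ω) - c.T h 0 g (Ys X τ s ω) with hD
  have hDm : Measurable D :=
    (G.g_meas.comp (S.Ys_meas L (by linarith))).sub ((c.T_meas h G.g_meas).comp (S.Ys_meas L hs))
  have hDi : Integrable (A.indicator D) μ := by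
    refine Integrable.indicator (bint hDm.aestronglyMeasurable (K + K) fun ω => ?_) hAm
    exact (abs_sub _ _).trans (add_le_add (G.g_bd _) (c.T_abs h G.g_bd _ _))
  set P : Ω → ℝ := fun ω => ∑ i, A.indicator (fun ω => p (X s ω) i) ω * dM M τ s (s+h) ω i with hP
  set Qd : Ω → ℝ := fun ω => ∑ i, ∑ j, A.indicator (fun ω => q (X s ω) i j) ω *
      (dM M τ s (s+h) ω i * dM M τ s (s+h) ω j - dA c X τ s (s+h) i j ω) with hQd
  have hPi : Integrable P μ := integrable_finsetSum _ fun i _ => li i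
  have hQi : Integrable Qd μ := integrable_finsetSum _ fun i _ => integrable_finsetSum _ fun j _ => qi i j
  have hP0 : ∫ ω, P ω ∂μ = 0 := by
    rw [hP, integral_finsetSum _ fun i _ => li i]; exact Finset.sum_eq_zero fun i _ => lin0 i
  have hQ0 : ∫ ω, Qd ω ∂μ = 0 := by
    rw [hQd, integral_finsetSum _ fun i _ => integrable_finsetSum _ fun j _ => qi i j]
    refine Finset.sum_eq_zero fun i _ => ?_
    rw [integral_finsetSum _ fun j _ => qi i j]
    exact Finset.sum_eq_zero fun j _ => quad0 i j
  have hDP : Integrable (fun ω => A.indicator D ω - P ω) μ := hDi.sub hPi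
  have eq1 : ∫ ω in A, D ω ∂μ = ∫ ω, A.indicator D ω - P ω - (1/2) * Qd ω ∂μ := by
    rw [integral_sub hDP (hQi.const_mul _), integral_sub hDi hPi, integral_const_mul, hP0, hQ0, integral_indicator hAm]; ring
  rw [eq1]
  have hEi : Integrable (fun ω => h * osc X τ h ω + h * Real.sqrt h + h * ind τ (s + h) ω + Er X τ s h ω) μ := by
    have hind : Measurable (ind τ (s + h)) := Measurable.ite (measurableSet_lt (τ_meas L) measurable_const) measurable_const measurable_const
    refine bint (((((S.osc_meas L h).const_mul h).add measurable_const).add (hind.const_mul h)).add (S.Er_meas L hs hh.le)).aestronglyMeasurable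
      (h * (2 * R) + h * Real.sqrt h + h * 1 + (2 * R) ^ 2) fun ω => ?_
    have a1 := osc_le L h ω
    have a2 := osc_nn (X := X) (τ := τ) h ω
    have a3 := ind_le (τ := τ) (s + h) ω
    have a4 := ind_nn (τ := τ) (s + h) ω
    have a5 := Er_bd L hs hh.le ω
    have a6 : 0 ≤ Er X τ s h ω := by unfold Er; positivity
    rw [abs_of_nonneg a6] at a5
    rw [abs_of_nonneg (by positivity)]
    gcongr
  calc _ ≤ ∫ ω, |A.indicator D ω - P ω - (1/2) * Qd ω| ∂μ := abs_integral_le_integral_abs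
    _ ≤ ∫ ω, A.indicator (fun ω => K * C2 * (h * osc X τ h ω + h * Real.sqrt h + h * ind τ (s + h) ω + Er X τ s h ω)) ω ∂μ := by
        refine integral_mono (hDP.sub (hQi.const_mul _)).abs ((hEi.const_mul _).indicator hAm) fun ω => ?_
        by_cases hω : ω ∈ A
        · simp only [hP, hQd, indicator_of_mem hω]
          have := H h hh hh1 g p q K G s hs ω (hAτ ω hω)
          have e : Ys X τ s ω = X s ω := by unfold Ys; rw [min_eq_left (hAτ ω hω).le]
          simp only [hD, Er]; rw [e]
          have e' : X (min s (τ ω)) ω = X s ω := e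
          rw [e'] at this
          exact this
        · simp [hP, hQd, indicator_of_notMem hω]
    _ = _ := by rw [integral_indicator hAm, integral_const_mul]

lemma quad_bd : ∃ C3 : ℝ, 0 ≤ C3 ∧ ∀ (h : ℝ), 0 < h → h ≤ 1 → ∀ s, 0 ≤ s → ∀ (Z : Ω → ℝ) (cz : ℝ), Measurable[ℱ s] Z →
    (∀ ω, 0 ≤ Z ω) → (∀ ω, Z ω ≤ cz) → (∀ ω, τ ω ≤ s → Z ω = 0) →
    ∫ ω, Z ω * ‖Ys X τ (s + h) ω - Ys X τ s ω‖ ^ 2 ∂μ ≤ C3 * h * ∫ ω, Z ω ∂μ := by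
  set Cb := c.C * (1 + R) with hCb
  have hR := L.R_nn
  have hC := c.C_one
  have hCb0 : 0 ≤ Cb := by positivity
  refine ⟨2 * (k * Cb ^ 2) + 2 * Cb ^ 2, by positivity, ?_⟩
  intro h hh hh1 s hs Z cz hZ hZ0 hZc hZτ
  have hst : s ≤ s + h := by linarith
  have hcz : 0 ≤ cz := (hZ0 (Classical.choice (nonempty_of_isProbabilityMeasure μ))).trans (hZc _)
  have hZb : ∀ ω, |Z ω| ≤ cz := fun ω => by rw [abs_of_nonneg (hZ0 ω)]; exact hZc ω
  have hZm : Measurable Z := hZ.mono (ℱ.le s) le_rfl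
  have hZi : Integrable Z μ := bint hZm.aestronglyMeasurable cz hZb
  set Q := R + ‖x‖ + c.C * (1 + R) * T with hQ
  have hmb : ∀ i ω, |dM M τ s (s+h) ω i| ≤ 2 * Q := fun i ω => (coord_le _ _).trans (S.dM_bd L hs hst ω)
  have qi : ∀ i, Integrable (fun ω => Z ω *
      (dM M τ s (s+h) ω i * dM M τ s (s+h) ω i - dA c X τ s (s+h) i i ω)) μ := fun i =>
    bint (hZm.aestronglyMeasurable.mul (S.quad L i i hs hst).1) (cz * ((2 * Q) * (2 * Q) + (c.C * (1 + R)) ^ 2 * (s + h - s))) fun ω => by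
      rw [abs_mul]; refine mul_le_mul (hZb ω) ?_ (abs_nonneg _) hcz
      refine (abs_sub _ _).trans (add_le_add ?_ (dA_bd L hs hst i i ω))
      rw [abs_mul]; exact mul_le_mul (hmb i ω) (hmb i ω) (abs_nonneg _) ((abs_nonneg _).trans (hmb i ω))
  have q0 := fun i => (S.quad L i i hs hst).2 Z cz hZ hZb hZτ
  set Qd : Ω → ℝ := fun ω => ∑ i, Z ω * (dM M τ s (s+h) ω i * dM M τ s (s+h) ω i - dA c X τ s (s+h) i i ω) with hQd
  have hQi : Integrable Qd μ := integrable_finsetSum _ fun i _ => qi i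
  have hQ0 : ∫ ω, Qd ω ∂μ = 0 := by
    rw [hQd, integral_finsetSum _ fun i _ => qi i]; exact Finset.sum_eq_zero fun i _ => q0 i
  have hDm : Measurable fun ω => ‖Ys X τ (s + h) ω - Ys X τ s ω‖ ^ 2 :=
    (((S.Ys_meas L (by linarith)).sub (S.Ys_meas L hs)).norm).pow_const 2
  have hLi : Integrable (fun ω => Z ω * ‖Ys X τ (s + h) ω - Ys X τ s ω‖ ^ 2) μ := by
    refine bint (hZm.mul hDm).aestronglyMeasurable (cz * (2 * R) ^ 2) fun ω => ?_
    rw [abs_mul, abs_of_nonneg (by positivity : 0 ≤ ‖Ys X τ (s + h) ω - Ys X τ s ω‖ ^ 2)]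
    have := dY_bd L (u := s + h) (v := s) (by linarith) hs ω
    have := hZb ω
    gcongr
  have hle : ∀ ω, Z ω * ‖Ys X τ (s + h) ω - Ys X τ s ω‖ ^ 2 ≤ 2 * Qd ω + (2 * (k * Cb ^ 2) + 2 * Cb ^ 2) * h * Z ω := by
    intro ω
    have hin := S.incr L ω hs hst
    set m := dM M τ s (s+h) ω with hm
    set β := ∫ u in (min s (τ ω))..(min (s+h) (τ ω)), c.b (X u ω) with hβ
    have hβb : ‖β‖ ≤ Cb * h := by
      refine (int_le L (φ := c.b) (fun y hy => c.b_bd hy) ω (le_min hs (L.nn ω)) (min_le_min_right _ hst) (min_le_right _ _)).trans (mul_le_mul_of_nonneg_left ?_ hCb0)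
      rcases le_total s (τ ω) with h1 | h1
      · rw [min_eq_left h1]; linarith [min_le_left (s+h) (τ ω)]
      · rw [min_eq_right h1, min_eq_right (h1.trans hst)]; linarith
    have hm2 : ‖m‖ ^ 2 = ∑ i, m i * m i := by
      rw [EuclideanSpace.norm_sq_eq]; refine Finset.sum_congr rfl fun i _ => ?_
      rw [Real.norm_eq_abs, sq_abs, sq]
    have e1 : Qd ω = Z ω * (‖m‖ ^ 2 - ∑ i, dA c X τ s (s+h) i i ω) := by
      rw [hm2, ← Finset.sum_sub_distrib, Finset.mul_sum]
    have hdA : ∑ i, dA c X τ s (s+h) i i ω ≤ k * (Cb ^ 2 * h) := by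
      calc _ ≤ ∑ i : Fin k, Cb ^ 2 * h := Finset.sum_le_sum fun i _ => by
            have := (le_abs_self _).trans (dA_bd (c := c) L hs hst i i ω)
            rwa [add_sub_cancel_left] at this
        _ = _ := by simp
    have e2 : ‖Ys X τ (s + h) ω - Ys X τ s ω‖ ^ 2 ≤ 2 * ‖m‖ ^ 2 + 2 * (Cb ^ 2 * h) := by
      have h1 : ‖Ys X τ (s + h) ω - Ys X τ s ω‖ ≤ ‖m‖ + Cb * h := by
        unfold Ys; rw [hin]; exact (norm_add_le _ _).trans (by linarith)
      have h2 : ‖Ys X τ (s + h) ω - Ys X τ s ω‖ ^ 2 ≤ (‖m‖ + Cb * h) ^ 2 := by gcongr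
      have h3 : (Cb * h) ^ 2 ≤ Cb ^ 2 * h := by
        rw [mul_pow]; refine mul_le_mul_of_nonneg_left ?_ (by positivity); nlinarith
      nlinarith [sq_nonneg (‖m‖ - Cb * h)]
    have h5 : ‖Ys X τ (s + h) ω - Ys X τ s ω‖ ^ 2 ≤ 2 * (‖m‖ ^ 2 - ∑ i, dA c X τ s (s+h) i i ω) + (2 * (k * Cb ^ 2) + 2 * Cb ^ 2) * h := by
      linarith
    have := mul_le_mul_of_nonneg_left h5 (hZ0 ω)
    rw [e1]; linarith
  calc _ ≤ ∫ ω, 2 * Qd ω + (2 * (k * Cb ^ 2) + 2 * Cb ^ 2) * h * Z ω ∂μ :=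
        integral_mono hLi ((hQi.const_mul _).add (hZi.const_mul _)) hle
    _ = _ := by
        rw [integral_add (hQi.const_mul _) (hZi.const_mul _), integral_const_mul, integral_const_mul, hQ0]; ring
end Sol
end


set_option linter.unusedSectionVars false

section
variable {Ω : Type*} {mΩ : MeasurableSpace Ω} {μ : Measure Ω} [IsProbabilityMeasure μ] {ℱ : Filtration ℝ mΩ}
  {k : ℕ} {c : Coef k} {x : EE k} {X M : ℝ → Ω → EE k} {T R : ℝ} {τ : Ω → ℝ}

/-- running maximum of increments -/
noncomputable def rmax (Y : ℝ → Ω → EE k) (h : ℝ) : ℕ → Ω → ℝ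
  | 0 => fun _ => 0
  | n + 1 => fun ω => max (rmax Y h n ω) ‖Y (n * h + h) ω - Y (n * h) ω‖

namespace Sol
variable (S : Sol c μ ℱ x X M) (L : Loc ℱ X T R τ)

lemma rmax_nn (Y : ℝ → Ω → EE k) (h : ℝ) (n : ℕ) (ω : Ω) : 0 ≤ rmax Y h n ω := by
  induction n with
  | zero => simp [rmax]
  | succ n ih => exact ih.trans (le_max_left _ _)

include S L in
lemma rmax_le {h : ℝ} (hh : 0 < h) (n : ℕ) (ω : Ω) : rmax (Ys X τ) h n ω ≤ osc X τ h ω := by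
  induction n with
  | zero => exact osc_nn h ω
  | succ n ih =>
    refine max_le ih (S.osc_ge' L hh ω (by positivity) (by positivity) ?_)
    rw [add_sub_cancel_left, abs_of_pos hh]

include S L in
lemma rmax_meas {h : ℝ} (hh : 0 < h) (n : ℕ) : Measurable (rmax (Ys X τ) h n) := by
  induction n with
  | zero => exact measurable_const
  | succ n ih => exact ih.max ((S.Ys_meas L (by positivity)).sub (S.Ys_meas L (by positivity))).norm

include S in
lemma rmax_adapt {h : ℝ} (hh : 0 < h) (n : ℕ) : Measurable[ℱ (n * h)] (rmax X h n) := by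
  induction n with
  | zero => exact @measurable_const _ _ _ (ℱ _) _
  | succ n ih =>
    have e : ((n + 1 : ℕ) : ℝ) * h = n * h + h := by push_cast; ring
    rw [e]
    have h1 : ℱ (n * h) ≤ ℱ (n * h + h) := ℱ.mono (by linarith)
    have h2 : Measurable[ℱ (n * h + h)] fun ω => (X (n * h + h) ω, X (n * h) ω) :=
      Measurable.prodMk (S.adapted _) ((S.adapted _).mono h1 le_rfl)
    have h3 : Measurable fun z : EE k × EE k => ‖z.1 - z.2‖ := by fun_prop
    have h4 : Measurable[ℱ (n * h + h)] fun ω => ‖X (n * h + h) ω - X (n * h) ω‖ :=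
      @Measurable.comp _ _ _ (ℱ (n * h + h)) _ _ (fun z : EE k × EE k => ‖z.1 - z.2‖) (fun ω => (X (n * h + h) ω, X (n * h) ω)) h3 h2
    have h5 : Measurable[ℱ (n * h + h)] (rmax X h n) := ih.mono h1 le_rfl
    have h6 : Measurable[ℱ (n * h + h)] fun ω => max (rmax X h n ω) ‖X (n * h + h) ω - X (n * h) ω‖ := Measurable.max h5 h4
    exact h6

lemma rmax_eq {h : ℝ} (hh : 0 < h) (n : ℕ) (ω : Ω) (hn : n * h ≤ τ ω) : rmax (Ys X τ) h n ω = rmax X h n ω := by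
  induction n with
  | zero => rfl
  | succ n ih =>
    have e : ((n + 1 : ℕ) : ℝ) * h = n * h + h := by push_cast; ring
    rw [e] at hn
    have h1 : n * h ≤ τ ω := by linarith
    simp only [rmax, Ys]
    rw [← ih h1, min_eq_left h1, min_eq_left hn]

include S L in
lemma lindeberg : ∃ C4 : ℝ, 0 ≤ C4 ∧ ∀ (h : ℝ), 0 < h → h ≤ 1 → ∀ n : ℕ, n * h ≤ T →
    ∑ i ∈ Finset.range n, ∫ ω, Er X τ (i * h) h ω ∂μ ≤ C4 * ∫ ω, osc X τ h ω ∂μ := by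
  obtain ⟨C3, hC3, H⟩ := S.quad_bd L
  have hR := L.R_nn
  have hT := L.T_nn
  refine ⟨C3 * T + (2 * R) ^ 2, by positivity, ?_⟩
  intro h hh hh1 n hn
  set O := ∫ ω, osc X τ h ω ∂μ with hO
  have hO0 : 0 ≤ O := integral_nonneg fun ω => osc_nn h ω
  have osci : Integrable (osc X τ h) μ := bint (S.osc_meas L h).aestronglyMeasurable (2 * R) fun ω => by
    rw [abs_of_nonneg (osc_nn h ω)]; exact osc_le L h ω
  have rb : ∀ i ω, |rmax (Ys X τ) h i ω| ≤ 2 * R := fun i ω => by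
    rw [abs_of_nonneg (rmax_nn _ h i ω)]; exact (S.rmax_le L hh i ω).trans (osc_le L h ω)
  have ri : ∀ i, Integrable (rmax (Ys X τ) h i) μ := fun i => bint (S.rmax_meas L hh i).aestronglyMeasurable (2 * R) (rb i)
  have step : ∀ i : ℕ, ∫ ω, Er X τ (i * h) h ω ∂μ ≤ C3 * h * O + (2 * R) ^ 2 * (∫ ω, rmax (Ys X τ) h (i+1) ω ∂μ - ∫ ω, rmax (Ys X τ) h i ω ∂μ) := by
    intro i
    have hs : 0 ≤ (i : ℝ) * h := by positivity
    set A : Set Ω := {ω | (i : ℝ) * h < τ ω} with hA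
    have hAm : MeasurableSet[ℱ (i * h)] A := by
      have := (L.meas _ hs).compl
      convert this using 1
      ext ω; simp [hA]
    set Z : Ω → ℝ := A.indicator (rmax (Ys X τ) h i) with hZ
    have hZe : Z = A.indicator (rmax X h i) := by
      ext ω
      by_cases hω : ω ∈ A
      · rw [hZ, indicator_of_mem hω, indicator_of_mem hω]; exact rmax_eq hh i ω (le_of_lt hω)
      · rw [hZ, indicator_of_notMem hω, indicator_of_notMem hω]
    have hZm : Measurable[ℱ (i * h)] Z := by rw [hZe]; exact (S.rmax_adapt hh i).indicator hAm
    have hZ0 : ∀ ω, 0 ≤ Z ω := fun ω => indicator_nonneg (fun ω _ => rmax_nn _ h i ω) ω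
    have hZr : ∀ ω, Z ω ≤ rmax (Ys X τ) h i ω := fun ω => indicator_le_self' (fun ω _ => rmax_nn _ h i ω) ω
    have hZ2 : ∀ ω, Z ω ≤ 2 * R := fun ω => (hZr ω).trans ((le_abs_self _).trans (rb i ω))
    have hZi : Integrable Z μ := (ri i).indicator (ℱ.le _ _ hAm)
    have h1 := H h hh hh1 _ hs Z (2 * R) hZm hZ0 hZ2 (fun ω hω => by
      rw [hZ, indicator_of_notMem]; simp only [hA, mem_ofPred_eq, not_lt]; exact hω)
    have h2 : ∫ ω, Z ω ∂μ ≤ O := integral_mono hZi osci fun ω => (hZr ω).trans (S.rmax_le L hh i ω)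
    have hDm : Measurable fun ω => ‖Ys X τ (i * h + h) ω - Ys X τ (i * h) ω‖ ^ 2 :=
      (((S.Ys_meas L (by positivity)).sub (S.Ys_meas L hs)).norm).pow_const 2
    have hLi : Integrable (fun ω => Z ω * ‖Ys X τ (i * h + h) ω - Ys X τ (i * h) ω‖ ^ 2) μ := by
      refine bint ((hZm.mono (ℱ.le _) le_rfl).mul hDm).aestronglyMeasurable ((2 * R) * (2 * R) ^ 2) fun ω => ?_
      rw [abs_mul, abs_of_nonneg (by positivity : 0 ≤ ‖Ys X τ (i * h + h) ω - Ys X τ (i * h) ω‖ ^ 2), abs_of_nonneg (hZ0 ω)]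
      have := dY_bd L (u := i * h + h) (v := i * h) (by positivity) hs ω
      have := hZ2 ω
      gcongr
    have hdi : Integrable (fun ω => (2 * R) ^ 2 * (rmax (Ys X τ) h (i+1) ω - rmax (Ys X τ) h i ω)) μ := ((ri (i+1)).sub (ri i)).const_mul _
    have hpt : ∀ ω, Er X τ (i * h) h ω ≤ Z ω * ‖Ys X τ (i * h + h) ω - Ys X τ (i * h) ω‖ ^ 2 + (2 * R) ^ 2 * (rmax (Ys X τ) h (i+1) ω - rmax (Ys X τ) h i ω) := by
      intro ω
      by_cases hω : ω ∈ A
      · rw [hZ, indicator_of_mem hω]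
        set D := ‖Ys X τ (i * h + h) ω - Ys X τ (i * h) ω‖ with hD
        have d0 : 0 ≤ D := norm_nonneg _
        have d1 : D ≤ 2 * R := dY_bd L (u := i * h + h) (v := i * h) (by positivity) hs ω
        have d2 : D ≤ rmax (Ys X τ) h (i+1) ω := le_max_right _ _
        have d3 : rmax (Ys X τ) h i ω ≤ rmax (Ys X τ) h (i+1) ω := le_max_left _ _
        have d4 : Er X τ (i * h) h ω ≤ D ^ 2 * D := by
          unfold Er; exact mul_le_mul_of_nonneg_left (min_le_right _ _) (by positivity)
        have d5 : D ^ 2 * (rmax (Ys X τ) h (i+1) ω - rmax (Ys X τ) h i ω) ≤ (2 * R) ^ 2 * (rmax (Ys X τ) h (i+1) ω - rmax (Ys X τ) h i ω) := by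
          have : 0 ≤ rmax (Ys X τ) h (i+1) ω - rmax (Ys X τ) h i ω := by linarith
          gcongr
        have d6 : D ^ 2 * D ≤ D ^ 2 * rmax (Ys X τ) h (i+1) ω := mul_le_mul_of_nonneg_left d2 (by positivity)
        linarith
      · have hω' : τ ω ≤ i * h := by simpa [hA] using hω
        have e : Er X τ (i * h) h ω = 0 := by
          unfold Er Ys
          rw [min_eq_right hω', min_eq_right (by linarith)]; simp
        rw [e]
        have d3 : rmax (Ys X τ) h i ω ≤ rmax (Ys X τ) h (i+1) ω := le_max_left _ _
        have : 0 ≤ rmax (Ys X τ) h (i+1) ω - rmax (Ys X τ) h i ω := by linarith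
        have := hZ0 ω
        positivity
    have hEi : Integrable (Er X τ (i * h) h) μ := bint (S.Er_meas L hs hh.le).aestronglyMeasurable _ (Er_bd L hs hh.le)
    calc _ ≤ ∫ ω, Z ω * ‖Ys X τ (i * h + h) ω - Ys X τ (i * h) ω‖ ^ 2 + (2 * R) ^ 2 * (rmax (Ys X τ) h (i+1) ω - rmax (Ys X τ) h i ω) ∂μ :=
          integral_mono hEi (hLi.add hdi) hpt
      _ = ∫ ω, Z ω * ‖Ys X τ (i * h + h) ω - Ys X τ (i * h) ω‖ ^ 2 ∂μ + (2 * R) ^ 2 * (∫ ω, rmax (Ys X τ) h (i+1) ω ∂μ - ∫ ω, rmax (Ys X τ) h i ω ∂μ) := by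
          rw [integral_add hLi hdi, integral_const_mul, integral_sub (ri _) (ri _)]
      _ ≤ _ := by
          have : C3 * h * ∫ ω, Z ω ∂μ ≤ C3 * h * O := mul_le_mul_of_nonneg_left h2 (by positivity)
          linarith
  calc _ ≤ ∑ i ∈ Finset.range n, (C3 * h * O + (2 * R) ^ 2 * (∫ ω, rmax (Ys X τ) h (i+1) ω ∂μ - ∫ ω, rmax (Ys X τ) h i ω ∂μ)) :=
        Finset.sum_le_sum fun i _ => step i
    _ = n * (C3 * h * O) + (2 * R) ^ 2 * (∫ ω, rmax (Ys X τ) h n ω ∂μ - ∫ ω, rmax (Ys X τ) h 0 ω ∂μ) := by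
        rw [Finset.sum_add_distrib, Finset.sum_const, Finset.card_range, nsmul_eq_mul, ← Finset.mul_sum, Finset.sum_range_sub (fun i => ∫ ω, rmax (Ys X τ) h i ω ∂μ)]
    _ ≤ _ := by
        have h1 : ∫ ω, rmax (Ys X τ) h n ω ∂μ ≤ O := integral_mono (ri n) osci fun ω => S.rmax_le L hh n ω
        have h2 : ∫ ω, rmax (Ys X τ) h 0 ω ∂μ = 0 := by simp [rmax]
        rw [h2, sub_zero]
        have h3 : (2 * R) ^ 2 * ∫ ω, rmax (Ys X τ) h n ω ∂μ ≤ (2 * R) ^ 2 * O := mul_le_mul_of_nonneg_left h1 (by positivity)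
        have h4 : n * (C3 * h * O) ≤ C3 * T * O := by
          calc n * (C3 * h * O) = C3 * (n * h) * O := by ring
            _ ≤ _ := by gcongr
        linarith

include S L in
lemma key {ε : ℝ} (hε : 0 < ε) : ∃ h0 > 0, ∀ h, 0 < h → h < h0 → ∀ n : ℕ, n * h ≤ T →
    ∀ (g : ℕ → EE k → ℝ) (K : ℝ), (∀ i, ∃ p q, SM (g i) p q K) → ∀ A : ℕ → Set Ω,
    (∀ i : ℕ, MeasurableSet[ℱ (i * h)] (A i)) → (∀ i : ℕ, ∀ ω ∈ A i, i * h < τ ω) →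
    |∑ i ∈ Finset.range n, ∫ ω in A i, g i (Ys X τ (i * h + h) ω) - c.T h 0 (g i) (Ys X τ (i * h) ω) ∂μ| ≤ K * ε := by
  obtain ⟨C2, hC2, H⟩ := S.int_step L
  obtain ⟨C4, hC4, H4⟩ := S.lindeberg L
  have hR := L.R_nn
  have hT := L.T_nn
  set ε' := ε / (2 * (C2 * (T + C4) + 1)) with hε'
  have hε'0 : 0 < ε' := by positivity
  obtain ⟨h0, hh0, H0⟩ := S.osc_small L hε'0
  set η := ε / (2 * (C2 * (T + 1) + 1)) with hη
  have hη0 : 0 < η := by positivity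
  refine ⟨min h0 (min 1 (η ^ 2)), by positivity, ?_⟩
  intro h hh hlt n hn g K hg A hA hAτ
  have hh0 : h < h0 := hlt.trans_le (min_le_left _ _)
  have hh1 : h ≤ 1 := (hlt.trans_le ((min_le_right _ _).trans (min_le_left _ _))).le
  have hh2 : h ≤ η ^ 2 := (hlt.trans_le ((min_le_right _ _).trans (min_le_right _ _))).le
  set e := Real.sqrt h with he
  have he0 : 0 ≤ e := Real.sqrt_nonneg h
  have heη : e ≤ η := Real.sqrt_le_iff.mpr ⟨hη0.le, hh2⟩
  have hhe : h ≤ e := Real.le_sqrt_of_sq_le (by nlinarith)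
  have hK : 0 ≤ K := by obtain ⟨p, q, G⟩ := hg 0; exact G.K_nn
  set O := ∫ ω, osc X τ h ω ∂μ with hO
  have hOε : O ≤ ε' := H0 h hh hh0
  have osci : Integrable (osc X τ h) μ := bint (S.osc_meas L h).aestronglyMeasurable (2 * R) fun ω => by
    rw [abs_of_nonneg (osc_nn h ω)]; exact osc_le L h ω
  -- overshoot
  set J : ℕ → Ω → ℝ := fun i ω => if (i:ℝ) * h < τ ω ∧ τ ω < i * h + h then 1 else 0 with hJ
  have hJm : ∀ i, Measurable (J i) := fun i => Measurable.ite
    ((measurableSet_lt measurable_const (τ_meas L)).inter (measurableSet_lt (τ_meas L) measurable_const)) measurable_const measurable_const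
  have hJ0 : ∀ i ω, 0 ≤ J i ω := fun i ω => by simp only [hJ]; split_ifs <;> norm_num
  have hJ1 : ∀ i ω, J i ω ≤ 1 := fun i ω => by simp only [hJ]; split_ifs <;> norm_num
  have hJi : ∀ i, Integrable (J i) μ := fun i => bint (hJm i).aestronglyMeasurable 1 fun ω => by
    rw [abs_of_nonneg (hJ0 i ω)]; exact hJ1 i ω
  have hJs : ∑ i ∈ Finset.range n, ∫ ω, J i ω ∂μ ≤ 1 := by
    rw [← integral_finsetSum _ fun i _ => hJi i]
    calc _ ≤ ∫ ω, (1:ℝ) ∂μ := by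
          refine integral_mono (integrable_finsetSum _ fun i _ => hJi i) (integrable_const _) fun ω => ?_
          simp only [hJ]
          rw [Finset.sum_boole]
          have : (Finset.filter (fun i : ℕ => (i:ℝ) * h < τ ω ∧ τ ω < i * h + h) (Finset.range n)).card ≤ 1 := by
            rw [Finset.card_le_one]
            intro a ha b hb
            simp only [Finset.mem_filter] at ha hb
            have h1 : (a : ℝ) * h < (b + 1) * h := by linarith [ha.2.1, hb.2.2]
            have h2 : (b : ℝ) * h < (a + 1) * h := by linarith [hb.2.1, ha.2.2]
            have h3 := lt_of_mul_lt_mul_right h1 hh.le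
            have h4 := lt_of_mul_lt_mul_right h2 hh.le
            norm_cast at h3 h4
            omega
          exact_mod_cast this
      _ = 1 := by simp
  have step : ∀ i : ℕ, |∫ ω in A i, g i (Ys X τ (i * h + h) ω) - c.T h 0 (g i) (Ys X τ (i * h) ω) ∂μ|
      ≤ K * C2 * (h * O + h * e + h * ∫ ω, J i ω ∂μ + ∫ ω, Er X τ (i * h) h ω ∂μ) := by
    intro i
    have hs : 0 ≤ (i : ℝ) * h := by positivity
    obtain ⟨p, q, G⟩ := hg i
    have hAm : MeasurableSet (A i) := ℱ.le _ _ (hA i)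
    refine (H h hh hh1 (g i) p q K G (i * h) hs (A i) (hA i) (hAτ i)).trans (mul_le_mul_of_nonneg_left ?_ (by positivity))
    have hEi : Integrable (Er X τ (i * h) h) μ := bint (S.Er_meas L hs hh.le).aestronglyMeasurable _ (Er_bd L hs hh.le)
    have i1 : Integrable (fun ω => h * osc X τ h ω + h * e) μ := (osci.const_mul h).add (integrable_const _)
    have i2 : Integrable (fun ω => h * osc X τ h ω + h * e + h * J i ω) μ := i1.add ((hJi i).const_mul h)
    have i3 : Integrable (fun ω => h * osc X τ h ω + h * e + h * J i ω + Er X τ (i * h) h ω) μ := i2.add hEi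
    have pos : ∀ ω, 0 ≤ h * osc X τ h ω + h * e + h * J i ω + Er X τ (i * h) h ω := by
      intro ω
      have := osc_nn (X := X) (τ := τ) h ω
      have := hJ0 i ω
      unfold Er; positivity
    calc _ = ∫ ω in A i, h * osc X τ h ω + h * e + h * J i ω + Er X τ (i * h) h ω ∂μ := by
          refine setIntegral_congr_fun hAm fun ω hω => ?_
          have : ind τ (i * h + h) ω = J i ω := by
            simp only [ind, hJ, hAτ i ω hω, true_and]
          simp only [this]
          rfl
      _ ≤ ∫ ω, h * osc X τ h ω + h * e + h * J i ω + Er X τ (i * h) h ω ∂μ :=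
          setIntegral_le_integral i3 (ae_of_all _ pos)
      _ = _ := by
          rw [integral_add i2 hEi, integral_add i1 ((hJi i).const_mul h), integral_add (osci.const_mul h) (integrable_const _),
            integral_const_mul, integral_const_mul, integral_const, probReal_univ, one_smul, integral_const_mul]
  have l4 := H4 h hh hh1 n hn
  have hO0 : 0 ≤ O := integral_nonneg fun ω => osc_nn h ω
  calc _ ≤ ∑ i ∈ Finset.range n, |∫ ω in A i, g i (Ys X τ (i * h + h) ω) - c.T h 0 (g i) (Ys X τ (i * h) ω) ∂μ| := Finset.abs_sum_le_sum_abs _ _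
    _ ≤ ∑ i ∈ Finset.range n, K * C2 * (h * O + h * e + h * ∫ ω, J i ω ∂μ + ∫ ω, Er X τ (i * h) h ω ∂μ) := Finset.sum_le_sum fun i _ => step i
    _ = K * C2 * ((n * h) * O + (n * h) * e + h * ∑ i ∈ Finset.range n, ∫ ω, J i ω ∂μ + ∑ i ∈ Finset.range n, ∫ ω, Er X τ (i * h) h ω ∂μ) := by
        rw [← Finset.mul_sum, Finset.sum_add_distrib, Finset.sum_add_distrib]
        rw [Finset.sum_add_distrib, Finset.sum_const, Finset.sum_const, Finset.card_range, nsmul_eq_mul, nsmul_eq_mul, ← Finset.mul_sum]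
        ring
    _ ≤ K * C2 * (T * O + T * e + e * 1 + C4 * O) := by
        have : 0 ≤ ∑ i ∈ Finset.range n, ∫ ω, J i ω ∂μ := Finset.sum_nonneg fun i _ => integral_nonneg fun ω => hJ0 i ω
        gcongr
    _ = K * (C2 * (T + C4) * O + C2 * (T + 1) * e) := by ring
    _ ≤ K * ε := by
        refine mul_le_mul_of_nonneg_left ?_ hK
        have b1 : C2 * (T + C4) * O ≤ ε / 2 := by
          calc _ ≤ (C2 * (T + C4) + 1) * ε' := by gcongr; linarith
            _ = ε / 2 := by rw [hε']; field_simp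
        have b2 : C2 * (T + 1) * e ≤ ε / 2 := by
          calc _ ≤ (C2 * (T + 1) + 1) * η := by gcongr; linarith
            _ = ε / 2 := by rw [hη]; field_simp
        linarith
end Sol
end


set_option linter.unusedSectionVars false

section
variable {Ω : Type*} {mΩ : MeasurableSpace Ω} {μ : Measure Ω} [IsProbabilityMeasure μ] {ℱ : Filtration ℝ mΩ}
  {k : ℕ} {c : Coef k} {x : EE k} {X M : ℝ → Ω → EE k} {T R : ℝ} {τ : Ω → ℝ}

/-- payoff on a grid of mesh `h` -/
noncomputable def gridV (X : ℝ → Ω → EE k) (h : ℝ) (v G : ℕ → EE k → ℝ) (θ : Ω → ℕ) (ω : Ω) : ℝ :=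
  v (θ ω) (X (θ ω * h) ω) + ∑ i ∈ Finset.range (θ ω), h * G i (X (i * h) ω)

lemma gridV_meas {Y : ℝ → Ω → EE k} {h : ℝ} {v G : ℕ → EE k → ℝ} {θ : Ω → ℕ}
    (hY : ∀ i : ℕ, Measurable (Y (i * h))) (hv : ∀ i, Measurable (v i)) (hG : ∀ i, Measurable (G i))
    (hθ : Measurable θ) : Measurable (gridV Y h v G θ) := by
  have : Measurable fun q : ℕ × Ω => v q.1 (Y (q.1 * h) q.2) + ∑ i ∈ Finset.range q.1, h * G i (Y (i * h) q.2) := by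
    apply measurable_from_prod_countable_right
    intro n
    have a1 : Measurable fun y => ∑ i ∈ Finset.range n, h * G i (Y (i * h) y) :=
      Finset.measurable_sum _ fun i _ => ((hG i).comp (hY i)).const_mul h
    exact ((hv n).comp (hY n)).add a1
  exact this.comp (hθ.prodMk measurable_id)

lemma gridV_bd {Y : ℝ → Ω → EE k} {h : ℝ} {v G : ℕ → EE k → ℝ} {θ : Ω → ℕ} {B : ℝ} {N : ℕ} (hh : 0 ≤ h)
    (hN : N * h ≤ T) (hv : ∀ i y, |v i y| ≤ B) (hG : ∀ i y, |G i y| ≤ B) (hθ : ∀ ω, θ ω ≤ N) (ω : Ω) :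
    |gridV Y h v G θ ω| ≤ B + T * B := by
  unfold gridV
  have hB : 0 ≤ B := (abs_nonneg _).trans (hv 0 0)
  refine (abs_add_le _ _).trans (add_le_add (hv _ _) ?_)
  calc _ ≤ ∑ i ∈ Finset.range (θ ω), |h * G i (Y (i * h) ω)| := Finset.abs_sum_le_sum_abs _ _
    _ ≤ ∑ i ∈ Finset.range (θ ω), h * B := Finset.sum_le_sum fun i _ => by
        rw [abs_mul, abs_of_nonneg hh]; exact mul_le_mul_of_nonneg_left (hG _ _) hh
    _ = θ ω * h * B := by rw [Finset.sum_const, Finset.card_range, nsmul_eq_mul]; ring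
    _ ≤ T * B := by
        have h1 : (θ ω : ℝ) ≤ N := by exact_mod_cast hθ ω
        have : (θ ω : ℝ) * h ≤ T := (mul_le_mul_of_nonneg_right h1 hh).trans hN
        gcongr

lemma theta_meas {θ : Ω → ℕ} {h : ℝ} (hθ : ∀ i : ℕ, MeasurableSet[ℱ (i * h)] {ω | i < θ ω}) : Measurable θ := by
  apply measurable_of_Ioi
  intro i
  exact ℱ.le _ _ (hθ i)

namespace Sol
variable (S : Sol c μ ℱ x X M)

lemma tele {h : ℝ} (θ : ℕ) (u : ℕ → ℝ) (G : ℕ → ℝ) :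
    ∑ i ∈ Finset.range θ, (u (i + 1) - u i + h * G i) = u θ + ∑ i ∈ Finset.range θ, h * G i - u 0 := by
  rw [Finset.sum_add_distrib, Finset.sum_range_sub]; ring

include S in
lemma super_grid (hT : 0 ≤ T) {ε : ℝ} (hε : 0 < ε) : ∃ h0 > 0, ∀ h, 0 < h → h < h0 → ∀ N : ℕ, N * h ≤ T →
    ∀ (w G : ℕ → EE k → ℝ) (K B : ℝ), (∀ i, ∃ p q, SM (w i) p q K) → (∀ i y, |w i y| ≤ B) → (∀ i y, |G i y| ≤ B) →
    (∀ i, Measurable (G i)) →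
    ∀ θ : Ω → ℕ, (∀ ω, θ ω ≤ N) → (∀ i : ℕ, MeasurableSet[ℱ (i * h)] {ω | i < θ ω}) →
    (∀ ω i, i < θ ω → c.T h 0 (w (i + 1)) (X (i * h) ω) + h * G i (X (i * h) ω) ≤ w i (X (i * h) ω)) →
    ∫ ω, gridV X h w G θ ω ∂μ ≤ w 0 x + (K + 2 * (B + T * B)) * ε := by
  obtain ⟨R, τ, hR, h0, hle, hm, hb, hP⟩ := exit_time S hT hε
  have L : Loc ℱ X T R τ := ⟨hT, hR, h0, hle, hm, hb⟩
  obtain ⟨h0, hh0, H⟩ := S.key L hε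
  refine ⟨h0, hh0, fun h hh hlt N hN w G K B hw hwB hGB hGm θ hθN hθ hsup => ?_⟩
  have hB : 0 ≤ B := (abs_nonneg _).trans (hwB 0 0)
  set A : ℕ → Set Ω := fun i => {ω | i < θ ω} ∩ {ω | i * h < τ ω} with hA
  have hs : ∀ i : ℕ, 0 ≤ (i : ℝ) * h := fun i => by positivity
  have hAm : ∀ i : ℕ, MeasurableSet[ℱ (i * h)] (A i) := fun i => by
    refine MeasurableSet.inter (hθ i) ?_
    have := (hm _ (hs i)).compl
    convert this using 1
    ext ω; simp
  have hAm' : ∀ i : ℕ, MeasurableSet (A i) := fun i => ℱ.le _ _ (hAm i)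
  have k1 := (abs_le.mp (H h hh hlt N hN (fun i => w (i + 1)) K (fun i => hw (i + 1)) A hAm fun i ω hω => hω.2)).2
  have wm : ∀ i, Measurable (w i) := fun i => by obtain ⟨p, q, G⟩ := hw i; exact G.g_meas
  have Ym : ∀ i : ℕ, Measurable (Ys X τ (i * h)) := fun i => S.Ys_meas L (hs i)
  have Ym' : ∀ i : ℕ, Measurable (Ys X τ (i * h + h)) := fun i => S.Ys_meas L (by positivity)
  set θ' : Ω → ℕ := fun ω => min (θ ω) ⌈τ ω / h⌉₊ with hθ'
  have hmem : ∀ i ω, ω ∈ A i ↔ i < θ' ω := fun i ω => by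
    simp only [hA, hθ', mem_inter_iff, mem_ofPred_eq, lt_min_iff, Nat.lt_ceil, lt_div_iff₀ hh]
  have hθ'N : ∀ ω, θ' ω ≤ N := fun ω => (min_le_left _ _).trans (hθN ω)
  have hθm := theta_meas hθ
  have hθ'm : Measurable θ' := hθm.min (Nat.measurable_ceil.comp ((τ_meas L).div_const h))
  set D : Ω → ℝ := gridV (Ys X τ) h w G θ' with hD
  have Dm : Measurable D := gridV_meas Ym wm hGm hθ'm
  have Db : ∀ ω, |D ω| ≤ B + T * B := gridV_bd hh.le hN hwB hGB hθ'N
  have Di : Integrable D μ := bint Dm.aestronglyMeasurable _ Db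
  set V : Ω → ℝ := gridV X h w G θ with hV
  have Vm : Measurable V := gridV_meas (fun i => (S.adapted _).mono (ℱ.le _) le_rfl) wm hGm hθm
  have Vb : ∀ ω, |V ω| ≤ B + T * B := gridV_bd hh.le hN hwB hGB hθN
  have Vi : Integrable V μ := bint Vm.aestronglyMeasurable _ Vb
  -- step bound
  have k2 : ∑ i ∈ Finset.range N, ∫ ω in A i, w (i+1) (Ys X τ (i * h + h) ω) - w i (Ys X τ (i * h) ω) + h * G i (Ys X τ (i * h) ω) ∂μ ≤ K * ε := by
    refine le_trans (Finset.sum_le_sum fun i _ => ?_) k1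
    have Gi := (bint (μ := μ) ((hGm i).comp (Ym i)).aestronglyMeasurable B (fun ω => hGB i _)).const_mul h
    have w1 := bint (μ := μ) ((wm (i+1)).comp (Ym' i)).aestronglyMeasurable B (fun ω => hwB (i+1) _)
    have w0 := bint (μ := μ) ((wm i).comp (Ym i)).aestronglyMeasurable B (fun ω => hwB i _)
    have Ti := bint (μ := μ) ((c.T_meas h (wm (i+1))).comp (Ym i)).aestronglyMeasurable B (fun ω => c.T_abs h (hwB (i+1)) 0 _)
    refine setIntegral_mono_on ((w1.sub w0).add Gi).integrableOn (w1.sub Ti).integrableOn (hAm' i) fun ω hω => ?_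
    have := hsup ω i hω.1
    have e : Ys X τ (i * h) ω = X (i * h) ω := by simp only [Ys]; rw [min_eq_left (le_of_lt hω.2)]
    simp only [Pi.add_apply, Pi.sub_apply, Function.comp] at *
    rw [e]
    linarith
  have k3 : ∑ i ∈ Finset.range N, ∫ ω in A i, w (i+1) (Ys X τ (i * h + h) ω) - w i (Ys X τ (i * h) ω) + h * G i (Ys X τ (i * h) ω) ∂μ = ∫ ω, D ω - w 0 x ∂μ := by
    simp_rw [← integral_indicator (hAm' _)]
    rw [← integral_finsetSum]
    · refine integral_congr_ae (ae_of_all _ fun ω => ?_)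
      simp only
      have : ∀ i, (A i).indicator (fun ω => w (i+1) (Ys X τ (i * h + h) ω) - w i (Ys X τ (i * h) ω) + h * G i (Ys X τ (i * h) ω)) ω
          = if i < θ' ω then w (i+1) (Ys X τ ((i + 1 : ℕ) * h) ω) - w i (Ys X τ (i * h) ω) + h * G i (Ys X τ (i * h) ω) else 0 := by
        intro i
        have e : ((i + 1 : ℕ) : ℝ) * h = i * h + h := by push_cast; ring
        rw [e]
        by_cases hi : i < θ' ω
        · rw [indicator_of_mem ((hmem i ω).2 hi), if_pos hi]
        · rw [indicator_of_notMem (fun h => hi ((hmem i ω).1 h)), if_neg hi]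
      simp_rw [this]
      rw [← Finset.sum_filter]
      have e2 : Finset.filter (fun i => i < θ' ω) (Finset.range N) = Finset.range (θ' ω) := by
        ext i; simp only [Finset.mem_filter, Finset.mem_range]
        exact ⟨fun h => h.2, fun h => ⟨h.trans_le (hθ'N ω), h⟩⟩
      rw [e2, tele (h := h) (θ' ω) (fun i => w i (Ys X τ (i * h) ω)) (fun i => G i (Ys X τ (i * h) ω))]
      simp only [hD, gridV]
      congr 2
      simp only [Ys, Nat.cast_zero, zero_mul]
      rw [min_eq_left (L.nn ω), S.init]
    · intro i _
      have Gi := (bint (μ := μ) ((hGm i).comp (Ym i)).aestronglyMeasurable B (fun ω => hGB i _)).const_mul h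
      have w1 := bint (μ := μ) ((wm (i+1)).comp (Ym' i)).aestronglyMeasurable B (fun ω => hwB (i+1) _)
      have w0 := bint (μ := μ) ((wm i).comp (Ym i)).aestronglyMeasurable B (fun ω => hwB i _)
      exact ((w1.sub w0).add Gi).indicator (hAm' i)
  rw [k3, integral_sub Di (integrable_const _), integral_const, probReal_univ, one_smul] at k2
  set bad : Set Ω := {ω | τ ω < T} with hbad
  have badm : MeasurableSet bad := measurableSet_lt (τ_meas L) measurable_const
  have pt : ∀ ω, V ω ≤ D ω + bad.indicator (fun _ => 2 * (B + T * B)) ω := by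
    intro ω
    by_cases hω : ω ∈ bad
    · rw [indicator_of_mem hω]
      linarith [(abs_le.mp (Vb ω)).2, (abs_le.mp (Db ω)).1]
    · rw [indicator_of_notMem hω, add_zero]
      have hτ : τ ω = T := le_antisymm (L.le ω) (not_lt.mp hω)
      have et : θ' ω = θ ω := by
        apply min_eq_left
        rw [hτ]
        have : (θ ω : ℝ) ≤ ⌈T / h⌉₊ := by
          refine le_trans ?_ (Nat.le_ceil _)
          rw [le_div_iff₀ hh]
          have h1 : (θ ω : ℝ) ≤ N := by exact_mod_cast hθN ω
          exact (mul_le_mul_of_nonneg_right h1 hh.le).trans hN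
        exact_mod_cast this
      have ey : ∀ i : ℕ, i ≤ N → Ys X τ (i * h) ω = X (i * h) ω := by
        intro i hi
        simp only [Ys]
        rw [min_eq_left]
        rw [hτ]
        have h1 : (i : ℝ) ≤ N := by exact_mod_cast hi
        exact (mul_le_mul_of_nonneg_right h1 hh.le).trans hN
      apply le_of_eq
      simp only [hV, hD, gridV]
      rw [et, ey _ (hθN ω)]
      congr 1
      refine Finset.sum_congr rfl fun i hi => ?_
      rw [ey i ((Finset.mem_range.mp hi).le.trans (hθN ω))]
  have bi : Integrable (bad.indicator fun _ => 2 * (B + T * B)) μ := (integrable_const _).indicator badm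
  have fin : ∫ ω, V ω ∂μ ≤ ∫ ω, D ω ∂μ + 2 * (B + T * B) * ε := by
    calc _ ≤ ∫ ω, D ω + bad.indicator (fun _ => 2 * (B + T * B)) ω ∂μ := integral_mono Vi (Di.add bi) pt
      _ = ∫ ω, D ω ∂μ + μ.real bad * (2 * (B + T * B)) := by
          rw [integral_add Di bi, integral_indicator_const _ badm, smul_eq_mul]
      _ ≤ _ := by
          have : μ.real bad * (2 * (B + T * B)) ≤ ε * (2 * (B + T * B)) := mul_le_mul_of_nonneg_right hP (by positivity)
          linarith
  linarith

include S in
lemma super_moll (hT : 0 ≤ T) {δ : ℝ} (hδ : 0 < δ) {η : ℝ} (hη : 0 < η) (B Λ : ℝ) (hB : 0 ≤ B) (hΛ : 0 ≤ Λ) :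
    ∃ h0 > 0, ∀ h, 0 < h → h < h0 → ∀ N : ℕ, N * h ≤ T →
    ∀ (v G : ℕ → EE k → ℝ), (∀ i y, |v i y| ≤ B) → (∀ i y, |G i y| ≤ B) →
    (∀ i y z, v i y - v i z ≤ Λ * ‖y - z‖) → (∀ i y z, G i y - G i z ≤ Λ * ‖y - z‖) →
    ∀ θ : Ω → ℕ, (∀ ω, θ ω ≤ N) → (∀ i : ℕ, MeasurableSet[ℱ (i * h)] {ω | i < θ ω}) →
    (∀ ω i, i < θ ω → ∀ z, ‖z‖ ≤ δ → c.T h z (v (i + 1)) (X (i * h) ω - z) + h * G i (X (i * h) ω - z) ≤ v i (X (i * h) ω - z)) →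
    ∫ ω, gridV X h v G θ ω ∂μ ≤ v 0 x + (2 * Λ + T * Λ) * δ + η := by
  obtain ⟨K, hK, HK⟩ := moll_SM (k := k) hδ
  set ε := η / (K * B + 2 * (B + T * B) + 1) with hε
  have hε0 : 0 < ε := by positivity
  obtain ⟨h0, hh0, H⟩ := S.super_grid hT hε0
  refine ⟨h0, hh0, fun h hh hlt N hN v G hvB hGB hvL hGL θ hθN hθ hsup => ?_⟩
  have vc : ∀ i, Continuous (v i) := fun i => cont_of_lip (hvL i)
  have Gc : ∀ i, Continuous (G i) := fun i => cont_of_lip (hGL i)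
  have Gmm : ∀ i, Measurable (moll δ hδ (G i)) := fun i => by
    obtain ⟨p, q, h⟩ := HK B (G i) (Gc i) (hGB i); exact h.g_meas
  have vmm : ∀ i, Measurable (moll δ hδ (v i)) := fun i => by
    obtain ⟨p, q, h⟩ := HK B (v i) (vc i) (hvB i); exact h.g_meas
  have vmb : ∀ i y, |moll δ hδ (v i) y| ≤ B := fun i y => moll_bd hδ (vc i) (hvB i) y
  have Gmb : ∀ i y, |moll δ hδ (G i) y| ≤ B := fun i y => moll_bd hδ (Gc i) (hGB i) y
  have key := H h hh hlt N hN (fun i => moll δ hδ (v i)) (fun i => moll δ hδ (G i)) (K * B) B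
    (fun i => HK B (v i) (vc i) (hvB i)) vmb Gmb Gmm θ hθN hθ ?_
  · have hθm := theta_meas hθ
    have Xm : ∀ i : ℕ, Measurable (X (i * h)) := fun i => (S.adapted _).mono (ℱ.le _) le_rfl
    have V1 : Integrable (gridV X h v G θ) μ := bint (gridV_meas Xm (fun i => (vc i).measurable) (fun i => (Gc i).measurable) hθm).aestronglyMeasurable _
      (gridV_bd hh.le hN hvB hGB hθN)
    have V2 : Integrable (gridV X h (fun i => moll δ hδ (v i)) (fun i => moll δ hδ (G i)) θ) μ :=
      bint (gridV_meas Xm vmm Gmm hθm).aestronglyMeasurable _ (gridV_bd hh.le hN vmb Gmb hθN)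
    have pt : ∀ ω, gridV X h v G θ ω ≤ gridV X h (fun i => moll δ hδ (v i)) (fun i => moll δ hδ (G i)) θ ω + (Λ + T * Λ) * δ := by
      intro ω
      unfold gridV
      have a1 := (abs_le.mp (moll_close hδ hΛ (hvL (θ ω)) (X (θ ω * h) ω))).1
      have a2 : ∑ i ∈ Finset.range (θ ω), h * G i (X (i * h) ω) ≤ ∑ i ∈ Finset.range (θ ω), (h * moll δ hδ (G i) (X (i * h) ω) + h * (Λ * δ)) := by
        refine Finset.sum_le_sum fun i _ => ?_
        have := (abs_le.mp (moll_close hδ hΛ (hGL i) (X (i * h) ω))).1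
        rw [← mul_add]
        exact mul_le_mul_of_nonneg_left (by linarith) hh.le
      rw [Finset.sum_add_distrib, Finset.sum_const, Finset.card_range, nsmul_eq_mul] at a2
      have h1 : (θ ω : ℝ) ≤ N := by exact_mod_cast hθN ω
      have h2 : (θ ω : ℝ) * h ≤ T := (mul_le_mul_of_nonneg_right h1 hh.le).trans hN
      have h3 : (θ ω : ℝ) * (h * (Λ * δ)) ≤ T * (Λ * δ) := by
        rw [← mul_assoc]; gcongr
      linarith
    have i1 : ∫ ω, gridV X h v G θ ω ∂μ ≤ ∫ ω, gridV X h (fun i => moll δ hδ (v i)) (fun i => moll δ hδ (G i)) θ ω ∂μ + (Λ + T * Λ) * δ := by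
      calc _ ≤ ∫ ω, gridV X h (fun i => moll δ hδ (v i)) (fun i => moll δ hδ (G i)) θ ω + (Λ + T * Λ) * δ ∂μ :=
            integral_mono V1 (V2.add (integrable_const _)) pt
        _ = _ := by rw [integral_add V2 (integrable_const _), integral_const, probReal_univ, one_smul]
    have a0 := (abs_le.mp (moll_close hδ hΛ (hvL 0) x)).2
    have e1 : (K * B + 2 * (B + T * B)) * ε ≤ η := by
      calc _ ≤ (K * B + 2 * (B + T * B) + 1) * ε := mul_le_mul_of_nonneg_right (by linarith) hε0.le
        _ = η := by rw [hε]; field_simp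
    linarith
  · intro ω i hi
    rw [← moll_comb hδ c (vc (i+1)) (Gc i)]
    refine moll_mono hδ ?_ (vc i) _ fun z hz => ?_
    · have := vc (i+1); have := Gc i; fun_prop
    · have := hsup ω i hi z hz
      unfold Coef.T at this
      rw [sub_add_cancel] at this
      exact this
end Sol
end


set_option linter.unusedSectionVars false

/-- discounted function at grid time `i * h` -/
noncomputable def disc {k : ℕ} (r h : ℝ) (f : EE k → ℝ) (i : ℕ) (y : EE k) : ℝ := Real.exp (-r * (i * h)) * f y

/-- bounded Lipschitz data -/
structure BL {k : ℕ} (f : EE k → ℝ) (B L : ℝ) : Prop where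
  B_nn : 0 ≤ B
  L_nn : 0 ≤ L
  bd : ∀ y, |f y| ≤ B
  lip : ∀ y z, f y - f z ≤ L * ‖y - z‖

section
variable {k : ℕ} {f g : EE k → ℝ} {B L r h : ℝ}

lemma BL.cont (hf : BL f B L) : Continuous f := cont_of_lip hf.lip

lemma exp_disc_le (hr : 0 ≤ r) {t : ℝ} (ht : 0 ≤ t) : Real.exp (-r * t) ≤ 1 := by
  rw [Real.exp_le_one_iff]; nlinarith

lemma disc_BL (hf : BL f B L) (hr : 0 ≤ r) (hh : 0 ≤ h) (i : ℕ) : BL (disc r h f i) B L := by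
  have e1 : Real.exp (-r * (i * h)) ≤ 1 := exp_disc_le hr (by positivity)
  have e0 := (Real.exp_pos (-r * (i * h))).le
  refine ⟨hf.B_nn, hf.L_nn, fun y => ?_, fun y z => ?_⟩
  · unfold disc
    rw [abs_mul, abs_of_nonneg e0]
    have := hf.bd y
    nlinarith [abs_nonneg (f y)]
  · unfold disc
    rw [← mul_sub]
    have h1 := hf.lip y z
    have h2 : 0 ≤ L * ‖y - z‖ := mul_nonneg hf.L_nn (norm_nonneg _)
    nlinarith

lemma disc_Dat (hf : BL f B L) (hg : BL g B L) (hr : 0 ≤ r) (hh : 0 ≤ h) (N : ℕ) :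
    Coef.Dat (fun n => disc r h f (N - n)) (fun n => disc r h g (N - n)) B L :=
  ⟨hf.B_nn, hf.L_nn, fun n x => (disc_BL hf hr hh _).bd x, fun n x => (disc_BL hg hr hh _).bd x,
    fun n x y => (disc_BL hf hr hh _).lip x y, fun n x y => (disc_BL hg hr hh _).lip x y⟩
end

/-- Lipschitz constant of the value -/
noncomputable def Lam {k : ℕ} (c : Coef k) (L T : ℝ) : ℝ := (L + T * L) * Real.exp (c.kap * T)

lemma Lam_ge {k : ℕ} (c : Coef k) {L T : ℝ} (hL : 0 ≤ L) (hT : 0 ≤ T) : L ≤ Lam c L T := by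
  have h1 : 1 ≤ Real.exp (c.kap * T) := Real.one_le_exp (mul_nonneg c.kap_nn hT)
  have h2 : 0 ≤ T * L := by positivity
  unfold Lam; nlinarith

section
variable {Ω : Type*} {mΩ : MeasurableSpace Ω} {μ : Measure Ω} [IsProbabilityMeasure μ] {ℱ : Filtration ℝ mΩ}
  {k : ℕ} {c : Coef k} {x : EE k} {X M : ℝ → Ω → EE k} {T : ℝ} {f g : EE k → ℝ} {B L r : ℝ}

namespace Sol
variable (S : Sol c μ ℱ x X M)

include S in
lemma grid_int {h : ℝ} (hh : 0 < h) {N : ℕ} (hN : N * h ≤ T) (hf : BL f B L) (hg : BL g B L) (hr : 0 ≤ r) {θ : Ω → ℕ} (hθN : ∀ ω, θ ω ≤ N)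
    (hθ : Measurable θ) : Integrable (gridV X h (disc r h g) (disc r h f) θ) μ :=
  bint (gridV_meas (fun i => (S.adapted _).mono (ℱ.le _) le_rfl) (fun i => (disc_BL hg hr hh.le i).cont.measurable)
    (fun i => (disc_BL hf hr hh.le i).cont.measurable) hθ).aestronglyMeasurable _
      (gridV_bd hh.le hN (fun i => (disc_BL hg hr hh.le i).bd) (fun i => (disc_BL hf hr hh.le i).bd) hθN)

lemma sub_le_T {h : ℝ} (hh : 0 ≤ h) {N i : ℕ} (hN : N * h ≤ T) : ((N - i : ℕ) : ℝ) * h ≤ T := by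
  refine le_trans (mul_le_mul_of_nonneg_right ?_ hh) hN
  exact_mod_cast Nat.sub_le _ _

include S in
lemma grid_upper (hT : 0 ≤ T) (hf : BL f B L) (hg : BL g B L) (hr : 0 ≤ r) {δ η : ℝ} (hδ : 0 < δ) (hη : 0 < η) :
    ∃ h0 > 0, ∀ h, 0 < h → h < h0 → ∀ N : ℕ, N * h ≤ T →
    ∀ θ : Ω → ℕ, (∀ ω, θ ω ≤ N) → (∀ i : ℕ, MeasurableSet[ℱ (i * h)] {ω | i < θ ω}) →
    ∫ ω, gridV X h (disc r h g) (disc r h f) θ ω ∂μ ≤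
      c.Wp h δ (fun n => disc r h f (N - n)) (fun n => disc r h g (N - n)) N x + (2 * Lam c L T + T * Lam c L T) * δ + η := by
  have hB := hf.B_nn
  have hL := hf.L_nn
  have hΛ := Lam_ge c hL hT
  obtain ⟨h0, hh0, H⟩ := S.super_moll hT hδ hη (B * (1 + T)) (Lam c L T) (by positivity) (hL.trans hΛ)
  refine ⟨min h0 1, by positivity, fun h hh hlt N hN θ hθN hθ => ?_⟩
  have hlt0 : h < h0 := hlt.trans_le (min_le_left _ _)
  have hh1 : h ≤ 1 := (hlt.trans_le (min_le_right _ _)).le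
  have d := disc_Dat (h := h) hf hg hr hh.le N
  have vb : ∀ i y, |c.Wp h δ (fun n => disc r h f (N - n)) (fun n => disc r h g (N - n)) (N - i) y| ≤ B * (1 + T) := fun i y => by
    refine (Coef.Wp_abs hh.le hδ.le d (N - i) y).trans ?_
    have := sub_le_T hh.le (i := i) hN
    gcongr
  have vl : ∀ i y z, c.Wp h δ (fun n => disc r h f (N - n)) (fun n => disc r h g (N - n)) (N - i) y - c.Wp h δ (fun n => disc r h f (N - n)) (fun n => disc r h g (N - n)) (N - i) z ≤ Lam c L T * ‖y - z‖ := fun i y z => by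
    refine (Coef.Wp_lip hh.le hh1 hδ.le d (N - i) y z).trans ?_
    have := c.Lc_le hh.le hL (N - i) (sub_le_T hh.le (i := i) hN)
    exact mul_le_mul_of_nonneg_right this (norm_nonneg _)
  have Gb : ∀ i y, |disc r h f i y| ≤ B * (1 + T) := fun i y => by
    refine ((disc_BL hf hr hh.le i).bd y).trans ?_
    nlinarith
  have Gl : ∀ i y z, disc r h f i y - disc r h f i z ≤ Lam c L T * ‖y - z‖ := fun i y z =>
    ((disc_BL hf hr hh.le i).lip y z).trans (mul_le_mul_of_nonneg_right hΛ (norm_nonneg _))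
  have key := H h hh hlt0 N hN (fun i => c.Wp h δ (fun n => disc r h f (N - n)) (fun n => disc r h g (N - n)) (N - i)) (disc r h f)
    vb Gb vl Gl θ hθN hθ ?_
  · refine le_trans ?_ key
    have hθm := theta_meas hθ
    refine integral_mono (S.grid_int hh hN hf hg hr hθN hθm) ?_ fun ω => ?_
    · exact bint (gridV_meas (fun i => (S.adapted _).mono (ℱ.le _) le_rfl) (fun i => (cont_of_lip (vl i)).measurable)
        (fun i => (disc_BL hf hr hh.le i).cont.measurable) hθm).aestronglyMeasurable _ (gridV_bd hh.le hN vb Gb hθN)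
    · unfold gridV
      refine add_le_add_left ?_ _
      have := Coef.Wp_ge (c := c) (h := h) (δ := δ) (F := fun n => disc r h f (N - n)) (H := fun n => disc r h g (N - n)) (N - θ ω) (X (θ ω * h) ω)
      simp only [Nat.sub_sub_self (hθN ω)] at this
      exact this
  · intro ω i hi z hz
    have hiN : i < N := hi.trans_le (hθN ω)
    have := Coef.Wp_super (c := c) hh.le hδ.le d (N - (i + 1)) (X (i * h) ω - z) z hz
    have e : N - (i + 1) + 1 = N - i := by omega
    simp only [e, Nat.sub_sub_self hiN.le] at this
    exact this

include S in
lemma grid_lower (hT : 0 ≤ T) (hf : BL f B L) (hg : BL g B L) (hr : 0 ≤ r) {δ η : ℝ} (hδ : 0 < δ) (hη : 0 < η) :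
    ∃ h0 > 0, ∀ h, 0 < h → h < h0 → ∀ N : ℕ, N * h ≤ T →
    ∃ θ : Ω → ℕ, (∀ ω, θ ω ≤ N) ∧ (∀ i : ℕ, MeasurableSet[ℱ (i * h)] {ω | i < θ ω}) ∧ (∀ ω ω', 0 < θ ω → 0 < θ ω') ∧
      c.Wm h δ (fun n => disc r h f (N - n)) (fun n => disc r h g (N - n)) N x ≤ 
    ∫ ω, gridV X h (disc r h g) (disc r h f) θ ω ∂μ + (4 * Lam c L T + T * Lam c L T) * δ + η := by
  classical
  have hB := hf.B_nn
  have hL := hf.L_nn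
  have hΛ := Lam_ge c hL hT
  set Λ := Lam c L T with hLam
  obtain ⟨h0, hh0, H⟩ := S.super_moll hT hδ hη (B * (1 + T)) Λ (by positivity) (hL.trans hΛ)
  refine ⟨min h0 1, by positivity, fun h hh hlt N hN => ?_⟩
  have hlt0 : h < h0 := hlt.trans_le (min_le_left _ _)
  have hh1 : h ≤ 1 := (hlt.trans_le (min_le_right _ _)).le
  have d := disc_Dat (h := h) hf hg hr hh.le N
  set W : ℕ → EE k → ℝ := fun i => c.Wm h δ (fun n => disc r h f (N - n)) (fun n => disc r h g (N - n)) (N - i) with hW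
  have vb : ∀ i y, |W i y| ≤ B * (1 + T) := fun i y => by
    refine (Coef.Wm_abs hh.le hδ.le d (N - i) y).trans ?_
    have := sub_le_T hh.le (i := i) hN
    gcongr
  have vl : ∀ i y z, W i y - W i z ≤ Λ * ‖y - z‖ := fun i y z => by
    refine (Coef.Wm_lip hh.le hh1 hδ.le d (N - i) y z).trans ?_
    have := c.Lc_le hh.le hL (N - i) (sub_le_T hh.le (i := i) hN)
    exact mul_le_mul_of_nonneg_right this (norm_nonneg _)
  have Gb : ∀ i y, |disc r h f i y| ≤ B * (1 + T) := fun i y => by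
    refine ((disc_BL hf hr hh.le i).bd y).trans ?_
    nlinarith
  have Gl : ∀ i y z, disc r h f i y - disc r h f i z ≤ Λ * ‖y - z‖ := fun i y z =>
    ((disc_BL hf hr hh.le i).lip y z).trans (mul_le_mul_of_nonneg_right hΛ (norm_nonneg _))
  have Hl : ∀ i y z, disc r h g i y - disc r h g i z ≤ Λ * ‖y - z‖ := fun i y z =>
    ((disc_BL hg hr hh.le i).lip y z).trans (mul_le_mul_of_nonneg_right hΛ (norm_nonneg _))
  -- the stopping rule
  have hΛ0 : 0 ≤ Λ := hL.trans hΛ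
  have ex : ∀ ω, ∃ j : ℕ, W j (X (j * h) ω) ≤ disc r h g j (X (j * h) ω) + 2 * Λ * δ := fun ω => ⟨N, by
    simp only [hW, Nat.sub_self, Coef.Wm, Nat.sub_zero]
    have : 0 ≤ 2 * Λ * δ := by positivity
    linarith⟩
  set θ : Ω → ℕ := fun ω => Nat.find (ex ω) with hθd
  have hθN : ∀ ω, θ ω ≤ N := fun ω => Nat.find_min' (ex ω) (by
    simp only [hW, Nat.sub_self, Coef.Wm, Nat.sub_zero]
    have : 0 ≤ 2 * Λ * δ := by positivity
    linarith)
  have hθm : ∀ i : ℕ, MeasurableSet[ℱ (i * h)] {ω | i < θ ω} := by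
    intro i
    have e : {ω | i < θ ω} = ⋂ j ∈ Finset.range (i + 1), {ω | disc r h g j (X (j * h) ω) + 2 * Λ * δ < W j (X (j * h) ω)} := by
      ext ω
      simp only [hθd, mem_ofPred_eq, Nat.lt_find_iff, mem_iInter, Finset.mem_range, not_le, Nat.lt_succ_iff]
    rw [e]
    refine Finset.measurableSet_biInter _ fun j hj => ?_
    have hji : (j : ℝ) * h ≤ i * h := by
      have : (j : ℝ) ≤ i := by exact_mod_cast Nat.lt_succ_iff.mp (Finset.mem_range.mp hj)
      gcongr
    have hs : MeasurableSet {y : EE k | disc r h g j y + 2 * Λ * δ < W j y} :=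
      measurableSet_lt ((disc_BL hg hr hh.le j).cont.measurable.add_const _) (cont_of_lip (vl j)).measurable
    exact ℱ.mono hji _ (S.adapted (j * h) hs)
  refine ⟨θ, hθN, hθm, fun ω ω' => by simp only [hθd, Nat.find_pos, Nat.cast_zero, zero_mul, S.init, imp_self], ?_⟩
  have key := H h hh hlt0 N hN (fun i y => - W i y) (fun i y => - disc r h f i y) (fun i y => by rw [abs_neg]; exact vb i y)
    (fun i y => by rw [abs_neg]; exact Gb i y) (fun i y z => by have := vl i z y; rw [norm_sub_rev] at this; linarith)
    (fun i y z => by have := Gl i z y; rw [norm_sub_rev] at this; linarith) θ hθN hθm ?_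
  · have I1 := S.grid_int (T := T) hh hN hf hg hr hθN (theta_meas hθm)
    have I2 : Integrable (gridV X h (fun i y => - W i y) (fun i y => - disc r h f i y) θ) μ := 
      bint (gridV_meas (fun i => (S.adapted _).mono (ℱ.le _) le_rfl) (fun i => (cont_of_lip (vl i)).measurable.neg)
        (fun i => (disc_BL hf hr hh.le i).cont.measurable.neg) (theta_meas hθm)).aestronglyMeasurable _ 
          (gridV_bd hh.le hN (B := B * (1 + T)) (fun i y => by rw [abs_neg]; exact vb i y) (fun i y => by rw [abs_neg]; exact Gb i y) hθN)
    have pt : ∀ ω, - gridV X h (disc r h g) (disc r h f) θ ω ≤ gridV X h (fun i y => - W i y) (fun i y => - disc r h f i y) θ ω + 2 * Λ * δ := by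
      intro ω
      have := Nat.find_spec (ex ω)
      unfold gridV
      simp only [mul_neg, Finset.sum_neg_distrib]
      change W (θ ω) (X (θ ω * h) ω) ≤ disc r h g (θ ω) (X (θ ω * h) ω) + 2 * Λ * δ at this
      linarith
    have i3 : - ∫ ω, gridV X h (disc r h g) (disc r h f) θ ω ∂μ ≤ ∫ ω, gridV X h (fun i y => - W i y) (fun i y => - disc r h f i y) θ ω ∂μ + 2 * Λ * δ := by
      rw [← integral_neg]
      calc _ ≤ ∫ ω, gridV X h (fun i y => - W i y) (fun i y => - disc r h f i y) θ ω + 2 * Λ * δ ∂μ := integral_mono I1.neg (I2.add (integrable_const _)) pt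
        _ = _ := by rw [integral_add I2 (integrable_const _), integral_const, probReal_univ, one_smul]
    have e : c.Wm h δ (fun n => disc r h f (N - n)) (fun n => disc r h g (N - n)) N x = W 0 x := by simp only [hW, Nat.sub_zero]
    rw [e]
    linarith
  · intro ω i hi z hz
    have hiN : i < N := hi.trans_le (hθN ω)
    have e : N - (i + 1) + 1 = N - i := by omega
    have hnot : disc r h g i (X (i * h) ω) + 2 * Λ * δ < W i (X (i * h) ω) := not_le.mp (Nat.find_min (ex ω) hi)
    have l1 := vl i (X (i * h) ω) (X (i * h) ω - z)
    have l2 := Hl i (X (i * h) ω - z) (X (i * h) ω)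
    rw [sub_sub_cancel] at l1
    have e3 : ‖X (i * h) ω - z - X (i * h) ω‖ = ‖z‖ := by rw [← norm_neg z]; congr 1; abel
    rw [e3] at l2
    have l3 : Λ * ‖z‖ ≤ Λ * δ := by gcongr
    have := Coef.Wm_sub (c := c) hh.le hδ.le d (N - (i + 1)) (X (i * h) ω - z) z hz
    simp only [e, Nat.sub_sub_self hiN.le] at this
    have := this (by change _ < W i _; linarith)
    have e2 : c.T h z (fun y => - W (i + 1) y) (X (i * h) ω - z) = - c.T h z (W (i + 1)) (X (i * h) ω - z) := by
      unfold Coef.T; simp only [mul_neg, Finset.sum_neg_distrib]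
    rw [e2]
    change W i _ ≤ c.T h z (W (i+1)) _ + _ at this
    linarith
end Sol
end


set_option linter.unusedSectionVars false

section
variable {Ω : Type*} {mΩ : MeasurableSpace Ω} {μ : Measure Ω} [IsProbabilityMeasure μ] {ℱ : Filtration ℝ mΩ}
  {k : ℕ} {c : Coef k} {x : EE k} {X M : ℝ → Ω → EE k} {T : ℝ} {f g : EE k → ℝ} {B L r : ℝ}

/-- payoff in continuous time -/
noncomputable def Pay (r : ℝ) (f g : EE k → ℝ) (X : ℝ → Ω → EE k) (ρ : Ω → ℝ) (ω : Ω) : ℝ :=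
  (∫ l in Ioc 0 (ρ ω), Real.exp (-r * l) * f (X l ω)) + Real.exp (-r * ρ ω) * g (X (ρ ω) ω)

/-- stopping times bounded by `T` -/
structure BST (ℱ : Filtration ℝ mΩ) (T : ℝ) (ρ : Ω → ℝ) : Prop where
  nn : ∀ ω, 0 ≤ ρ ω
  le : ∀ ω, ρ ω ≤ T
  meas : ∀ t, MeasurableSet[ℱ t] {ω | ρ ω ≤ max t 0}

lemma BST.mea {ρ : Ω → ℝ} (h : BST ℱ T ρ) : Measurable ρ := by
  apply measurable_of_Iic
  intro t
  by_cases ht : 0 ≤ t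
  · have := ℱ.le _ _ (h.meas t)
    rw [max_eq_left ht] at this; exact this
  · convert MeasurableSet.empty using 1
    ext ω
    simp only [mem_preimage, mem_Iic, mem_empty_iff_false, iff_false, not_le]
    exact (not_le.mp ht).trans_le (h.nn ω)

/-- Riemann sum error -/
noncomputable def rerr (r : ℝ) (f : EE k → ℝ) (X : ℝ → Ω → EE k) (T h : ℝ) (ω : Ω) : ℝ :=
  ∫ l in Ioc 0 T, |Real.exp (-r * l) * f (X l ω) - Real.exp (-r * (⌊l / h⌋₊ * h)) * f (X (⌊l / h⌋₊ * h) ω)|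

lemma floor_tendsto {h : ℕ → ℝ} (hh : ∀ n, 0 < h n) (ht : Tendsto h atTop (𝓝 0)) {l : ℝ} (hl : 0 ≤ l) :
    Tendsto (fun n => (⌊l / h n⌋₊ : ℝ) * h n) atTop (𝓝 l) := by
  have h1 : Tendsto (fun n => l - h n) atTop (𝓝 l) := by simpa using tendsto_const_nhds.sub ht
  refine tendsto_of_tendsto_of_tendsto_of_le_of_le h1 tendsto_const_nhds (fun n => ?_) fun n => ?_
  · have := Nat.lt_floor_add_one (l / h n)
    rw [div_lt_iff₀ (hh n)] at this
    simp only; linarith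
  · have := Nat.floor_le (div_nonneg hl (hh n).le)
    rwa [le_div_iff₀ (hh n)] at this

lemma ceil_tendsto {h : ℕ → ℝ} (hh : ∀ n, 0 < h n) (ht : Tendsto h atTop (𝓝 0)) {l : ℝ} (hl : 0 ≤ l) :
    Tendsto (fun n => (⌈l / h n⌉₊ : ℝ) * h n) atTop (𝓝 l) := by
  have h1 : Tendsto (fun n => l + h n) atTop (𝓝 l) := by simpa using tendsto_const_nhds.add ht
  exact tendsto_of_tendsto_of_tendsto_of_le_of_le tendsto_const_nhds h1 (fun n => (ceil_grid l (h n) (hh n) hl).1)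
    fun n => (ceil_grid l (h n) (hh n) hl).2

namespace Sol
variable (S : Sol c μ ℱ x X M)

include S in
lemma phi_meas (hf : Measurable f) : Measurable fun q : ℝ × Ω => Real.exp (-r * q.1) * f (X q.1 q.2) :=
  (Real.measurable_exp.comp (measurable_fst.const_mul _)).mul (hf.comp S.unc)

include S in
lemma phi_cont (hf : Continuous f) (ω : Ω) : Continuous fun l => Real.exp (-r * l) * f (X l ω) := by
  have := S.cont ω; fun_prop

include S in
lemma pay_meas (hf : Measurable f) (hg : Measurable g) {ρ : Ω → ℝ} (hρ : Measurable ρ) : Measurable (Pay r f g X ρ) := by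
  have h1 : Measurable fun ω => Real.exp (-r * ρ ω) * g (X (ρ ω) ω) := (S.phi_meas (r := r) hg).comp (hρ.prodMk measurable_id)
  have h2 : Measurable fun ω => ∫ l, (if 0 < l ∧ l ≤ ρ ω then Real.exp (-r * l) * f (X l ω) else 0) := by
    have : Measurable (fun q : Ω × ℝ => if 0 < q.2 ∧ q.2 ≤ ρ q.1 then Real.exp (-r * q.2) * f (X q.2 q.1) else 0) := by
      refine Measurable.ite ((measurableSet_lt measurable_const measurable_snd).inter (measurableSet_le measurable_snd (hρ.comp measurable_fst)))
        ((S.phi_meas (r := r) hf).comp measurable_swap) measurable_const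
    exact (this.stronglyMeasurable.integral_prod_right' (ν := volume)).measurable
  refine Measurable.add ?_ h1
  convert h2 using 2 with ω
  rw [← integral_indicator measurableSet_Ioc]
  congr 1
  ext l
  simp only [indicator, mem_Ioc]

include S in
lemma pay_bd (hr : 0 ≤ r) (hf : Continuous f) (hfb : ∀ y, |f y| ≤ B) (hgb : ∀ y, |g y| ≤ B) {ρ : Ω → ℝ} (h0 : ∀ ω, 0 ≤ ρ ω) (hT : ∀ ω, ρ ω ≤ T) (ω : Ω) :
    |Pay r f g X ρ ω| ≤ B + T * B := by
  unfold Pay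
  have hB : 0 ≤ B := (abs_nonneg _).trans (hfb 0)
  have eb : ∀ (f : EE k → ℝ), (∀ y, |f y| ≤ B) → ∀ l ≥ 0, |Real.exp (-r * l) * f (X l ω)| ≤ B := fun f hf l hl => by
    rw [abs_mul, abs_of_pos (Real.exp_pos _)]
    have := exp_disc_le hr hl
    have := hf (X l ω)
    have := Real.exp_pos (-r * l)
    nlinarith [abs_nonneg (f (X l ω))]
  refine (abs_add_le _ _).trans ?_
  rw [add_comm]
  refine add_le_add (eb g hgb _ (h0 ω)) ?_
  have : ‖∫ l in Ioc 0 (ρ ω), Real.exp (-r * l) * f (X l ω)‖ ≤ B * (volume.real (Ioc 0 (ρ ω))) := by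
    refine norm_setIntegral_le_of_norm_le_const (by simp) fun l hl => eb f hfb l hl.1.le
  rw [Real.volume_real_Ioc_of_le (h0 ω), sub_zero, Real.norm_eq_abs] at this
  have h3 := hT ω
  calc _ ≤ B * ρ ω := this
    _ ≤ B * T := by gcongr
    _ = T * B := mul_comm _ _

lemma floor_eq {h l : ℝ} (hh : 0 < h) {i : ℕ} (h1 : i * h ≤ l) (h2 : l < i * h + h) : ⌊l / h⌋₊ = i := by
  have : 0 ≤ l := le_trans (by positivity) h1
  rw [Nat.floor_eq_iff (by positivity)]
  rw [le_div_iff₀ hh, div_lt_iff₀ hh]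
  exact ⟨h1, by linarith⟩

lemma riem_eq (φ : ℝ → ℝ) {h : ℝ} (hh : 0 < h) (n : ℕ) :
    IntegrableOn (fun l => φ (⌊l / h⌋₊ * h)) (Ioc 0 (n * h)) ∧ ∫ l in Ioc 0 (n * h), φ (⌊l / h⌋₊ * h) = ∑ i ∈ Finset.range n, h * φ (i * h) := by
  have ae : ∀ i : ℕ, (fun l => φ (⌊l / h⌋₊ * h)) =ᵐ[volume.restrict (Ioc (i * h) (i * h + h))] fun _ => φ (i * h) := by
    intro i
    have e : volume.restrict (Ioc ((i:ℝ) * h) (i * h + h)) = volume.restrict (Ico ((i:ℝ) * h) (i * h + h)) :=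
      (Measure.restrict_congr_set Ico_ae_eq_Ioc).symm
    rw [e]
    filter_upwards [ae_restrict_mem measurableSet_Ico] with l hl
    rw [floor_eq hh hl.1 hl.2]
  have io : ∀ i : ℕ, IntegrableOn (fun l => φ (⌊l / h⌋₊ * h)) (Ioc (i * h) (i * h + h)) := fun i => by
    have : IntegrableOn (fun _ : ℝ => φ (i * h)) (Ioc ((i:ℝ) * h) (i * h + h)) := integrableOn_const (by simp)
    exact this.congr (ae i).symm
  induction n with
  | zero => simp
  | succ n ih =>
    have e : ((n + 1 : ℕ) : ℝ) * h = n * h + h := by push_cast; ring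
    have hu : Ioc 0 (((n + 1 : ℕ) : ℝ) * h) = Ioc 0 (n * h) ∪ Ioc (n * h) (n * h + h) := by
      rw [e, Ioc_union_Ioc_eq_Ioc (by positivity) (by linarith)]
    have hd : Disjoint (Ioc 0 ((n:ℝ) * h)) (Ioc (n * h) (n * h + h)) := Ioc_disjoint_Ioc_of_le le_rfl
    rw [hu]
    refine ⟨ih.1.union (io n), ?_⟩
    rw [setIntegral_union hd measurableSet_Ioc ih.1 (io n), ih.2, Finset.sum_range_succ, integral_congr_ae (ae n)]
    simp [hh.le]

include S in
lemma grid_pay (hr : 0 ≤ r) (hf : BL f B L) {h : ℝ} (hh : 0 < h) {θ : Ω → ℕ} (ω : Ω) (hT : θ ω * h ≤ T) :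
    |gridV X h (disc r h g) (disc r h f) θ ω - Pay r f g X (fun ω => θ ω * h) ω| ≤ rerr r f X T h ω := by
  unfold gridV Pay
  simp only [disc]
  have e := riem_eq (fun l => Real.exp (-r * l) * f (X l ω)) hh (θ ω)
  rw [← e.2]
  have i1 : IntegrableOn (fun l => Real.exp (-r * l) * f (X l ω)) (Ioc 0 (θ ω * h)) :=
    (S.phi_cont hf.cont ω).integrableOn_Icc.mono_set Ioc_subset_Icc_self
  have e2 : ∀ a b c : ℝ, a + b - (c + a) = -(c - b) := by intros; ring
  rw [e2, abs_neg, ← integral_sub i1 e.1]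
  unfold rerr
  refine (abs_integral_le_integral_abs).trans ?_
  refine setIntegral_mono_set ?_ (ae_of_all _ fun l => abs_nonneg _) (HasSubset.Subset.eventuallyLE (Ioc_subset_Ioc_right hT))
  have hm : Measurable fun l => |Real.exp (-r * l) * f (X l ω) - Real.exp (-r * (⌊l / h⌋₊ * h)) * f (X (⌊l / h⌋₊ * h) ω)| := by
    have p := (S.phi_cont (r := r) hf.cont ω).measurable
    have q : Measurable fun l : ℝ => (⌊l / h⌋₊ : ℝ) * h :=
      (measurable_from_nat.comp (Nat.measurable_floor.comp (measurable_id.div_const h))).mul_const h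
    exact (p.sub (p.comp q)).norm
  refine Measure.integrableOn_of_bounded (M := 2 * B) (by simp) hm.aestronglyMeasurable ?_
  filter_upwards [ae_restrict_mem measurableSet_Ioc] with l hl
  rw [Real.norm_eq_abs, abs_abs]
  have eb : ∀ l ≥ 0, |Real.exp (-r * l) * f (X l ω)| ≤ B := fun l hl => by
    rw [abs_mul, abs_of_pos (Real.exp_pos _)]
    have := exp_disc_le hr hl
    have := hf.bd (X l ω)
    have := Real.exp_pos (-r * l)
    nlinarith [abs_nonneg (f (X l ω))]
  refine (abs_sub _ _).trans ?_
  linarith [eb l hl.1.le, eb (⌊l / h⌋₊ * h) (by positivity)]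

include S in
lemma rerr_tendsto (hr : 0 ≤ r) (hf : BL f B L) {h : ℕ → ℝ} (hh : ∀ n, 0 < h n) (ht : Tendsto h atTop (𝓝 0)) :
    (∀ n, Integrable (rerr r f X T (h n)) μ) ∧ Tendsto (fun n => ∫ ω, rerr r f X T (h n) ω ∂μ) atTop (𝓝 0) := by
  have eb : ∀ ω, ∀ l ≥ 0, |Real.exp (-r * l) * f (X l ω)| ≤ B := fun ω l hl => by
    rw [abs_mul, abs_of_pos (Real.exp_pos _)]
    have := exp_disc_le hr hl
    have := hf.bd (X l ω)
    have := Real.exp_pos (-r * l)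
    nlinarith [abs_nonneg (f (X l ω))]
  set Φ : ℕ → Ω × ℝ → ℝ := fun n q => |Real.exp (-r * q.2) * f (X q.2 q.1) - Real.exp (-r * (⌊q.2 / h n⌋₊ * h n)) * f (X (⌊q.2 / h n⌋₊ * h n) q.1)| with hΦ
  set ν := μ.prod (volume.restrict (Ioc 0 T)) with hν
  have hm : ∀ n, Measurable (Φ n) := fun n => by
    have p := S.phi_meas (r := r) hf.cont.measurable
    have q : Measurable fun q : Ω × ℝ => (⌊q.2 / h n⌋₊ : ℝ) * h n :=
      (measurable_from_nat.comp (Nat.measurable_floor.comp (measurable_snd.div_const (h n)))).mul_const (h n)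
    exact ((p.comp measurable_swap).sub (p.comp (q.prodMk measurable_fst))).norm
  have hmem : ∀ᵐ q ∂ν, q.2 ∈ Ioc 0 T := by
    have : ∀ᵐ l ∂(volume.restrict (Ioc 0 T)), l ∈ Ioc 0 T := ae_restrict_mem measurableSet_Ioc
    exact Measure.quasiMeasurePreserving_snd.ae this
  have hb : ∀ n, ∀ᵐ q ∂ν, ‖Φ n q‖ ≤ 2 * B := fun n => by
    filter_upwards [hmem] with q hq
    rw [Real.norm_eq_abs, abs_abs]
    refine (abs_sub _ _).trans ?_
    have := (hh n).le
    linarith [eb q.1 q.2 hq.1.le, eb q.1 (⌊q.2 / h n⌋₊ * h n) (by positivity)]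
  have hi : ∀ n, Integrable (Φ n) ν := fun n => Integrable.of_bound (hm n).aestronglyMeasurable (2 * B) (hb n)
  refine ⟨fun n => (hi n).integral_prod_left, ?_⟩
  have e : ∀ n, ∫ ω, rerr r f X T (h n) ω ∂μ = ∫ q, Φ n q ∂ν := fun n => by
    rw [hν, integral_prod _ (hi n)]; rfl
  simp_rw [e]
  have := tendsto_integral_of_dominated_convergence (μ := ν) (F := Φ) (f := fun _ => 0) (fun _ => 2 * B)
    (fun n => (hm n).aestronglyMeasurable) (integrable_const _) hb ?_
  · simpa using this
  · filter_upwards [hmem] with q hq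
    have t := floor_tendsto hh ht hq.1.le
    have c := ((S.phi_cont (r := r) hf.cont q.1).tendsto q.2).comp t
    have := (c.const_sub (Real.exp (-r * q.2) * f (X q.2 q.1))).abs
    simpa [Function.comp_def, hΦ] using this

include S in
lemma pay_tendsto (hr : 0 ≤ r) (hf : BL f B L) (hg : BL g B L) {ρ : Ω → ℝ} (hρ : Measurable ρ) (h0 : ∀ ω, 0 ≤ ρ ω) 
    {ρn : ℕ → Ω → ℝ} (hρn : ∀ n, Measurable (ρn n)) (h0n : ∀ n ω, 0 ≤ ρn n ω) (hT : ∀ n ω, ρn n ω ≤ T)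
    (ht : ∀ ω, Tendsto (fun n => ρn n ω) atTop (𝓝 (ρ ω))) :
    Tendsto (fun n => ∫ ω, Pay r f g X (ρn n) ω ∂μ) atTop (𝓝 (∫ ω, Pay r f g X ρ ω ∂μ)) := by
  refine tendsto_integral_of_dominated_convergence (fun _ => B + T * B) (fun n => (S.pay_meas hf.cont.measurable hg.cont.measurable (hρn n)).aestronglyMeasurable)
    (integrable_const _) (fun n => ae_of_all _ fun ω => S.pay_bd hr hf.cont hf.bd hg.bd (h0n n) (hT n) ω) (ae_of_all _ fun ω => ?_)
  unfold Pay
  refine Tendsto.add ?_ (((S.phi_cont (r := r) hg.cont ω).tendsto _).comp (ht ω))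
  have cp : Continuous fun b => ∫ l in (0:ℝ)..b, Real.exp (-r * l) * f (X l ω) :=
    intervalIntegral.continuous_primitive (fun a b => (S.phi_cont hf.cont ω).intervalIntegrable a b) 0
  have := (cp.tendsto (ρ ω)).comp (ht ω)
  rw [intervalIntegral.integral_of_le (h0 ω)] at this
  refine this.congr fun n => ?_
  simp only [Function.comp]
  rw [intervalIntegral.integral_of_le (h0n n ω)]
end Sol
end


set_option linter.unusedSectionVars false

section
variable {Ω : Type*} {mΩ : MeasurableSpace Ω} {μ : Measure Ω} [IsProbabilityMeasure μ] {ℱ : Filtration ℝ mΩ}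
  {k : ℕ} {c : Coef k} {x : EE k} {X M : ℝ → Ω → EE k} {T : ℝ} {f g : EE k → ℝ} {B L r : ℝ}

/-- grid mesh -/
noncomputable def msh (T : ℝ) (n : ℕ) : ℝ := T / ((n + 1 : ℕ) : ℝ)

lemma msh_pos (hT : 0 < T) (n : ℕ) : 0 < msh T n := by unfold msh; positivity

lemma msh_mul (T : ℝ) (n : ℕ) : ((n + 1 : ℕ) : ℝ) * msh T n = T := by
  unfold msh; field_simp

lemma msh_tendsto (T : ℝ) : Tendsto (msh T) atTop (𝓝 0) := by
  unfold msh
  exact (tendsto_const_div_atTop_nhds_zero_nat T).comp (tendsto_add_atTop_nat 1)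

namespace Sol
variable (S : Sol c μ ℱ x X M)

include S in
lemma pay_int (hr : 0 ≤ r) (hf : Continuous f) (hg : Continuous g) (hfb : ∀ y, |f y| ≤ B) (hgb : ∀ y, |g y| ≤ B) {ρ : Ω → ℝ} (hρ : BST ℱ T ρ) :
    Integrable (Pay r f g X ρ) μ :=
  bint (S.pay_meas hf.measurable hg.measurable hρ.mea).aestronglyMeasurable _ (S.pay_bd hr hf hfb hgb hρ.nn hρ.le)

include S in
lemma pay_upper (hT : 0 < T) (hf : BL f B L) (hg : BL g B L) (hr : 0 ≤ r) {δ η : ℝ} (hδ : 0 < δ) (hη : 0 < η) {ρ : Ω → ℝ} (hρ : BST ℱ T ρ) :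
    ∀ᶠ n in atTop, ∫ ω, Pay r f g X ρ ω ∂μ ≤
      c.Wp (msh T n) δ (fun i => disc r (msh T n) f (n + 1 - i)) (fun i => disc r (msh T n) g (n + 1 - i)) (n + 1) x
        + (2 * Lam c L T + T * Lam c L T) * δ + η := by
  obtain ⟨h0, hh0, H⟩ := S.grid_upper hT.le hf hg hr hδ (by positivity : 0 < η / 3)
  obtain ⟨ri, rt⟩ := S.rerr_tendsto (T := T) hr hf (msh_pos hT) (msh_tendsto T)
  set ρn : ℕ → Ω → ℝ := fun n ω => (⌈ρ ω / msh T n⌉₊ : ℝ) * msh T n with hρn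
  have hle : ∀ n ω, ⌈ρ ω / msh T n⌉₊ ≤ n + 1 := fun n ω => by
    rw [Nat.ceil_le, div_le_iff₀ (msh_pos hT n), msh_mul]; exact hρ.le ω
  have hleT : ∀ n ω, ρn n ω ≤ T := fun n ω => by
    calc _ ≤ ((n + 1 : ℕ) : ℝ) * msh T n := mul_le_mul_of_nonneg_right (by exact_mod_cast hle n ω) (msh_pos hT n).le
      _ = T := msh_mul T n
  have hnn : ∀ n ω, 0 ≤ ρn n ω := fun n ω => mul_nonneg (Nat.cast_nonneg _) (msh_pos hT n).le
  have cm : ∀ n, Measurable fun ω => ⌈ρ ω / msh T n⌉₊ := fun n => Nat.measurable_ceil.comp (hρ.mea.div_const _)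
  have hm : ∀ n, Measurable (ρn n) := fun n => (measurable_from_nat.comp (cm n)).mul_const _
  have pt := S.pay_tendsto hr hf hg hρ.mea hρ.nn hm hnn hleT (fun ω => ceil_tendsto (msh_pos hT) (msh_tendsto T) (hρ.nn ω))
  filter_upwards [(msh_tendsto T).eventually_lt_const hh0, rt.eventually_lt_const (by positivity : 0 < η / 3),
    pt.eventually_const_lt (by linarith : ∫ ω, Pay r f g X ρ ω ∂μ - η / 3 < _)] with n h1 h2 h3
  have hmesh := (msh_mul T n).le
  have hst : ∀ i : ℕ, MeasurableSet[ℱ (i * msh T n)] {ω | i < ⌈ρ ω / msh T n⌉₊} := fun i => by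
    have hs : 0 ≤ (i : ℝ) * msh T n := mul_nonneg (Nat.cast_nonneg _) (msh_pos hT n).le
    have := (hρ.meas (i * msh T n)).compl
    rw [max_eq_left hs] at this
    convert this using 1
    ext ω
    simp only [mem_ofPred_eq, mem_compl_iff, not_le, Nat.lt_ceil, lt_div_iff₀ (msh_pos hT n)]
  have key := H (msh T n) (msh_pos hT n) h1 (n + 1) hmesh (fun ω => ⌈ρ ω / msh T n⌉₊) (hle n) hst
  have gi := S.grid_int (T := T) (r := r) (msh_pos hT n) hmesh hf hg hr (hle n) (cm n)
  have pi := bint (μ := μ) (S.pay_meas (r := r) hf.cont.measurable hg.cont.measurable (hm n)).aestronglyMeasurable _ (S.pay_bd hr hf.cont hf.bd hg.bd (hnn n) (hleT n))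
  have cmp : ∫ ω, Pay r f g X (ρn n) ω ∂μ ≤ ∫ ω, gridV X (msh T n) (disc r (msh T n) g) (disc r (msh T n) f) (fun ω => ⌈ρ ω / msh T n⌉₊) ω ∂μ
      + ∫ ω, rerr r f X T (msh T n) ω ∂μ := by
    rw [← integral_add gi (ri n)]
    refine integral_mono pi (gi.add (ri n)) fun ω => ?_
    have := S.grid_pay (g := g) hr hf (msh_pos hT n) (θ := fun ω => ⌈ρ ω / msh T n⌉₊) ω (hleT n ω)
    have := (abs_le.mp this).1
    simp only [Pi.add_apply]
    linarith
  linarith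

include S in
lemma pay_lower (hT : 0 < T) (hf : BL f B L) (hg : BL g B L) (hr : 0 ≤ r) {δ η : ℝ} (hδ : 0 < δ) (hη : 0 < η) :
    ∀ᶠ n in atTop, ∃ ρ, BST ℱ T ρ ∧ 
      c.Wm (msh T n) δ (fun i => disc r (msh T n) f (n + 1 - i)) (fun i => disc r (msh T n) g (n + 1 - i)) (n + 1) x
        ≤ ∫ ω, Pay r f g X ρ ω ∂μ + (4 * Lam c L T + T * Lam c L T) * δ + η := by
  obtain ⟨h0, hh0, H⟩ := S.grid_lower hT.le hf hg hr hδ (by positivity : 0 < η / 2)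
  obtain ⟨ri, rt⟩ := S.rerr_tendsto (T := T) hr hf (msh_pos hT) (msh_tendsto T)
  filter_upwards [(msh_tendsto T).eventually_lt_const hh0, rt.eventually_lt_const (by positivity : 0 < η / 2)] with n h1 h2
  have hmesh := (msh_mul T n).le
  have hp := msh_pos hT n
  obtain ⟨θ, hle, hst, hz, key⟩ := H (msh T n) hp h1 (n + 1) hmesh
  have hleT : ∀ ω, θ ω * msh T n ≤ T := fun ω => by
    calc _ ≤ ((n + 1 : ℕ) : ℝ) * msh T n := mul_le_mul_of_nonneg_right (by exact_mod_cast hle ω) (msh_pos hT n).le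
      _ = T := msh_mul T n
  have hρ : BST ℱ T (fun ω => θ ω * msh T n) := by
    refine ⟨fun ω => mul_nonneg (Nat.cast_nonneg _) hp.le, hleT, fun t => ?_⟩
    rcases le_or_gt 0 t with ht | ht
    · rw [max_eq_left ht]
      have e : {ω | (θ ω : ℝ) * msh T n ≤ t} = {ω | ⌊t / msh T n⌋₊ < θ ω}ᶜ := by
        ext ω
        simp only [mem_ofPred_eq, mem_compl_iff, not_lt]
        rw [Nat.le_floor_iff (by positivity), le_div_iff₀ hp]
      rw [e]
      have hf := Nat.floor_le (div_nonneg ht hp.le)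
      rw [le_div_iff₀ hp] at hf
      exact ℱ.mono hf _ (hst _).compl
    · rw [max_eq_right ht.le]
      have e : {ω | (θ ω : ℝ) * msh T n ≤ 0} = {ω | 0 < θ ω}ᶜ := by
        ext ω
        simp only [mem_ofPred_eq, mem_compl_iff, not_lt]
        constructor
        · intro h
          have : (θ ω : ℝ) ≤ 0 := le_of_mul_le_mul_right (by linarith) hp
          exact_mod_cast this
        · intro h
          have : θ ω = 0 := by omega
          simp [this]
      rw [e]
      refine @MeasurableSet.compl _ _ (ℱ t) ?_
      by_cases hw : ∃ ω, 0 < θ ω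
      · obtain ⟨ω, hω⟩ := hw
        have : {ω | 0 < θ ω} = univ := eq_univ_of_forall fun ω' => hz ω ω' hω
        rw [this]; exact @MeasurableSet.univ _ (ℱ t)
      · have : {ω | 0 < θ ω} = ∅ := eq_empty_of_forall_notMem fun ω' h => hw ⟨ω', h⟩
        rw [this]; exact @MeasurableSet.empty _ (ℱ t)
  refine ⟨_, hρ, ?_⟩
  have gi := S.grid_int (T := T) (r := r) hp hmesh hf hg hr hle (theta_meas hst)
  have pi := S.pay_int hr hf.cont hg.cont hf.bd hg.bd hρ
  have cmp : ∫ ω, gridV X (msh T n) (disc r (msh T n) g) (disc r (msh T n) f) θ ω ∂μ ≤ ∫ ω, Pay r f g X (fun ω => θ ω * msh T n) ω ∂μ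
      + ∫ ω, rerr r f X T (msh T n) ω ∂μ := by
    rw [← integral_add pi (ri n)]
    refine integral_mono gi (pi.add (ri n)) fun ω => ?_
    have := S.grid_pay (g := g) hr hf hp (θ := θ) ω (hleT ω)
    have := (abs_le.mp this).2
    simp only [Pi.add_apply]
    linarith
  linarith

include S in
lemma core (hT : 0 < T) (hf : BL f B L) (hg : BL g B L) (hr : 0 ≤ r) {y : EE k} {Y M' : ℝ → Ω → EE k} (S' : Sol c μ ℱ y Y M')
    {ρ : Ω → ℝ} (hρ : BST ℱ T ρ) {ε : ℝ} (hε : 0 < ε) :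
    ∃ ρ', BST ℱ T ρ' ∧ ∫ ω, Pay r f g X ρ ω ∂μ ≤ ∫ ω, Pay r f g Y ρ' ω ∂μ + Lam c L T * ‖x - y‖ + ε := by
  have hΛ0 : 0 ≤ Lam c L T := hf.L_nn.trans (Lam_ge c hf.L_nn hT.le)
  set Λ := Lam c L T with hΛ
  set δ := ε / (3 * (8 * Λ + 2 * T * Λ + 1)) with hδ
  have hδ0 : 0 < δ := by positivity
  have hδ1 : (8 * Λ + 2 * T * Λ) * δ ≤ ε / 3 := by
    calc _ ≤ (8 * Λ + 2 * T * Λ + 1) * δ := mul_le_mul_of_nonneg_right (by linarith) hδ0.le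
      _ = ε / 3 := by rw [hδ]; field_simp
  have h1 := S.pay_upper hT hf hg hr hδ0 (by positivity : 0 < ε / 3) hρ
  have h2 := S'.pay_lower hT hf hg hr hδ0 (by positivity : 0 < ε / 3)
  obtain ⟨n, h1, ⟨ρ', hρ', h2⟩, h3⟩ := (h1.and (h2.and ((msh_tendsto T).eventually_lt_const one_pos))).exists
  refine ⟨ρ', hρ', ?_⟩
  have hp := msh_pos hT n
  have h4 := Coef.Wp_Wm (c := c) hp.le h3.le hδ0.le (disc_Dat (h := msh T n) hf hg hr hp.le (n + 1)) (n + 1) x y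
  have h5 := c.Lc_le hp.le hf.L_nn (n + 1) (msh_mul T n).le
  have h6 : Real.sqrt (‖x - y‖ ^ 2 + (2 * δ) ^ 2) ≤ ‖x - y‖ + 2 * δ := by
    apply Real.sqrt_le_iff.mpr
    constructor
    · positivity
    · nlinarith [norm_nonneg (x - y)]
  have h7 : c.Lc (msh T n) L (n + 1) * Real.sqrt (‖x - y‖ ^ 2 + (2 * δ) ^ 2) ≤ Λ * (‖x - y‖ + 2 * δ) :=
    mul_le_mul h5 h6 (Real.sqrt_nonneg _) hΛ0
  rw [← hΛ] at h1 h2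
  linarith
end Sol
end


set_option linter.unusedSectionVars false

section
variable {k : ℕ}

/-- inf-convolution -/
noncomputable def infc (f : EE k → ℝ) (n : ℝ) (y : EE k) : ℝ := ⨅ z, (f z + n * ‖y - z‖)

lemma infc_bdd {f : EE k → ℝ} {A n : ℝ} (hn : 0 ≤ n) (hA : ∀ y, A ≤ f y) (y : EE k) : BddBelow (range fun z => f z + n * ‖y - z‖) := by
  refine ⟨A, ?_⟩
  rintro _ ⟨z, rfl⟩
  have := hA z
  have : 0 ≤ n * ‖y - z‖ := by positivity
  simp only; linarith

lemma infc_le {f : EE k → ℝ} {A n : ℝ} (hn : 0 ≤ n) (hA : ∀ y, A ≤ f y) (y : EE k) : infc f n y ≤ f y := by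
  refine (ciInf_le (infc_bdd hn hA y) y).trans (by simp)

lemma le_infc {f : EE k → ℝ} {A n : ℝ} (hn : 0 ≤ n) (hA : ∀ y, A ≤ f y) (y : EE k) : A ≤ infc f n y := by
  refine le_ciInf fun z => ?_
  have := hA z
  have : 0 ≤ n * ‖y - z‖ := by positivity
  linarith

lemma infc_BL {f : EE k → ℝ} {B n : ℝ} (hn : 0 ≤ n) (hf : ∀ y, |f y| ≤ B) : BL (infc f n) B n := by
  have hA : ∀ y, -B ≤ f y := fun y => (abs_le.mp (hf y)).1
  refine ⟨(abs_nonneg _).trans (hf 0), hn, fun y => abs_le.mpr ⟨le_infc hn hA y, (infc_le hn hA y).trans (abs_le.mp (hf y)).2⟩, fun y z => ?_⟩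
  suffices infc f n y - n * ‖y - z‖ ≤ infc f n z by linarith
  refine le_ciInf fun w => ?_
  have h1 : infc f n y ≤ f w + n * ‖y - w‖ := ciInf_le (infc_bdd hn hA y) w
  have h2 := mul_le_mul_of_nonneg_left (norm_sub_le_norm_sub_add_norm_sub y z w) hn
  linarith

lemma infc_approx {f : EE k → ℝ} {B : ℝ} (hc : Continuous f) (hf : ∀ y, |f y| ≤ B) (R : ℝ) {ε : ℝ} (hε : 0 < ε) :
    ∃ n0 ≥ 0, ∀ n ≥ n0, ∀ y, ‖y‖ ≤ R → f y - infc f n y ≤ ε := by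
  have hB : 0 ≤ B := (abs_nonneg _).trans (hf 0)
  have hu := (isCompact_closedBall (0 : EE k) (R + 1)).uniformContinuousOn_of_continuous hc.continuousOn
  rw [Metric.uniformContinuousOn_iff] at hu
  obtain ⟨δ, hδ, H⟩ := hu ε hε
  set d := min δ 1 with hd
  have hd0 : 0 < d := lt_min hδ one_pos
  refine ⟨2 * B / d, by positivity, fun n hn y hy => ?_⟩
  suffices f y - ε ≤ infc f n y by linarith
  refine le_ciInf fun z => ?_
  have hn0 : 0 ≤ n := le_trans (by positivity) hn
  rcases lt_or_ge ‖y - z‖ d with h | h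
  · have hz : ‖z‖ ≤ R + 1 := by
      have := norm_sub_norm_le z y
      rw [norm_sub_rev] at this
      have := h.le.trans (min_le_right _ _)
      linarith
    have := H y (by simp; linarith) z (by simpa using hz) (by rw [dist_eq_norm]; exact h.trans_le (min_le_left _ _))
    rw [Real.dist_eq, abs_lt] at this
    have : 0 ≤ n * ‖y - z‖ := by positivity
    linarith
  · have h1 : 2 * B ≤ n * ‖y - z‖ := by
      rw [ge_iff_le, div_le_iff₀ hd0] at hn
      exact hn.trans (mul_le_mul_of_nonneg_left h hn0)
    have h2 := (abs_le.mp (hf y)).2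
    have h3 := (abs_le.mp (hf z)).1
    linarith

lemma BL.zero {B L : ℝ} (hB : 0 ≤ B) (hL : 0 ≤ L) : BL (fun _ : EE k => (0 : ℝ)) B L :=
  ⟨hB, hL, fun _ => by simpa using hB, fun y z => by simp; positivity⟩

end

section
variable {Ω : Type*} {mΩ : MeasurableSpace Ω} {μ : Measure Ω} [IsProbabilityMeasure μ] {ℱ : Filtration ℝ mΩ}
  {k : ℕ} {c : Coef k} {x : EE k} {X M : ℝ → Ω → EE k} {T : ℝ} {f g : EE k → ℝ} {B L r : ℝ}

lemma BST.const (hT : 0 ≤ T) : BST ℱ T (fun _ => T) :=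
  ⟨fun _ => hT, fun _ => le_rfl, fun t => by
    by_cases h : T ≤ max t 0
    · simp only [h]; exact @MeasurableSet.const _ (ℱ t) True
    · simp only [h]; exact @MeasurableSet.const _ (ℱ t) False⟩

variable (c) in
lemma moment_bl (m : ℕ) : ∃ κ : ℝ, 0 ≤ κ ∧ ∀ (x : EE k) (X M : ℝ → Ω → EE k), Sol c μ ℱ x X M → ∀ T > 0, ∀ (φ : EE k → ℝ) (B L : ℝ), BL φ B L → (∀ y, φ y ≤ (1 + ‖y‖ ^ 2) ^ m) →
    ∫ ω, φ (X T ω) ∂μ ≤ Real.exp (κ * T) * (1 + ‖x‖ ^ 2) ^ m := by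
  obtain ⟨κ, hκ, H⟩ := c.Wp_moment m
  refine ⟨κ, hκ, fun x X M S T hT φ B L hφ hm => ?_⟩
  have key : ∀ ε > 0, ∫ ω, φ (X T ω) ∂μ ≤ Real.exp (κ * T) * (1 + ‖x‖ ^ 2) ^ m + ε := fun ε hε => by
    set Λ := Lam c L T with hΛ
    have hΛ0 : 0 ≤ Λ := hφ.L_nn.trans (Lam_ge c hφ.L_nn hT.le)
    set δ := min 1 (ε / 2 / (2 * Λ + T * Λ + 1)) with hδ
    have hδ0 : 0 < δ := by rw [hδ]; positivity
    have hδ2 : (2 * Λ + T * Λ) * δ ≤ ε / 2 := by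
      have h1 : δ ≤ ε / 2 / (2 * Λ + T * Λ + 1) := min_le_right _ _
      rw [le_div_iff₀ (by positivity)] at h1
      nlinarith
    have := S.pay_upper hT (BL.zero hφ.B_nn hφ.L_nn) hφ le_rfl hδ0 (half_pos hε) (BST.const hT.le)
    obtain ⟨n, h1, h2⟩ := (this.and ((msh_tendsto T).eventually_lt_const one_pos)).exists
    have e1 : (fun i => disc 0 (msh T n) (fun _ : EE k => (0:ℝ)) (n + 1 - i)) = fun _ _ => 0 := by
      funext i y; simp [disc]
    have hp := msh_pos hT n
    have h3 := H (msh T n) δ hp.le h2.le hδ0.le (min_le_left _ _) (fun i => disc 0 (msh T n) φ (n + 1 - i))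
      (fun i y => by simpa [disc] using hm y) (n + 1) x
    rw [e1] at h1
    simp only [Pay] at h1
    simp only [neg_zero, zero_mul, mul_zero, Real.exp_zero, one_mul, integral_zero, zero_add] at h1
    have h4 : (1 + κ * msh T n) ^ (n + 1) ≤ Real.exp (κ * T) := by
      calc _ ≤ Real.exp (κ * msh T n) ^ (n + 1) := pow_le_pow_left₀ (by positivity) (by linarith [Real.add_one_le_exp (κ * msh T n)]) _
        _ = _ := by rw [← Real.exp_nat_mul, mul_left_comm, msh_mul]
    have h5 := mul_le_mul_of_nonneg_right h4 (by positivity : 0 ≤ (1 + ‖x‖ ^ 2) ^ m)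
    linarith
  exact le_of_forall_pos_le_add key

variable (c) in
lemma moment (m : ℕ) : ∃ κ : ℝ, 0 ≤ κ ∧ ∀ (x : EE k) (X M : ℝ → Ω → EE k), Sol c μ ℱ x X M → ∀ t ≥ 0, 
    Integrable (fun ω => (1 + ‖X t ω‖ ^ 2) ^ m) μ ∧ ∫ ω, (1 + ‖X t ω‖ ^ 2) ^ m ∂μ ≤ Real.exp (κ * t) * (1 + ‖x‖ ^ 2) ^ m := by
  obtain ⟨κ, hκ, H⟩ := moment_bl (μ := μ) (ℱ := ℱ) c m
  refine ⟨κ, hκ, fun x X M S t ht => ?_⟩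
  rcases ht.eq_or_lt with rfl | ht
  · simp only [S.init]
    simp
  set ψ : ℕ → EE k → ℝ := fun N y => min ((1 + ‖y‖ ^ 2) ^ m) N with hψ
  have hψc : ∀ N, Continuous (ψ N) := fun N => by simp only [hψ]; fun_prop
  have hψ0 : ∀ N y, 0 ≤ ψ N y := fun N y => le_min (by positivity) (by positivity)
  have hψb : ∀ N y, |ψ N y| ≤ N := fun N y => by rw [abs_of_nonneg (hψ0 N y)]; exact min_le_right _ _
  have hex : ∀ N : ℕ, ∃ n ≥ 0, ∀ y, ‖y‖ ≤ N → ψ N y - infc (ψ N) n y ≤ 1 / ((N : ℝ) + 1) := fun N => by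
    obtain ⟨n0, h0, h⟩ := infc_approx (hψc N) (hψb N) N (by positivity : 0 < 1 / ((N : ℝ) + 1))
    exact ⟨n0, h0, h n0 le_rfl⟩
  choose n hn hap using hex
  set φ : ℕ → EE k → ℝ := fun N => infc (ψ N) (n N) with hφ
  have hBL : ∀ N, BL (φ N) N (n N) := fun N => infc_BL (hn N) (hψb N)
  have hle : ∀ N y, φ N y ≤ ψ N y := fun N y => infc_le (hn N) (hψ0 N) y
  have h0 : ∀ N y, 0 ≤ φ N y := fun N y => le_infc (hn N) (hψ0 N) y
  have hlim : ∀ y, Tendsto (fun N => φ N y) atTop (𝓝 ((1 + ‖y‖ ^ 2) ^ m)) := fun y => by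
    have h1 : Tendsto (fun N : ℕ => (1 + ‖y‖ ^ 2) ^ m - 1 / ((N : ℝ) + 1)) atTop (𝓝 ((1 + ‖y‖ ^ 2) ^ m)) := by
      simpa using tendsto_const_nhds.sub (tendsto_one_div_add_atTop_nhds_zero_nat (𝕜 := ℝ))
    refine tendsto_of_tendsto_of_tendsto_of_le_of_le' h1 tendsto_const_nhds ?_ (Eventually.of_forall fun N => (hle N y).trans (min_le_left _ _))
    filter_upwards [eventually_ge_atTop ⌈‖y‖⌉₊, eventually_ge_atTop ⌈(1 + ‖y‖ ^ 2) ^ m⌉₊] with N a1 a2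
    have := hap N y (Nat.ceil_le.mp a1)
    have e : ψ N y = (1 + ‖y‖ ^ 2) ^ m := min_eq_left (Nat.ceil_le.mp a2)
    rw [e] at this
    linarith
  have hXm : Measurable (X t) := (S.adapted t).mono (ℱ.le t) le_rfl
  set K := Real.exp (κ * t) * (1 + ‖x‖ ^ 2) ^ m with hK
  have hK0 : 0 ≤ K := by positivity
  have hl : ∫⁻ ω, ENNReal.ofReal ((1 + ‖X t ω‖ ^ 2) ^ m) ∂μ ≤ ENNReal.ofReal K := by
    have e : ∀ ω, ENNReal.ofReal ((1 + ‖X t ω‖ ^ 2) ^ m) = liminf (fun N => ENNReal.ofReal (φ N (X t ω))) atTop := fun ω =>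
      ((ENNReal.continuous_ofReal.tendsto _).comp (hlim (X t ω))).liminf_eq.symm
    simp only [e]
    refine (lintegral_liminf_le fun N => ((hBL N).cont.measurable.comp hXm).ennreal_ofReal).trans ?_
    refine liminf_le_of_le (by isBoundedDefault) fun b hb => ?_
    obtain ⟨N, hN⟩ := hb.exists
    refine hN.trans ?_
    have hi : Integrable (fun ω => φ N (X t ω)) μ := bint ((hBL N).cont.measurable.comp hXm).aestronglyMeasurable _ fun ω => (hBL N).bd _
    change ∫⁻ ω, ENNReal.ofReal (φ N (X t ω)) ∂μ ≤ _
    rw [← ofReal_integral_eq_lintegral_ofReal hi (ae_of_all _ fun ω => h0 N _)]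
    exact ENNReal.ofReal_le_ofReal (H x X M S t ht (φ N) _ _ (hBL N) fun y => (hle N y).trans (min_le_left _ _))
  have hmeas : AEStronglyMeasurable (fun ω => (1 + ‖X t ω‖ ^ 2) ^ m) μ := by
    have : Measurable fun ω => (1 + ‖X t ω‖ ^ 2) ^ m := by fun_prop
    exact this.aestronglyMeasurable
  have hi : Integrable (fun ω => (1 + ‖X t ω‖ ^ 2) ^ m) μ := by
    refine ⟨hmeas, ?_⟩
    rw [hasFiniteIntegral_iff_ofReal (ae_of_all _ fun ω => by positivity)]
    exact hl.trans_lt ENNReal.ofReal_lt_top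
  refine ⟨hi, ?_⟩
  rw [← ENNReal.ofReal_le_ofReal_iff hK0, ofReal_integral_eq_lintegral_ofReal hi (ae_of_all _ fun ω => by positivity)]
  exact hl
end


set_option linter.unusedSectionVars false

section
variable {Ω : Type*} {mΩ : MeasurableSpace Ω} {μ : Measure Ω} [IsProbabilityMeasure μ] {ℱ : Filtration ℝ mΩ}
  {k : ℕ} {c : Coef k} {x : EE k} {X M : ℝ → Ω → EE k} {T : ℝ} {f g : EE k → ℝ} {B L r : ℝ}

lemma pay_neg (ρ : Ω → ℝ) (ω : Ω) : Pay r (fun y => -f y) (fun y => -g y) X ρ ω = -Pay r f g X ρ ω := by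
  unfold Pay
  simp only [mul_neg, integral_neg]; ring

namespace Sol
variable (S : Sol c μ ℱ x X M)

include S in
lemma pay_diff (hr : 0 ≤ r) {f' g' : EE k → ℝ} (hf : Continuous f) (hf' : Continuous f') {ρ : Ω → ℝ} {ω : Ω}
    (h0 : 0 ≤ ρ ω) (hT : ρ ω ≤ T) {D : ℝ} (hD : 0 ≤ D) (h1 : ∀ l ∈ Icc 0 T, f (X l ω) ≤ f' (X l ω) + D) (h2 : ∀ l ∈ Icc 0 T, g (X l ω) ≤ g' (X l ω) + D) :
    Pay r f g X ρ ω ≤ Pay r f' g' X ρ ω + (T + 1) * D := by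
  unfold Pay
  have i1 : IntegrableOn (fun l => Real.exp (-r * l) * f (X l ω)) (Ioc 0 (ρ ω)) := ((S.phi_cont hf ω).integrableOn_Icc (a := 0) (b := ρ ω)).mono_set Ioc_subset_Icc_self
  have i2 : IntegrableOn (fun l => Real.exp (-r * l) * f' (X l ω)) (Ioc 0 (ρ ω)) := ((S.phi_cont hf' ω).integrableOn_Icc (a := 0) (b := ρ ω)).mono_set Ioc_subset_Icc_self
  have ic : IntegrableOn (fun _ : ℝ => D) (Ioc 0 (ρ ω)) := by simp
  have e1 : ∀ l ≥ 0, ∀ u v, u ≤ v + D → Real.exp (-r * l) * u ≤ Real.exp (-r * l) * v + D := fun l hl u v huv => by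
    have := exp_disc_le hr hl
    have := Real.exp_pos (-r * l)
    nlinarith
  have a1 : ∫ l in Ioc 0 (ρ ω), Real.exp (-r * l) * f (X l ω) ≤ (∫ l in Ioc 0 (ρ ω), Real.exp (-r * l) * f' (X l ω)) + ρ ω * D := by
    have : ∫ l in Ioc 0 (ρ ω), D = ρ ω * D := by simp [h0]
    rw [← this, ← integral_add i2 ic]
    exact setIntegral_mono_on i1 (i2.add ic) measurableSet_Ioc fun l hl => e1 l hl.1.le _ _ (h1 l ⟨hl.1.le, hl.2.trans hT⟩)
  have a2 := e1 (ρ ω) h0 _ _ (h2 _ ⟨h0, hT⟩)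
  have := mul_le_mul_of_nonneg_right hT hD
  linarith

include S in
lemma gap (hT : 0 < T) (hr : 0 ≤ r) (hf : Continuous f) (hg : Continuous g) (hfb : ∀ y, |f y| ≤ B) (hgb : ∀ y, |g y| ≤ B) {ε : ℝ} (hε : 0 < ε) :
    ∃ L f' g', BL f' B L ∧ BL g' B L ∧ (∀ y, f' y ≤ f y) ∧ (∀ y, g' y ≤ g y) ∧ ∀ ρ, BST ℱ T ρ → ∫ ω, Pay r f g X ρ ω ∂μ ≤ ∫ ω, Pay r f' g' X ρ ω ∂μ + ε := by
  have hB : 0 ≤ B := (abs_nonneg _).trans (hfb 0)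
  set η := ε / 2 / (T + 1) with hη
  have hη0 : 0 < η := by positivity
  obtain ⟨R, hR⟩ := hit_small (μ := μ) S.adapted S.cont hT.le (by positivity : 0 < ε / 2 / ((T + 1) * (2 * B) + 1))
  replace hR := hR R le_rfl
  obtain ⟨n1, p1, q1⟩ := infc_approx hf hfb R hη0
  obtain ⟨n2, p2, q2⟩ := infc_approx hg hgb R hη0
  set n := max n1 n2 with hn
  have hn0 : 0 ≤ n := p1.trans (le_max_left _ _)
  have lf := infc_BL (n := n) hn0 hfb
  have lg := infc_BL (n := n) hn0 hgb
  refine ⟨n, infc f n, infc g n, lf, lg, infc_le hn0 fun y => (abs_le.mp (hfb y)).1, infc_le hn0 fun y => (abs_le.mp (hgb y)).1, fun ρ hρ => ?_⟩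
  set E := {ω | ∃ u ∈ Icc 0 T, R ≤ ‖X u ω‖} with hE
  have hEm : MeasurableSet E := ℱ.le T _ (hit_meas S.adapted S.cont hT.le R)
  have pt : ∀ ω, Pay r f g X ρ ω ≤ Pay r (infc f n) (infc g n) X ρ ω + (ε / 2 + E.indicator (fun _ => (T + 1) * (2 * B)) ω) := fun ω => by
    by_cases hω : ω ∈ E
    · rw [indicator_of_mem hω]
      have gen : ∀ (f f' : EE k → ℝ), (∀ y, |f y| ≤ B) → (∀ y, |f' y| ≤ B) → ∀ l ∈ Icc 0 T, f (X l ω) ≤ f' (X l ω) + 2 * B := fun f f' a b l _ => by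
        have := (abs_le.mp (a (X l ω))).2
        have := (abs_le.mp (b (X l ω))).1
        linarith
      have := S.pay_diff hr hf lf.cont (hρ.nn ω) (hρ.le ω) (D := 2 * B) (by positivity) (gen _ _ hfb lf.bd) (gen _ _ hgb lg.bd)
      linarith
    · rw [indicator_of_notMem hω]
      have hlt : ∀ l ∈ Icc 0 T, ‖X l ω‖ ≤ R := fun l hl => by
        by_contra h
        exact hω ⟨l, hl, (not_le.mp h).le⟩
      have := S.pay_diff (g := g) (g' := infc g n) hr hf lf.cont (hρ.nn ω) (hρ.le ω) (D := η) hη0.le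
        (fun l hl => by linarith [q1 n (le_max_left _ _) _ (hlt l hl)]) (fun l hl => by linarith [q2 n (le_max_right _ _) _ (hlt l hl)])
      have e : (T + 1) * η = ε / 2 := by rw [hη]; field_simp
      linarith
  have i1 := S.pay_int hr hf hg hfb hgb hρ
  have i2 := S.pay_int hr lf.cont lg.cont lf.bd lg.bd hρ
  have ie : Integrable (E.indicator fun _ => (T + 1) * (2 * B)) μ := (integrable_const _).indicator hEm
  have := integral_mono i1 (i2.add ((integrable_const (ε / 2)).add ie)) pt
  have es : ∫ ω, (Pay r (infc f n) (infc g n) X ρ + ((fun _ : Ω => ε / 2) + E.indicator fun _ : Ω => (T + 1) * (2 * B)) : Ω → ℝ) ω ∂μ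
      = ∫ ω, Pay r (infc f n) (infc g n) X ρ ω ∂μ + (ε / 2 + μ.real E * ((T + 1) * (2 * B))) := by
    rw [integral_add' i2 ((integrable_const _).add ie), integral_add' (integrable_const _) ie,
      integral_indicator_const _ hEm, integral_const, probReal_univ, one_smul, smul_eq_mul]
  rw [es] at this
  have h3 : μ.real E * ((T + 1) * (2 * B)) ≤ ε / 2 := by
    rw [le_div_iff₀ (by positivity)] at hR
    have : 0 ≤ μ.real E := measureReal_nonneg
    nlinarith
  linarith

include S in
lemma bdd_rel (hT : 0 < T) (hr : 0 ≤ r) (hf : Continuous f) (hg : Continuous g) (hfb : ∀ y, |f y| ≤ B) (hgb : ∀ y, |g y| ≤ B) {ε : ℝ} (hε : 0 < ε) :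
    ∃ δ > 0, ∀ (y : EE k) (Y M' : ℝ → Ω → EE k), Sol c μ ℱ y Y M' → ‖y - x‖ < δ → ∀ ρ, BST ℱ T ρ →
      (∃ ρ', BST ℱ T ρ' ∧ ∫ ω, Pay r f g X ρ ω ∂μ ≤ ∫ ω, Pay r f g Y ρ' ω ∂μ + ε) ∧
      (∃ ρ', BST ℱ T ρ' ∧ ∫ ω, Pay r f g Y ρ ω ∂μ ≤ ∫ ω, Pay r f g X ρ' ω ∂μ + ε) := by
  have e3 : 0 < ε / 3 := by positivity
  obtain ⟨L1, f1, g1, lf1, lg1, mf1, mg1, G1⟩ := S.gap hT hr hf hg hfb hgb e3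
  obtain ⟨L2, f2, g2, lf2, lg2, mf2, mg2, G2⟩ := S.gap (f := fun y => -f y) (g := fun y => -g y) hT hr hf.neg hg.neg (fun y => by rw [abs_neg]; exact hfb y) (fun y => by rw [abs_neg]; exact hgb y) e3
  have negBL : ∀ {u : EE k → ℝ}, BL u B L2 → BL (fun y => - u y) B L2 := fun {u} h =>
    ⟨h.B_nn, h.L_nn, fun y => by rw [abs_neg]; exact h.bd y, fun y z => by have := h.lip z y; rw [norm_sub_rev] at this; linarith⟩
  have kf2 := negBL lf2
  have kg2 := negBL lg2
  set Λ := Lam c L1 T + Lam c L2 T with hΛ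
  have hL1 : 0 ≤ Lam c L1 T := lf1.L_nn.trans (Lam_ge c lf1.L_nn hT.le)
  have hL2 : 0 ≤ Lam c L2 T := lf2.L_nn.trans (Lam_ge c lf2.L_nn hT.le)
  refine ⟨ε / 3 / (Λ + 1), by positivity, fun y Y M' S' hy ρ hρ => ?_⟩
  rw [lt_div_iff₀ (by positivity)] at hy
  have n0 := norm_nonneg (y - x)
  have b1 : Lam c L1 T * ‖x - y‖ ≤ ε / 3 := by rw [norm_sub_rev]; nlinarith
  have b2 : Lam c L2 T * ‖y - x‖ ≤ ε / 3 := by nlinarith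
  constructor
  · obtain ⟨ρ', hρ', h⟩ := S.core hT lf1 lg1 hr S' hρ e3
    refine ⟨ρ', hρ', ?_⟩
    have a1 := G1 ρ hρ
    have a2 : ∫ ω, Pay r f1 g1 Y ρ' ω ∂μ ≤ ∫ ω, Pay r f g Y ρ' ω ∂μ := by
      refine integral_mono (S'.pay_int hr lf1.cont lg1.cont lf1.bd lg1.bd hρ') (S'.pay_int hr hf hg hfb hgb hρ') fun ω => ?_
      have := S'.pay_diff (g := g1) (g' := g) hr lf1.cont hf (hρ'.nn ω) (hρ'.le ω) le_rfl (fun l _ => by simpa using mf1 _) (fun l _ => by simpa using mg1 _)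
      simpa using this
    linarith
  · obtain ⟨ρ', hρ', h⟩ := S'.core hT kf2 kg2 hr S hρ e3
    refine ⟨ρ', hρ', ?_⟩
    have a1 := G2 ρ' hρ'
    simp only [pay_neg, integral_neg] at a1 h
    have a2 : ∫ ω, Pay r f g Y ρ ω ∂μ ≤ ∫ ω, Pay r (fun y => -f2 y) (fun y => -g2 y) Y ρ ω ∂μ := by
      refine integral_mono (S'.pay_int hr hf hg hfb hgb hρ) (S'.pay_int hr kf2.cont kg2.cont kf2.bd kg2.bd hρ) fun ω => ?_
      have := S'.pay_diff (g := g) (g' := fun y => -g2 y) hr hf kf2.cont (hρ.nn ω) (hρ.le ω) le_rfl (fun l _ => by linarith [mf2 (Y l ω)]) (fun l _ => by linarith [mg2 (Y l ω)])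
      simpa using this
    simp only [pay_neg, integral_neg] at a2
    linarith
end Sol
end


set_option linter.unusedSectionVars false

/-- truncation -/
noncomputable def clp {k : ℕ} (N : ℝ) (f : EE k → ℝ) (y : EE k) : ℝ := max (-N) (min (f y) N)

section
variable {Ω : Type*} {mΩ : MeasurableSpace Ω} {μ : Measure Ω} [IsProbabilityMeasure μ] {ℱ : Filtration ℝ mΩ}
  {k : ℕ} {c : Coef k} {x : EE k} {X M : ℝ → Ω → EE k} {T : ℝ} {f g : EE k → ℝ} {B L r : ℝ}

lemma clp_cont (N : ℝ) (hf : Continuous f) : Continuous (clp N f) := by unfold clp; fun_prop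

lemma clp_bd {N : ℝ} (hN : 0 < N) (y : EE k) : |clp N f y| ≤ N := by
  unfold clp
  exact abs_le.mpr ⟨le_max_left _ _, max_le (by linarith) (min_le_right _ _)⟩

lemma clp_err {N : ℝ} (hN : 0 < N) (y : EE k) : |f y - clp N f y| ≤ f y ^ 2 / N := by
  unfold clp
  rw [le_div_iff₀ hN]
  rcases le_total (f y) N with h | h
  · rw [min_eq_left h]
    rcases le_total (-N) (f y) with h' | h'
    · rw [max_eq_right h']; simp; positivity
    · rw [max_eq_left h', abs_of_nonpos (by linarith)]; nlinarith
  · rw [min_eq_right h, max_eq_right (by linarith), abs_of_nonneg (by linarith)]; nlinarith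

namespace Sol
variable (S : Sol c μ ℱ x X M)

include S in
lemma fub {s : Set ℝ} (hs : MeasurableSet s) {w : ℝ → ℝ} (hw : Continuous w) (hw0 : ∀ l, 0 ≤ w l) {ψ : EE k → ℝ} (hψ : Continuous ψ) (hψ0 : ∀ y, 0 ≤ ψ y)
    {G : ℝ → ℝ} (hG : IntegrableOn G s) (hi : ∀ l ∈ s, Integrable (fun ω => ψ (X l ω)) μ) (hb : ∀ l ∈ s, w l * ∫ ω, ψ (X l ω) ∂μ ≤ G l) :
    Integrable (fun ω => ∫ l in s, w l * ψ (X l ω)) μ ∧ ∫ ω, (∫ l in s, w l * ψ (X l ω)) ∂μ ≤ ∫ l in s, G l := by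
  set F : ℝ × Ω → ℝ := fun q => w q.1 * ψ (X q.1 q.2) with hF
  have hFm : Measurable F := (hw.measurable.comp measurable_fst).mul (hψ.measurable.comp S.unc)
  have hF0 : ∀ q, ‖F q‖ = F q := fun q => by rw [Real.norm_eq_abs, abs_of_nonneg (mul_nonneg (hw0 _) (hψ0 _))]
  have hIm : Measurable fun l => ∫ ω, F (l, ω) ∂μ := (hFm.stronglyMeasurable.integral_prod_right' (ν := μ)).measurable
  have hle : ∀ l ∈ s, ∫ ω, F (l, ω) ∂μ ≤ G l := fun l hl => by
    simp only [hF]; rw [integral_const_mul]; exact hb l hl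
  have hI : IntegrableOn (fun l => ∫ ω, F (l, ω) ∂μ) s := by
    refine Integrable.mono' hG hIm.aestronglyMeasurable ((ae_restrict_iff' hs).mpr (ae_of_all _ fun l hl => ?_))
    rw [Real.norm_eq_abs, abs_of_nonneg (integral_nonneg fun ω => mul_nonneg (hw0 _) (hψ0 _))]
    exact hle l hl
  have hFi : Integrable F ((volume.restrict s).prod μ) := by
    rw [integrable_prod_iff hFm.aestronglyMeasurable]
    refine ⟨(ae_restrict_iff' hs).mpr (ae_of_all _ fun l hl => (hi l hl).const_mul (w l)), ?_⟩
    simp only [hF0]; exact hI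
  refine ⟨hFi.integral_prod_right, ?_⟩
  have sw := integral_integral_swap (f := fun l ω => F (l, ω)) (μ := volume.restrict s) (ν := μ) hFi
  calc _ = ∫ l in s, ∫ ω, F (l, ω) ∂μ := sw.symm
    _ ≤ _ := setIntegral_mono_on hI hG hs hle

include S in
lemma pay_abs (hr : 0 ≤ r) {f' : EE k → ℝ} (hf : Continuous f) (hf' : Continuous f') {ρ : Ω → ℝ} {ω : Ω}
    (hT : ρ ω ≤ T) : |Pay r f g X ρ ω - Pay r f' g X ρ ω| ≤ ∫ l in Ioc 0 T, 1 * |f (X l ω) - f' (X l ω)| := by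
  unfold Pay
  have i1 : IntegrableOn (fun l => Real.exp (-r * l) * f (X l ω)) (Ioc 0 (ρ ω)) := ((S.phi_cont hf ω).integrableOn_Icc (a := 0) (b := ρ ω)).mono_set Ioc_subset_Icc_self
  have i2 : IntegrableOn (fun l => Real.exp (-r * l) * f' (X l ω)) (Ioc 0 (ρ ω)) := ((S.phi_cont hf' ω).integrableOn_Icc (a := 0) (b := ρ ω)).mono_set Ioc_subset_Icc_self
  have cc : Continuous fun l => 1 * |f (X l ω) - f' (X l ω)| := by have := S.cont ω; fun_prop
  have i3 : IntegrableOn (fun l => 1 * |f (X l ω) - f' (X l ω)|) (Ioc 0 T) := (cc.integrableOn_Icc (a := 0) (b := T)).mono_set Ioc_subset_Icc_self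
  rw [add_sub_add_right_eq_sub, ← integral_sub i1 i2]
  refine (abs_integral_le_integral_abs).trans ?_
  refine (setIntegral_mono_on (i1.sub i2).abs (i3.mono_set (Ioc_subset_Ioc_right hT)) measurableSet_Ioc fun l hl => ?_).trans
    (setIntegral_mono_set i3 (ae_of_all _ fun l => by simp) (Ioc_subset_Ioc_right hT).eventuallyLE)
  simp only [Pi.sub_apply]
  rw [← mul_sub, abs_mul, abs_of_pos (Real.exp_pos _)]
  exact mul_le_mul_of_nonneg_right (exp_disc_le hr hl.1.le) (abs_nonneg _)
end Sol

variable (c) in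
lemma trunc {K : ℝ} {m : ℕ} (hr : 0 ≤ r) (hf : Continuous f) (hg : Continuous g) (hgb : ∀ y, |g y| ≤ B) (hK : ∀ y, f y ^ 2 ≤ K * (1 + ‖y‖ ^ 2) ^ m) :
    ∃ κ ≥ 0, ∀ (x : EE k) (X M : ℝ → Ω → EE k), Sol c μ ℱ x X M → ∀ T > 0, ∀ ρ, BST ℱ T ρ → ∀ N > 0, 
      Integrable (Pay r f g X ρ) μ ∧ |∫ ω, Pay r f g X ρ ω ∂μ - ∫ ω, Pay r (clp N f) g X ρ ω ∂μ| ≤ T * (K / N * (Real.exp (κ * T) * (1 + ‖x‖ ^ 2) ^ m)) := by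
  obtain ⟨κ, hκ, H⟩ := moment (μ := μ) (ℱ := ℱ) c m
  refine ⟨κ, hκ, fun x X M S T hT ρ hρ N hN => ?_⟩
  have hK0 : 0 ≤ K := by
    have := (sq_nonneg _).trans (hK 0)
    simpa using this
  have hcc := clp_cont N hf
  have hbd : ∀ y, |f y - clp N f y| ≤ K / N * (1 + ‖y‖ ^ 2) ^ m := fun y => by
    refine (clp_err hN y).trans ?_
    rw [div_mul_eq_mul_div]
    exact div_le_div_of_nonneg_right (hK y) hN.le
  have hii : ∀ l ∈ Ioc 0 T, Integrable (fun ω => |f (X l ω) - clp N f (X l ω)|) μ := fun l hl => by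
    have hXm : Measurable (X l) := (S.adapted l).mono (ℱ.le l) le_rfl
    refine Integrable.mono' ((H x X M S l hl.1.le).1.const_mul (K / N)) ?_ (ae_of_all _ fun ω => ?_)
    · have : Measurable fun ω => |f (X l ω) - clp N f (X l ω)| := by
        have h1 := hf.measurable; have h2 := hcc.measurable; fun_prop
      exact this.aestronglyMeasurable
    · rw [Real.norm_eq_abs, abs_abs]; exact hbd _
  obtain ⟨fi, fb⟩ := S.fub (s := Ioc 0 T) measurableSet_Ioc (w := fun _ => 1) continuous_const (fun _ => zero_le_one)
    (ψ := fun y => |f y - clp N f y|) (by fun_prop) (fun _ => abs_nonneg _)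
    (G := fun _ => K / N * (Real.exp (κ * T) * (1 + ‖x‖ ^ 2) ^ m)) (integrable_const _) hii (fun l hl => by
      rw [one_mul]
      obtain ⟨m1, m2⟩ := H x X M S l hl.1.le
      calc _ ≤ ∫ ω, K / N * (1 + ‖X l ω‖ ^ 2) ^ m ∂μ := integral_mono (hii l hl) (m1.const_mul _) fun ω => hbd _
        _ ≤ _ := by
          rw [integral_const_mul]
          refine mul_le_mul_of_nonneg_left (m2.trans ?_) (by positivity)
          refine mul_le_mul_of_nonneg_right (Real.exp_le_exp.mpr ?_) (by positivity)
          exact mul_le_mul_of_nonneg_left hl.2 hκ)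
  have pa : ∀ ω, |Pay r f g X ρ ω - Pay r (clp N f) g X ρ ω| ≤ ∫ l in Ioc 0 T, 1 * |f (X l ω) - clp N f (X l ω)| := fun ω => S.pay_abs hr hf hcc (hρ.le ω)
  have ic : Integrable (Pay r (clp N f) g X ρ) μ := S.pay_int (B := max N B) hr hcc hg (fun y => (clp_bd hN y).trans (le_max_left _ _)) (fun y => (hgb y).trans (le_max_right _ _)) hρ
  have ii : Integrable (Pay r f g X ρ) μ := by
    refine Integrable.mono' (ic.abs.add fi) (S.pay_meas hf.measurable hg.measurable hρ.mea).aestronglyMeasurable (ae_of_all _ fun ω => ?_)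
    have h1 := pa ω
    have h2 := abs_sub_abs_le_abs_sub (Pay r f g X ρ ω) (Pay r (clp N f) g X ρ ω)
    rw [Real.norm_eq_abs]; simp only [Pi.add_apply]; linarith
  refine ⟨ii, ?_⟩
  rw [← integral_sub ii ic]
  refine abs_integral_le_integral_abs.trans ((integral_mono (ii.sub ic).abs fi pa).trans (fb.trans ?_))
  simp [hT.le]
end


open scoped ENNReal
set_option linter.unusedSectionVars false

section
variable {Ω : Type*} {mΩ : MeasurableSpace Ω} {μ : Measure Ω} [IsProbabilityMeasure μ] {ℱ : Filtration ℝ mΩ}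
  {k : ℕ} {c : Coef k} {x : EE k} {X M : ℝ → Ω → EE k} {T : ℝ} {f h : EE k → ℝ} {Ch L r : ℝ}

/-- payoff of the stopping problem -/
noncomputable def JJ (r : ℝ) (f h : EE k → ℝ) (X : ℝ → Ω → EE k) (τ : Ω → ℝ≥0∞) (ω : Ω) : ℝ :=
  (∫ l in {l : ℝ | 0 ≤ l ∧ ENNReal.ofReal l < τ ω}, Real.exp (-r * l) * f (X l ω)) +
    (if τ ω = ⊤ then 0 else Real.exp (-r * (τ ω).toReal) * h (X (τ ω).toReal ω))

/-- truncated stopping time -/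
noncomputable def cut (T : ℝ) (τ : Ω → ℝ≥0∞) (ω : Ω) : ℝ := (min (τ ω) (ENNReal.ofReal T)).toReal

lemma ofReal_max (t : ℝ) : ENNReal.ofReal t = ENNReal.ofReal (max t 0) := by
  rcases le_total t 0 with h | h
  · rw [max_eq_right h, ENNReal.ofReal_of_nonpos h, ENNReal.ofReal_zero]
  · rw [max_eq_left h]

lemma cut_BST {τ : Ω → ℝ≥0∞} (hT : 0 ≤ T) (hτ : IsStoppingTimeENN ℱ τ) : BST ℱ T (cut T τ) := by
  refine ⟨fun ω => ENNReal.toReal_nonneg, fun ω => ?_, fun t => ?_⟩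
  · exact ENNReal.toReal_le_of_le_ofReal hT (min_le_right _ _)
  · have e : ∀ ω, cut T τ ω ≤ max t 0 ↔ (τ ω ≤ ENNReal.ofReal t ∨ T ≤ max t 0) := fun ω => by
      unfold cut
      have hne : min (τ ω) (ENNReal.ofReal T) ≠ ⊤ := ((min_le_right _ _).trans_lt ENNReal.ofReal_lt_top).ne
      rw [← ENNReal.le_ofReal_iff_toReal_le hne (le_max_right _ _), min_le_iff, ENNReal.ofReal_le_ofReal_iff (le_max_right _ _), ← ofReal_max]
    simp only [e]
    by_cases hc : T ≤ max t 0
    · simp only [hc, or_true]; exact @MeasurableSet.const _ (ℱ t) True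
    · simp only [hc, or_false]; exact hτ t

lemma BST.toENN {ρ : Ω → ℝ} (h : BST ℱ T ρ) : IsStoppingTimeENN ℱ fun ω => ENNReal.ofReal (ρ ω) := fun t => by
  have : {ω | ENNReal.ofReal (ρ ω) ≤ ENNReal.ofReal t} = {ω | ρ ω ≤ max t 0} := by
    ext ω
    simp only [mem_ofPred_eq]
    rw [ofReal_max t, ENNReal.ofReal_le_ofReal_iff (le_max_right _ _)]
  rw [this]; exact h.meas t

lemma jj_ofReal {ρ : Ω → ℝ} {ω : Ω} (hρ : 0 ≤ ρ ω) : JJ r f h X (fun ω => ENNReal.ofReal (ρ ω)) ω = Pay r f h X ρ ω := by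
  unfold JJ Pay
  simp only [ENNReal.ofReal_ne_top, if_false, ENNReal.toReal_ofReal hρ]
  congr 1
  have e : {l : ℝ | 0 ≤ l ∧ ENNReal.ofReal l < ENNReal.ofReal (ρ ω)} = Ico 0 (ρ ω) := by
    ext l
    simp only [mem_ofPred_eq, mem_Ico]
    refine and_congr_right fun hl => ?_
    rw [ENNReal.ofReal_lt_ofReal_iff_of_nonneg hl]
  rw [e, Measure.restrict_congr_set Ico_ae_eq_Ioc]

namespace Sol
variable (S : Sol c μ ℱ x X M)

include S in
lemma jj_tail (hr : 0 ≤ r) (hT : 0 ≤ T) (hf : Continuous f) (hhb : ∀ y, |h y| ≤ Ch) (τ : Ω → ℝ≥0∞) (ω : Ω)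
    (hip : IntegrableOn (fun l => Real.exp (-r * l) * |f (X l ω)|) (Ioi 0)) :
    |JJ r f h X τ ω - Pay r f h X (cut T τ) ω| ≤ (∫ l in Ioi T, Real.exp (-r * l) * |f (X l ω)|) + 2 * Ch * Real.exp (-r * T) := by
  have hCh : 0 ≤ Ch := (abs_nonneg _).trans (hhb 0)
  have ht0 : 0 ≤ ∫ l in Ioi T, Real.exp (-r * l) * |f (X l ω)| := integral_nonneg fun l => by positivity
  rcases le_or_gt (τ ω) (ENNReal.ofReal T) with hτ | hτ
  · have hfin : τ ω ≠ ⊤ := (hτ.trans_lt ENNReal.ofReal_lt_top).ne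
    have e1 : JJ r f h X τ ω = JJ r f h X (fun ω => ENNReal.ofReal (cut T τ ω)) ω := by
      have : ENNReal.ofReal (cut T τ ω) = τ ω := by
        unfold cut; rw [min_eq_left hτ, ENNReal.ofReal_toReal hfin]
      unfold JJ; simp only [this]
    rw [e1, jj_ofReal (ρ := cut T τ) ENNReal.toReal_nonneg, sub_self, abs_zero]
    positivity
  · have e1 : cut T τ ω = T := by unfold cut; rw [min_eq_right hτ.le, ENNReal.toReal_ofReal hT]
    set A := {l : ℝ | 0 ≤ l ∧ ENNReal.ofReal l < τ ω} with hA
    have hAm : MeasurableSet A := (measurableSet_le measurable_const measurable_id).inter (measurableSet_lt ENNReal.measurable_ofReal measurable_const)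
    have eA : A = Icc 0 T ∪ (A ∩ Ioi T) := by
      ext l
      simp only [hA, mem_ofPred_eq, mem_union, mem_inter_iff, mem_Icc, mem_Ioi]
      constructor
      · intro hl
        rcases le_or_gt l T with h' | h'
        · exact Or.inl ⟨hl.1, h'⟩
        · exact Or.inr ⟨hl, h'⟩
      · rintro (hl | hl)
        · exact ⟨hl.1, (ENNReal.ofReal_le_ofReal hl.2).trans_lt hτ⟩
        · exact hl.1
    set φ : ℝ → ℝ := fun l => Real.exp (-r * l) * f (X l ω) with hφ
    have hφc : Continuous φ := S.phi_cont hf ω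
    have hab : ∀ l, |φ l| = Real.exp (-r * l) * |f (X l ω)| := fun l => by simp only [hφ]; rw [abs_mul, abs_of_pos (Real.exp_pos _)]
    have hTi : IntegrableOn (fun l => |φ l|) (Ioi T) := by
      simp only [hab]; exact hip.mono_set (Ioi_subset_Ioi hT)
    have hTi' : IntegrableOn φ (Ioi T) := (integrable_norm_iff hφc.measurable.aestronglyMeasurable).mp hTi
    have e2 : ∫ l in A, φ l = (∫ l in Ioc 0 T, φ l) + ∫ l in A ∩ Ioi T, φ l := by
      conv_lhs => rw [eA]
      rw [setIntegral_union ?_ (hAm.inter measurableSet_Ioi) hφc.integrableOn_Icc (hTi'.mono_set inter_subset_right), integral_Icc_eq_integral_Ioc]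
      rw [Set.disjoint_left]
      intro l hl hl'
      exact absurd hl'.2 (not_lt.mpr hl.2)
    have b1 : |∫ l in A ∩ Ioi T, φ l| ≤ ∫ l in Ioi T, |φ l| :=
      abs_integral_le_integral_abs.trans (setIntegral_mono_set hTi (ae_of_all _ fun l => abs_nonneg _) inter_subset_right.eventuallyLE)
    simp only [hab] at b1
    have b2 : |Real.exp (-r * T) * h (X T ω)| ≤ Ch * Real.exp (-r * T) := by
      rw [abs_mul, abs_of_pos (Real.exp_pos _), mul_comm]
      exact mul_le_mul_of_nonneg_right (hhb _) (Real.exp_pos _).le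
    have b3 : |if τ ω = ⊤ then 0 else Real.exp (-r * (τ ω).toReal) * h (X (τ ω).toReal ω)| ≤ Ch * Real.exp (-r * T) := by
      split_ifs with ht
      · rw [abs_zero]; positivity
      · rw [abs_mul, abs_of_pos (Real.exp_pos _), mul_comm]
        refine mul_le_mul (hhb _) (Real.exp_le_exp.mpr ?_) (Real.exp_pos _).le hCh
        have : T ≤ (τ ω).toReal := (ENNReal.ofReal_le_iff_le_toReal ht).mp hτ.le
        nlinarith
    have e3 : JJ r f h X τ ω = (∫ l in A, φ l) + (if τ ω = ⊤ then 0 else Real.exp (-r * (τ ω).toReal) * h (X (τ ω).toReal ω)) := rfl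
    have e4 : Pay r f h X (cut T τ) ω = (∫ l in Ioc 0 T, φ l) + Real.exp (-r * T) * h (X T ω) := by unfold Pay; rw [e1]
    rw [e3, e4, e2]
    rw [abs_le] at b1 b2 b3 ⊢
    constructor <;> linarith

include S in
lemma jj_int (hr : 0 < r) (hf : Continuous f) (hh : Continuous h) (hhb : ∀ y, |h y| ≤ Ch) {τ : Ω → ℝ≥0∞} (hτ : IsStoppingTimeENN ℱ τ)
    (hip : ∀ ω, IntegrableOn (fun l => Real.exp (-r * l) * |f (X l ω)|) (Ioi 0))
    (hint : Integrable (fun ω => ∫ l in Ioi (0:ℝ), Real.exp (-r * l) * |f (X l ω)|) μ) :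
    Integrable (JJ r f h X τ) μ ∧ |∫ ω, JJ r f h X τ ω ∂μ| ≤ (∫ ω, (∫ l in Ioi (0:ℝ), Real.exp (-r * l) * |f (X l ω)|) ∂μ) + 3 * Ch := by
  have hCh : 0 ≤ Ch := (abs_nonneg _).trans (hhb 0)
  have hm : Measurable (JJ r f h X τ) := by
    refine measurable_of_tendsto_metrizable (f := fun n : ℕ => Pay r f h X (cut n τ)) (fun n => S.pay_meas hf.measurable hh.measurable (cut_BST (Nat.cast_nonneg n) hτ).mea) ?_
    rw [tendsto_pi_nhds]
    intro ω
    rw [tendsto_iff_norm_sub_tendsto_zero]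
    have t1 : Tendsto (fun n : ℕ => ∫ l in Ioi (n : ℝ), Real.exp (-r * l) * |f (X l ω)|) atTop (𝓝 0) := by
      have := tendsto_setIntegral_of_antitone (μ := volume) (s := fun n : ℕ => Ioi (n : ℝ)) (f := fun l => Real.exp (-r * l) * |f (X l ω)|) (fun n => measurableSet_Ioi)
        (fun a b hab => Ioi_subset_Ioi (by exact_mod_cast hab)) ⟨0, by simpa using hip ω⟩
      have e : ⋂ n : ℕ, Ioi (n : ℝ) = ∅ := by
        ext l
        simp only [mem_iInter, mem_Ioi, mem_empty_iff_false, iff_false, not_forall, not_lt]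
        exact exists_nat_ge l
      rw [e] at this
      simpa using this
    have t2 : Tendsto (fun n : ℕ => 2 * Ch * Real.exp (-r * n)) atTop (𝓝 0) := by
      have : Tendsto (fun n : ℕ => -r * (n : ℝ)) atTop atBot := tendsto_natCast_atTop_atTop.const_mul_atTop_of_neg (by linarith)
      simpa using (Real.tendsto_exp_atBot.comp this).const_mul (2 * Ch)
    refine squeeze_zero (fun _ => norm_nonneg _) (fun n => ?_) ((add_zero (0 : ℝ)) ▸ t1.add t2)
    rw [norm_sub_rev]
    exact S.jj_tail hr.le (Nat.cast_nonneg n) hf hhb τ ω (hip ω)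
  have hb : ∀ ω, ‖JJ r f h X τ ω‖ ≤ (∫ l in Ioi (0:ℝ), Real.exp (-r * l) * |f (X l ω)|) + 3 * Ch := fun ω => by
    have h1 := S.jj_tail hr.le le_rfl hf hhb τ ω (hip ω)
    have e : Pay r f h X (cut 0 τ) ω = h (X 0 ω) := by simp [Pay, cut]
    rw [e] at h1
    have h2 := abs_sub_abs_le_abs_sub (JJ r f h X τ ω) (h (X 0 ω))
    have h3 := hhb (X 0 ω)
    simp only [mul_zero, Real.exp_zero, mul_one] at h1
    rw [Real.norm_eq_abs]; linarith
  have hg := hint.add (integrable_const (3 * Ch))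
  have hi : Integrable (JJ r f h X τ) μ := Integrable.mono' hg hm.aestronglyMeasurable (ae_of_all _ hb)
  refine ⟨hi, abs_integral_le_integral_abs.trans ((integral_mono hi.abs hg hb).trans ?_)⟩
  rw [integral_add' hint (integrable_const _)]
  simp
end Sol
end


open scoped ENNReal
set_option linter.unusedSectionVars false

section
variable {Ω : Type*} {mΩ : MeasurableSpace Ω} {μ : Measure Ω} [IsProbabilityMeasure μ] {ℱ : Filtration ℝ mΩ}
  {k : ℕ} {c : Coef k} {f h : EE k → ℝ} {Ch r : ℝ}

lemma rpow_le_q {s γ : ℝ} (hs : 0 ≤ s) (hγ : 0 ≤ γ) : s ^ γ ≤ (1 + s ^ 2) ^ ⌈γ⌉₊ := by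
  have h1 : s ≤ 1 + s ^ 2 := by nlinarith [sq_nonneg (s - 1)]
  have h2 : 1 ≤ 1 + s ^ 2 := by nlinarith [sq_nonneg s]
  calc s ^ γ ≤ (1 + s ^ 2) ^ γ := Real.rpow_le_rpow hs h1 hγ
    _ ≤ (1 + s ^ 2) ^ ((⌈γ⌉₊ : ℕ) : ℝ) := Real.rpow_le_rpow_of_exponent_le h2 (Nat.le_ceil γ)
    _ = _ := Real.rpow_natCast _ _

lemma sq_growth {Cf γ : ℝ} (hCf : 0 ≤ Cf) (hγ : 0 ≤ γ) (hfg : ∀ y, |f y| ≤ Cf * (1 + ‖y‖ ^ γ)) (y : EE k) :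
    f y ^ 2 ≤ 4 * Cf ^ 2 * (1 + ‖y‖ ^ 2) ^ (2 * ⌈γ⌉₊) := by
  have h1 := rpow_le_q (norm_nonneg y) hγ
  have h2 : 1 ≤ (1 + ‖y‖ ^ 2) ^ ⌈γ⌉₊ := one_le_pow₀ (by nlinarith [sq_nonneg ‖y‖])
  set q := (1 + ‖y‖ ^ 2) ^ ⌈γ⌉₊ with hq
  have h3 : |f y| ≤ 2 * Cf * q := (hfg y).trans (by nlinarith)
  rw [mul_comm 2, pow_mul, ← hq, ← sq_abs]
  calc |f y| ^ 2 ≤ (2 * Cf * q) ^ 2 := pow_le_pow_left₀ (abs_nonneg _) h3 2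
    _ = _ := by ring

lemma tail_exp {Cf γ Cγ : ℝ} (hCf : 0 ≤ Cf) (hγ : 0 ≤ γ) (hfg : ∀ y, |f y| ≤ Cf * (1 + ‖y‖ ^ γ)) (hf : Continuous f)
    (hr : 0 < r) (hCγr : Cγ < r) {x : EE k} {X M : ℝ → Ω → EE k} (S : Sol c μ ℱ x X M)
    (hmom : ∀ t ≥ (0:ℝ), ∫ ω, ‖X t ω‖ ^ γ ∂μ ≤ Cγ * Real.exp (Cγ * t) * (1 + ‖x‖ ^ γ)) {T : ℝ} (hT : 0 ≤ T) :
    Integrable (fun ω => ∫ l in Ioi T, Real.exp (-r * l) * |f (X l ω)|) μ ∧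
    ∫ ω, (∫ l in Ioi T, Real.exp (-r * l) * |f (X l ω)|) ∂μ ≤ Cf * (Real.exp (-r * T) / r) + Cf * (Cγ * (1 + ‖x‖ ^ γ)) * (Real.exp (-(r - Cγ) * T) / (r - Cγ)) := by
  obtain ⟨κ, hκ, H⟩ := moment (μ := μ) (ℱ := ℱ) c ⌈γ⌉₊
  have hXm : ∀ l, Measurable (X l) := fun l => (S.adapted l).mono (ℱ.le l) le_rfl
  have hpi : ∀ l ≥ 0, Integrable (fun ω => ‖X l ω‖ ^ γ) μ := fun l hl => by
    have hXl := hXm l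
    refine Integrable.mono' (H x X M S l hl).1 ?_ (ae_of_all _ fun ω => ?_)
    · have : Measurable fun ω => ‖X l ω‖ ^ γ := by fun_prop
      exact this.aestronglyMeasurable
    · rw [Real.norm_eq_abs, abs_of_nonneg (Real.rpow_nonneg (norm_nonneg _) _)]
      exact rpow_le_q (norm_nonneg _) hγ
  have hgi : ∀ l ≥ 0, Integrable (fun ω => Cf * (1 + ‖X l ω‖ ^ γ)) μ := fun l hl => ((integrable_const 1).add (hpi l hl)).const_mul Cf
  have hfi : ∀ l ≥ 0, Integrable (fun ω => |f (X l ω)|) μ := fun l hl => by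
    refine Integrable.mono' (hgi l hl) ?_ (ae_of_all _ fun ω => ?_)
    · have : Measurable fun ω => |f (X l ω)| := (hf.abs.measurable).comp (hXm l)
      exact this.aestronglyMeasurable
    · rw [Real.norm_eq_abs, abs_abs]; exact hfg _
  have n1 : -r < 0 := by linarith
  have n2 : -(r - Cγ) < 0 := by linarith
  have I1 := integrableOn_exp_mul_Ioi n1 T
  have I2 := integrableOn_exp_mul_Ioi n2 T
  obtain ⟨a, b⟩ := S.fub (s := Ioi T) measurableSet_Ioi (w := fun l => Real.exp (-r * l)) (by fun_prop) (fun l => (Real.exp_pos _).le)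
    (ψ := fun y => |f y|) hf.abs (fun _ => abs_nonneg _)
    (G := fun l => Cf * Real.exp (-r * l) + Cf * (Cγ * (1 + ‖x‖ ^ γ)) * Real.exp (-(r - Cγ) * l))
    ((I1.const_mul Cf).add (I2.const_mul _)) (fun l hl => hfi l (hT.trans (le_of_lt hl))) (fun l hl => by
      have hl0 : 0 ≤ l := hT.trans (le_of_lt hl)
      have h1 : ∫ ω, |f (X l ω)| ∂μ ≤ Cf * (1 + Cγ * Real.exp (Cγ * l) * (1 + ‖x‖ ^ γ)) := by
        refine (integral_mono (hfi l hl0) (hgi l hl0) fun ω => hfg _).trans ?_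
        rw [integral_const_mul, integral_add (integrable_const _) (hpi l hl0), integral_const, probReal_univ, one_smul]
        exact mul_le_mul_of_nonneg_left (by linarith [hmom l hl0]) hCf
      refine (mul_le_mul_of_nonneg_left h1 (Real.exp_pos _).le).trans (le_of_eq ?_)
      have : Real.exp (-(r - Cγ) * l) = Real.exp (-r * l) * Real.exp (Cγ * l) := by rw [← Real.exp_add]; congr 1; ring
      rw [this]; ring)
  refine ⟨a, b.trans (le_of_eq ?_)⟩
  rw [integral_add (I1.const_mul Cf) (I2.const_mul _), integral_const_mul, integral_const_mul, integral_exp_mul_Ioi n1, integral_exp_mul_Ioi n2, neg_div_neg_eq, neg_div_neg_eq]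

theorem main_sol {X M : EE k → ℝ → Ω → EE k} (S : ∀ x, Sol c μ ℱ x (X x) (M x)) (hf : Continuous f) (hh : Continuous h)
    (Cf γ : ℝ) (hγ : 2 ≤ γ) (hfg : ∀ y, |f y| ≤ Cf * (1 + ‖y‖ ^ γ)) (hhb : ∀ y, |h y| ≤ Ch)
    (hr : 0 < r) (Cγ : ℝ) (hCγr : Cγ < r)
    (hmom : ∀ x, ∀ t ≥ (0:ℝ), ∫ ω, ‖X x t ω‖ ^ γ ∂μ ≤ Cγ * Real.exp (Cγ * t) * (1 + ‖x‖ ^ γ))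
    (hintpath : ∀ x, ∀ ω, IntegrableOn (fun l => Real.exp (-r * l) * |f (X x l ω)|) (Set.Ioi (0:ℝ)))
    (hint : ∀ x, Integrable (fun ω => ∫ l in Set.Ioi (0:ℝ), Real.exp (-r * l) * |f (X x l ω)|) μ) :
    Continuous fun x => sSup {y : ℝ | ∃ τ : Ω → ℝ≥0∞, IsStoppingTimeENN ℱ τ ∧ y = ∫ ω, JJ r f h (X x) τ ω ∂μ} := by
  have hγ0 : 0 ≤ γ := by linarith
  have hCf : 0 ≤ Cf := by
    have := (abs_nonneg _).trans (hfg 0)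
    rw [norm_zero, Real.zero_rpow (by linarith)] at this
    linarith
  have hCh : 0 ≤ Ch := (abs_nonneg _).trans (hhb 0)
  have hCγ : 0 ≤ Cγ := by
    have h1 := hmom 0 0 le_rfl
    have h2 : 0 ≤ ∫ ω, ‖X 0 0 ω‖ ^ γ ∂μ := integral_nonneg fun ω => Real.rpow_nonneg (norm_nonneg _) _
    rw [norm_zero, Real.zero_rpow (by linarith)] at h1
    simp at h1; linarith
  set U : EE k → Set ℝ := fun x => {y : ℝ | ∃ τ : Ω → ℝ≥0∞, IsStoppingTimeENN ℱ τ ∧ y = ∫ ω, JJ r f h (X x) τ ω ∂μ} with hU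
  have hbdd : ∀ x, BddAbove (U x) := fun x => by
    refine ⟨(∫ ω, (∫ l in Ioi (0:ℝ), Real.exp (-r * l) * |f (X x l ω)|) ∂μ) + 3 * Ch, ?_⟩
    · rintro _ ⟨τ, hτ, rfl⟩
      exact (abs_le.mp ((S x).jj_int hr hf hh hhb hτ (hintpath x) (hint x)).2).2
  have hne : ∀ x, (U x).Nonempty := fun x => ⟨_, _, (BST.const (ℱ := ℱ) zero_le_one).toENN, rfl⟩
  set K := 4 * Cf ^ 2 with hK
  set m := 2 * ⌈γ⌉₊ with hm
  obtain ⟨κ, hκ, TR⟩ := trunc (μ := μ) (ℱ := ℱ) c (r := r) hr.le hf hh hhb (sq_growth hCf hγ0 hfg)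
  rw [Metric.continuous_iff]
  intro x0 ε hε
  set e := ε / 8 with he
  have he0 : 0 < e := by positivity
  set P := 1 + (‖x0‖ + 1) ^ γ with hP
  obtain ⟨T, hT1, hT2⟩ : ∃ T : ℝ, 0 < T ∧ Cf * (Real.exp (-r * T) / r) + Cf * (Cγ * P) * (Real.exp (-(r - Cγ) * T) / (r - Cγ)) + 2 * Ch * Real.exp (-r * T) < e := by
    have ex : ∀ a : ℝ, a < 0 → Tendsto (fun T : ℝ => Real.exp (a * T)) atTop (𝓝 0) := fun a ha =>
      Real.tendsto_exp_atBot.comp (tendsto_id.const_mul_atTop_of_neg ha)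
    have t1 := ((ex (-r) (by linarith)).div_const r).const_mul Cf
    have t2 := ((ex (-(r - Cγ)) (by linarith)).div_const (r - Cγ)).const_mul (Cf * (Cγ * P))
    have t3 := (ex (-r) (by linarith)).const_mul (2 * Ch)
    have t := (t1.add t2).add t3
    simp only [zero_div, mul_zero, add_zero] at t
    exact ((eventually_gt_atTop 0).and (t.eventually_lt_const he0)).exists
  set A := Real.exp (κ * T) * (1 + (‖x0‖ + 1) ^ 2) ^ m with hA
  have hA0 : 0 ≤ A := by positivity
  set N := T * K * A / e + 1 with hN
  have hN0 : 0 < N := by positivity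
  have hNe : T * (K / N * A) ≤ e := by
    have : T * (K / N * A) = T * K * A / N := by ring
    rw [this, div_le_iff₀ hN0, hN, mul_add, mul_div_cancel₀ _ he0.ne']
    linarith
  have fact1 : ∀ y, ‖y - x0‖ < 1 → ∀ ρ, BST ℱ T ρ → Integrable (Pay r f h (X y) ρ) μ ∧ |∫ ω, Pay r f h (X y) ρ ω ∂μ - ∫ ω, Pay r (clp N f) h (X y) ρ ω ∂μ| ≤ e := fun y hy ρ hρ => by
    obtain ⟨h1, h2⟩ := TR y (X y) (M y) (S y) T hT1 ρ hρ N hN0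
    refine ⟨h1, h2.trans (le_trans ?_ hNe)⟩
    have hn : ‖y‖ ≤ ‖x0‖ + 1 := by have := norm_sub_norm_le y x0; linarith
    rw [hA]
    gcongr
  have fact2 : ∀ y, ‖y - x0‖ < 1 → ∀ τ, IsStoppingTimeENN ℱ τ → |∫ ω, JJ r f h (X y) τ ω ∂μ - ∫ ω, Pay r f h (X y) (cut T τ) ω ∂μ| ≤ e := fun y hy τ hτ => by
    have hn : ‖y‖ ≤ ‖x0‖ + 1 := by have := norm_sub_norm_le y x0; linarith
    have j := ((S y).jj_int hr hf hh hhb hτ (hintpath y) (hint y)).1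
    have p := (fact1 y hy _ (cut_BST hT1.le hτ)).1
    obtain ⟨t1, t2⟩ := tail_exp hCf hγ0 hfg hf hr hCγr (S y) (hmom y) hT1.le
    rw [← integral_sub j p]
    refine abs_integral_le_integral_abs.trans ((integral_mono (j.sub p).abs (t1.add (integrable_const (2 * Ch * Real.exp (-r * T)))) fun ω => (S y).jj_tail hr.le hT1.le hf hhb τ ω (hintpath y ω)).trans ?_)
    rw [integral_add' t1 (integrable_const _), integral_const, probReal_univ, one_smul]
    have hrc : 0 < r - Cγ := by linarith
    have hp : 1 + ‖y‖ ^ γ ≤ P := by rw [hP]; gcongr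
    have : Cf * (Cγ * (1 + ‖y‖ ^ γ)) * (Real.exp (-(r - Cγ) * T) / (r - Cγ)) ≤ Cf * (Cγ * P) * (Real.exp (-(r - Cγ) * T) / (r - Cγ)) := by gcongr
    linarith
  obtain ⟨δ, hδ, rel⟩ := (S x0).bdd_rel (r := r) (B := max N Ch) hT1 hr.le (clp_cont N hf) hh (fun y => (clp_bd hN0 y).trans (le_max_left _ _)) (fun y => (hhb y).trans (le_max_right _ _)) he0
  refine ⟨min δ 1, lt_min hδ one_pos, fun y hy => ?_⟩
  rw [dist_eq_norm] at hy
  have hy1 : ‖y - x0‖ < δ := hy.trans_le (min_le_left _ _)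
  have hy2 : ‖y - x0‖ < 1 := hy.trans_le (min_le_right _ _)
  have hx2 : ‖x0 - x0‖ < 1 := by simp
  have rel' := rel y (X y) (M y) (S y) hy1
  have gen : ∀ z w, ‖z - x0‖ < 1 → ‖w - x0‖ < 1 → (∀ ρ, BST ℱ T ρ → ∃ ρ', BST ℱ T ρ' ∧ ∫ ω, Pay r (clp N f) h (X z) ρ ω ∂μ ≤ ∫ ω, Pay r (clp N f) h (X w) ρ' ω ∂μ + e) →
      sSup (U z) ≤ sSup (U w) + 4 * e := fun z w hz hw hzw => by
    refine csSup_le (hne z) ?_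
    rintro _ ⟨τ, hτ, rfl⟩
    obtain ⟨ρ', hρ', h1⟩ := hzw _ (cut_BST hT1.le hτ)
    have h2 := (abs_le.mp (fact2 z hz τ hτ)).2
    have h3 := (abs_le.mp (fact1 z hz _ (cut_BST hT1.le hτ)).2).2
    have h4 := (abs_le.mp (fact1 w hw _ hρ').2).1
    have h5 : ∫ ω, Pay r f h (X w) ρ' ω ∂μ ≤ sSup (U w) := by
      refine le_csSup (hbdd w) ⟨_, hρ'.toENN, ?_⟩
      exact integral_congr_ae (ae_of_all _ fun ω => (jj_ofReal (hρ'.nn ω)).symm)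
    linarith
  have g1 := gen x0 y hx2 hy2 fun ρ hρ => (rel' ρ hρ).1
  have g2 := gen y x0 hy2 hx2 fun ρ hρ => (rel' ρ hρ).2
  rw [Real.dist_eq, abs_lt]
  constructor <;> linarith
end


open scoped ENNReal
set_option linter.unusedSectionVars false

section
variable {k d : ℕ}

/-- columns of a matrix, with an extra zero column -/
noncomputable def colM (A : Matrix (Fin k) (Fin d) ℝ) : Fin (d + 1) → EE k :=
  Fin.cons 0 fun j => WithLp.toLp 2 fun i => A i j

lemma colM_sub (A B : Matrix (Fin k) (Fin d) ℝ) (j : Fin (d + 1)) : colM (A - B) j = colM A j - colM B j := by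
  refine Fin.cases ?_ (fun j => ?_) j
  · simp [colM]
  · ext i; simp [colM]

lemma matNorm_nn (A : Matrix (Fin k) (Fin d) ℝ) : 0 ≤ matNorm A := Real.sqrt_nonneg _

lemma colM_norm (A : Matrix (Fin k) (Fin d) ℝ) (j : Fin (d + 1)) : ‖colM A j‖ ≤ matNorm A := by
  refine Fin.cases ?_ (fun j => ?_) j
  · simpa [colM] using matNorm_nn A
  · simp only [colM, Fin.cons_succ]
    rw [EuclideanSpace.norm_eq]
    unfold matNorm
    refine Real.sqrt_le_sqrt (Finset.sum_le_sum fun i _ => ?_)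
    simp only [Real.norm_eq_abs, sq_abs]
    exact Finset.single_le_sum (f := fun j => A i j ^ 2) (fun j _ => sq_nonneg _) (Finset.mem_univ j)

/-- the signed columns -/
noncomputable def sgnCol (A : Matrix (Fin k) (Fin d) ℝ) : Fin ((d + 1) + (d + 1)) → EE k :=
  Fin.addCases (fun j => Real.sqrt (d + 1) • colM A j) (fun j => -(Real.sqrt (d + 1) • colM A j))

lemma sgnCol_sub (A B : Matrix (Fin k) (Fin d) ℝ) (l) : sgnCol (A - B) l = sgnCol A l - sgnCol B l := by
  refine Fin.addCases (fun j => ?_) (fun j => ?_) l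
  · simp only [sgnCol, Fin.addCases_left, colM_sub, smul_sub]
  · simp only [sgnCol, Fin.addCases_right, colM_sub, smul_sub]; abel

lemma sgnCol_norm (A : Matrix (Fin k) (Fin d) ℝ) (l) : ‖sgnCol A l‖ ≤ Real.sqrt (d + 1) * matNorm A := by
  have h0 := Real.sqrt_nonneg ((d : ℝ) + 1)
  refine Fin.addCases (fun j => ?_) (fun j => ?_) l
  · simp only [sgnCol, Fin.addCases_left, norm_smul, Real.norm_eq_abs, abs_of_nonneg h0]
    exact mul_le_mul_of_nonneg_left (colM_norm A j) h0
  · simp only [sgnCol, Fin.addCases_right, norm_neg, norm_smul, Real.norm_eq_abs, abs_of_nonneg h0]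
    exact mul_le_mul_of_nonneg_left (colM_norm A j) h0

/-- coefficients from drift and diffusion matrix -/
noncomputable def mkCoef (b : EE k → EE k) (σ : EE k → Matrix (Fin k) (Fin d) ℝ) (C0 : ℝ)
    (hgrowth : ∀ x, ‖b x‖ + matNorm (σ x) ≤ C0 * (1 + ‖x‖))
    (hlip : ∀ x x', ‖b x - b x'‖ + matNorm (σ x - σ x') ≤ C0 * ‖x - x'‖) : Coef k where
  b := b
  m := (d + 1) + (d + 1)
  p := fun _ => 1 / (2 * (d + 1))
  s := fun l x => sgnCol (σ x) l
  C := max 1 (Real.sqrt (d + 1) * |C0|)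
  C_one := le_max_left _ _
  p_nn := fun _ => by positivity
  p_sum := by simp; field_simp; ring
  s_mean := fun x => by
    rw [Fin.sum_univ_add]
    simp only [sgnCol, Fin.addCases_left, Fin.addCases_right, smul_neg, Finset.sum_neg_distrib, add_neg_cancel]
  b_lip := fun x y => by
    have h1 : (1:ℝ) ≤ Real.sqrt (d + 1) := Real.one_le_sqrt.mpr (by linarith [(Nat.cast_nonneg d : (0:ℝ) ≤ d)])
    have h2 := hlip x y
    have h3 := matNorm_nn (σ x - σ y)
    have h4 : C0 ≤ max 1 (Real.sqrt (d + 1) * |C0|) := le_trans (by nlinarith [le_abs_self C0, abs_nonneg C0]) (le_max_right _ _)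
    have := mul_le_mul_of_nonneg_right h4 (norm_nonneg (x - y))
    linarith
  s_lip := fun l x y => by
    rw [← sgnCol_sub]
    have h0 := Real.sqrt_nonneg ((d : ℝ) + 1)
    have h2 : matNorm (σ x - σ y) ≤ |C0| * ‖x - y‖ := by
      have := mul_le_mul_of_nonneg_right (le_abs_self C0) (norm_nonneg (x - y))
      linarith [hlip x y, norm_nonneg (b x - b y)]
    calc _ ≤ Real.sqrt (d + 1) * matNorm (σ x - σ y) := sgnCol_norm _ _
      _ ≤ Real.sqrt (d + 1) * (|C0| * ‖x - y‖) := mul_le_mul_of_nonneg_left h2 h0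
      _ = (Real.sqrt (d + 1) * |C0|) * ‖x - y‖ := by ring
      _ ≤ _ := mul_le_mul_of_nonneg_right (le_max_right _ _) (norm_nonneg _)
  b_gr := fun x => by
    have h1 : (1:ℝ) ≤ Real.sqrt (d + 1) := Real.one_le_sqrt.mpr (by linarith [(Nat.cast_nonneg d : (0:ℝ) ≤ d)])
    have h3 := matNorm_nn (σ x)
    have h4 : C0 ≤ max 1 (Real.sqrt (d + 1) * |C0|) := le_trans (by nlinarith [le_abs_self C0, abs_nonneg C0]) (le_max_right _ _)
    have := mul_le_mul_of_nonneg_right h4 (by positivity : 0 ≤ 1 + ‖x‖)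
    linarith [hgrowth x]
  s_gr := fun l x => by
    have h0 := Real.sqrt_nonneg ((d : ℝ) + 1)
    have h2 : matNorm (σ x) ≤ |C0| * (1 + ‖x‖) := by
      have := mul_le_mul_of_nonneg_right (le_abs_self C0) (by positivity : 0 ≤ 1 + ‖x‖)
      linarith [hgrowth x, norm_nonneg (b x)]
    calc _ ≤ Real.sqrt (d + 1) * matNorm (σ x) := sgnCol_norm _ _
      _ ≤ Real.sqrt (d + 1) * (|C0| * (1 + ‖x‖)) := mul_le_mul_of_nonneg_left h2 h0
      _ = (Real.sqrt (d + 1) * |C0|) * (1 + ‖x‖) := by ring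
      _ ≤ _ := mul_le_mul_of_nonneg_right (le_max_right _ _) (by positivity)

lemma sgn_quad (A : Matrix (Fin k) (Fin d) ℝ) (i j : Fin k) :
    ∑ l, (1 / (2 * ((d:ℝ) + 1))) * (sgnCol A l i * sgnCol A l j) = (A * Aᵀ) i j := by
  rw [Fin.sum_univ_add]
  simp only [sgnCol, Fin.addCases_left, Fin.addCases_right, PiLp.neg_apply, PiLp.smul_apply, smul_eq_mul, neg_mul_neg]
  rw [← Finset.sum_add_distrib, Fin.sum_univ_succ, Matrix.mul_apply]
  simp only [colM, Fin.cons_zero, Fin.cons_succ, PiLp.zero_apply, mul_zero, add_zero, zero_add, Matrix.transpose_apply]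
  refine Finset.sum_congr rfl fun l _ => ?_
  have h : Real.sqrt ((d:ℝ) + 1) * Real.sqrt (d + 1) = d + 1 := Real.mul_self_sqrt (by positivity)
  have hd : (d : ℝ) + 1 ≠ 0 := by positivity
  calc _ = (1 / ((d:ℝ) + 1)) * (Real.sqrt ((d:ℝ) + 1) * Real.sqrt (d + 1)) * (A i l * A j l) := by field_simp; ring
    _ = _ := by rw [h]; field_simp
end

lemma coord_mart {Ω : Type*} {mΩ : MeasurableSpace Ω} {μ : Measure Ω} [IsProbabilityMeasure μ] {ℱ : Filtration ℝ mΩ} {k : ℕ}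
    {M : ℝ → Ω → EE k} (h : Martingale M ℱ μ) (i : Fin k) : Martingale (fun t ω => M t ω i) ℱ μ := by
  set P : EE k →L[ℝ] ℝ := EuclideanSpace.proj i with hP
  have e : (fun t ω => M t ω i) = fun t ω => P (M t ω) := rfl
  rw [e]
  refine ⟨fun t => P.continuous.comp_stronglyMeasurable (h.1 t), fun s t hst => ?_⟩
  have h1 := P.comp_condExp_comm (m := ℱ s) (h.integrable t)
  have h2 := h.2 s t hst
  filter_upwards [h1, h2] with ω a1 a2
  simp only [Function.comp_def] at a1
  rw [← a1, a2]

lemma mkSol {Ω : Type*} {mΩ : MeasurableSpace Ω} {μ : Measure Ω} [IsProbabilityMeasure μ] {ℱ : Filtration ℝ mΩ} {k d : ℕ}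
    (b : EE k → EE k) (σ : EE k → Matrix (Fin k) (Fin d) ℝ) (C0 : ℝ)
    (hgrowth : ∀ x, ‖b x‖ + matNorm (σ x) ≤ C0 * (1 + ‖x‖))
    (hlip : ∀ x x', ‖b x - b x'‖ + matNorm (σ x - σ x') ≤ C0 * ‖x - x'‖) {x : EE k} {X : ℝ → Ω → EE k} (s : SDESolution μ ℱ b σ x X) :
    Sol (mkCoef b σ C0 hgrowth hlip) μ ℱ x X s.M where
  adapted := s.adapted
  cont := s.contPaths
  init := s.init
  mart := coord_mart s.mart
  eqn := s.eqn
  qvar := fun i j => by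
    have e : ∀ y, (mkCoef b σ C0 hgrowth hlip).a y i j = (σ y * (σ y)ᵀ) i j := fun y => sgn_quad (σ y) i j
    simp only [e]
    exact s.qvar i j

/-- Continuity of the value function of the optimal stopping problem
`u(x) = sup_τ E[∫_0^τ e^{-rl} f(X^x_l) dl + e^{-rτ} h(X^x_τ) 1_{τ<∞}]`, for `f` continuous of
polynomial growth, `h` continuous and bounded, under the discounting condition `C_γ < r`. -/
theorem value_function_continuous {Ω : Type*} {mΩ : MeasurableSpace Ω}
    (μ : Measure Ω) [IsProbabilityMeasure μ] (ℱ : Filtration ℝ mΩ) {k d : ℕ}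
    (b : EuclideanSpace ℝ (Fin k) → EuclideanSpace ℝ (Fin k))
    (σ : EuclideanSpace ℝ (Fin k) → Matrix (Fin k) (Fin d) ℝ) (C0 : ℝ)
    (hgrowth : ∀ x, ‖b x‖ + matNorm (σ x) ≤ C0 * (1 + ‖x‖))
    (hlip : ∀ x x', ‖b x - b x'‖ + matNorm (σ x - σ x') ≤ C0 * ‖x - x'‖)
    (X : EuclideanSpace ℝ (Fin k) → ℝ → Ω → EuclideanSpace ℝ (Fin k))
    (sol : ∀ x, SDESolution μ ℱ b σ x (X x))
    (f h : EuclideanSpace ℝ (Fin k) → ℝ) (hf : Continuous f) (hh : Continuous h)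
    (Cf γ : ℝ) (hγ : 2 ≤ γ) (hfg : ∀ y, |f y| ≤ Cf * (1 + ‖y‖ ^ γ))
    (Ch : ℝ) (hhb : ∀ y, |h y| ≤ Ch)
    (r : ℝ) (hr : 0 < r)
    (Cγ : ℝ) (hCγr : Cγ < r)
    (hmom : ∀ x, ∀ t ≥ (0:ℝ), ∫ ω, ‖X x t ω‖ ^ γ ∂μ ≤ Cγ * Real.exp (Cγ * t) * (1 + ‖x‖ ^ γ))
    (hintpath : ∀ x, ∀ ω, IntegrableOn (fun l => Real.exp (-r * l) * |f (X x l ω)|)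
      (Set.Ioi (0:ℝ)))
    (hint : ∀ x, Integrable
      (fun ω => ∫ l in Set.Ioi (0:ℝ), Real.exp (-r * l) * |f (X x l ω)|) μ) :
    Continuous (fun x : EuclideanSpace ℝ (Fin k) => sSup
      {y : ℝ | ∃ τ : Ω → ℝ≥0∞, IsStoppingTimeENN ℱ τ ∧
        y = ∫ ω, ((∫ l in {l : ℝ | 0 ≤ l ∧ ENNReal.ofReal l < τ ω},
              Real.exp (-r * l) * f (X x l ω)) +
            (if τ ω = ⊤ then 0 else
              Real.exp (-r * (τ ω).toReal) * h (X x (τ ω).toReal ω))) ∂μ}) := by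
  exact main_sol (fun x => mkSol b σ C0 hgrowth hlip (sol x)) hf hh Cf γ hγ hfg hhb hr Cγ hCγr hmom hintpath hint
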